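/- (Kingman-type exponential upcrossing bound) Let Γ be a finitely generated group of polynomial growth with word metric, and let (S_{B(g,r)}) be a stationary subadditive process such that S_{B(e,0)} ≤ C almost surely for some constant C > 0. Then for every interval (α,β) ⊂ ℝ there exist constants c > 0 and ρ ∈ (0,1), depending only on α, β, Γ and C, such that for all k ≥ 1: ℙ({x : the sequence (|B(i)|^{−1} S_{B(i)}(x))_{i≥0} has at least k upcrossings across (α,β)}) ≤ cρ^k. -/

import Mathlib

open Filter MeasureTheory

/-- The word norm of `g` with respect to a generating set `S` of a group. -/
noncomputable def wordNorm {Γ : Type*} [Group Γ] (S : Set Γ) (g : Γ) : ℕ :=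
  sInf {n : ℕ | ∃ f : Fin n → Γ, (∀ i, f i ∈ S ∨ (f i)⁻¹ ∈ S) ∧ g = (List.ofFn f).prod}

/-- The closed ball of radius `r` around `g` for the right-invariant word metric
`d(x,y) = ‖x y⁻¹‖`. -/
def wordBall {Γ : Type*} [Group Γ] (S : Set Γ) (g : Γ) (r : ℕ) : Set Γ :=
  {y : Γ | wordNorm S (g * y⁻¹) ≤ r}

open scoped Pointwise commutatorElement

universe u v

/-- Every finite subset `T` of `G` has powers growing at most like `n ^ d`. -/
def HasGrowth (d : ℕ) (G : Type*) [Group G] : Prop :=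
  ∀ T : Set G, T.Finite → ∃ C : ℕ, ∀ n : ℕ, (T ^ n).ncard ≤ C * (n + 1) ^ d

/-- A finite symmetric generating set containing the identity. -/
structure IsSymmGen {G : Type*} [Group G] (T : Set G) : Prop where
  finite : T.Finite
  one_mem : (1 : G) ∈ T
  inv_mem : ∀ g ∈ T, g⁻¹ ∈ T
  exists_mem_pow : ∀ g : G, ∃ n : ℕ, g ∈ T ^ n

/-- Powers of an arbitrary finite set are dominated by powers of a finite symmetric
generating set. -/
def HasDoubling (G : Type*) [Group G] : Prop :=
  ∀ A : Set G, A.Finite → ∀ T : Set G, IsSymmGen T →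
    ∃ K : ℕ, ∀ n : ℕ, (A ^ n).ncard ≤ K * (T ^ n).ncard

section Growth

variable {G : Type*} [Group G] {H : Type*} [Group H]

theorem set_finite_pow {T : Set G} (hT : T.Finite) (n : ℕ) : (T ^ n).Finite := by
  induction n with
  | zero => simp
  | succ n ih => rw [pow_succ]; exact ih.mul hT

theorem HasGrowth.of_injective {d : ℕ} (hG : HasGrowth d G) (f : H →* G)
    (hf : Function.Injective f) : HasGrowth d H := by
  intro T hT
  obtain ⟨C, hC⟩ := hG (f '' T) (hT.image f)
  refine ⟨C, fun n => ?_⟩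
  rw [← Set.ncard_image_of_injective _ hf, Set.image_pow]
  exact hC n

theorem HasGrowth.subgroup {d : ℕ} (hG : HasGrowth d G) (K : Subgroup G) : HasGrowth d K :=
  hG.of_injective K.subtype K.subtype_injective

theorem HasGrowth.of_surjective {d : ℕ} (hG : HasGrowth d G) (f : G →* H)
    (hf : Function.Surjective f) : HasGrowth d H := by
  intro T hT
  obtain ⟨g, hg'⟩ := hf.hasRightInverse
  have hg : ∀ x, f (g x) = x := hg'
  obtain ⟨C, hC⟩ := hG (g '' T) (hT.image g)
  refine ⟨C, fun n => le_trans ?_ (hC n)⟩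
  have : T ^ n = f '' ((g '' T) ^ n) := by
    rw [Set.image_pow, Function.LeftInverse.image_image hg]
  rw [this]
  exact Set.ncard_image_le (set_finite_pow (hT.image g) n)

theorem HasGrowth.quotient {d : ℕ} (hG : HasGrowth d G) (N : Subgroup G) [N.Normal] :
    HasGrowth d (G ⧸ N) :=
  hG.of_surjective (QuotientGroup.mk' N) (QuotientGroup.mk'_surjective N)

namespace IsSymmGen

variable {T : Set G}

theorem finite_pow (hT : IsSymmGen T) (n : ℕ) : (T ^ n).Finite := set_finite_pow hT.finite n

theorem pow_mono (hT : IsSymmGen T) {m n : ℕ} (h : m ≤ n) : T ^ m ⊆ T ^ n :=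
  Set.pow_subset_pow_right hT.one_mem h

theorem one_mem_pow (hT : IsSymmGen T) (n : ℕ) : (1 : G) ∈ T ^ n := Set.one_mem_pow hT.one_mem

theorem mul_mem_pow {m n : ℕ} {g h : G} (hg : g ∈ T ^ m) (hh : h ∈ T ^ n) :
    g * h ∈ T ^ (m + n) := by
  rw [pow_add]; exact Set.mul_mem_mul hg hh

theorem inv_mem_pow (hT : IsSymmGen T) {n : ℕ} {g : G} (hg : g ∈ T ^ n) : g⁻¹ ∈ T ^ n := by
  induction n generalizing g with
  | zero => simpa using hg
  | succ n ih =>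
    rw [pow_succ] at hg
    obtain ⟨a, ha, b, hb, rfl⟩ := hg
    rw [mul_inv_rev, pow_succ']
    exact Set.mul_mem_mul (hT.inv_mem b hb) (ih ha)

theorem ncard_pow_pos (hT : IsSymmGen T) (n : ℕ) : 0 < (T ^ n).ncard :=
  (Set.ncard_pos (hT.finite_pow n)).2 ⟨1, hT.one_mem_pow n⟩

theorem ncard_pow_mono (hT : IsSymmGen T) {m n : ℕ} (h : m ≤ n) :
    (T ^ m).ncard ≤ (T ^ n).ncard :=
  Set.ncard_le_ncard (hT.pow_mono h) (hT.finite_pow n)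

/-- A finite set is contained in a power of a symmetric generating set. -/
theorem exists_subset_pow (hT : IsSymmGen T) {A : Set G} (hA : A.Finite) :
    ∃ k : ℕ, A ⊆ T ^ k := by
  choose f hf using hT.exists_mem_pow
  obtain ⟨k, hk⟩ := (hA.image f).bddAbove
  exact ⟨k, fun a ha => hT.pow_mono (hk ⟨a, ha, rfl⟩) (hf a)⟩

theorem exists_pow_subset_pow (hT : IsSymmGen T) {A : Set G} (hA : A.Finite) :
    ∃ k : ℕ, ∀ n, A ^ n ⊆ T ^ (k * n) := by
  obtain ⟨k, hk⟩ := hT.exists_subset_pow hA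
  exact ⟨k, fun n => by rw [pow_mul]; exact Set.pow_subset_pow_left hk⟩

theorem hasGrowth (hT : IsSymmGen T) {d C : ℕ}
    (h : ∀ n, (T ^ n).ncard ≤ C * (n + 1) ^ d) : HasGrowth d G := by
  intro A hA
  obtain ⟨k, hk⟩ := hT.exists_pow_subset_pow hA
  refine ⟨C * (k + 1) ^ d, fun n => ?_⟩
  calc (A ^ n).ncard ≤ (T ^ (k * n)).ncard := Set.ncard_le_ncard (hk n) (hT.finite_pow _)
    _ ≤ C * (k * n + 1) ^ d := h _
    _ ≤ C * ((k + 1) * (n + 1)) ^ d := by gcongr; nlinarith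
    _ = _ := by rw [mul_pow, mul_assoc]

/-- The subgroup generated by a symmetric generating set is everything. -/
theorem closure_eq_top (hT : IsSymmGen T) : Subgroup.closure T = ⊤ := by
  rw [eq_top_iff]
  intro g _
  obtain ⟨n, hn⟩ := hT.exists_mem_pow g
  have h : ∀ n, T ^ n ⊆ (Subgroup.closure T : Set G) := by
    intro n
    induction n with
    | zero => simp
    | succ n ih =>
      rw [pow_succ]
      rintro _ ⟨a, ha, b, hb, rfl⟩
      exact mul_mem (ih ha) (Subgroup.subset_closure hb)
  exact h n hn

theorem fg (hT : IsSymmGen T) : Group.FG G := by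
  rw [Group.fg_iff]
  exact ⟨T, hT.closure_eq_top, hT.finite⟩

/-- Symmetrising a finite generating set. -/
theorem of_closure {S : Set G} (hS : S.Finite) (hgen : Subgroup.closure S = ⊤) :
    IsSymmGen (S ∪ S⁻¹ ∪ {1}) where
  finite := (hS.union hS.inv).union (Set.finite_singleton 1)
  one_mem := by simp
  inv_mem := by
    intro g hg
    simp only [Set.mem_union, Set.mem_inv, Set.mem_singleton_iff, inv_inv, inv_eq_one] at hg ⊢
    tauto
  exists_mem_pow := by
    intro g
    have hg : g ∈ Subgroup.closure S := by rw [hgen]; trivial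
    induction hg using Subgroup.closure_induction'' with
    | mem x hx => exact ⟨1, by simp [hx]⟩
    | inv_mem x hx => exact ⟨1, by simp [hx]⟩
    | one => exact ⟨0, by simp⟩
    | mul x y _ _ hx hy =>
      obtain ⟨m, hm⟩ := hx
      obtain ⟨n, hn⟩ := hy
      exact ⟨m + n, mul_mem_pow hm hn⟩

variable (G) in
theorem exists_of_fg [hG : Group.FG G] : ∃ T : Set G, IsSymmGen T := by
  obtain ⟨S, hS, hfin⟩ := Group.fg_iff.1 hG
  exact ⟨_, of_closure hfin hS⟩

theorem image_of_surjective (hT : IsSymmGen T) (f : G →* H) (hf : Function.Surjective f) :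
    IsSymmGen (f '' T) where
  finite := hT.finite.image f
  one_mem := ⟨1, hT.one_mem, map_one f⟩
  inv_mem := by
    rintro _ ⟨g, hg, rfl⟩
    exact ⟨g⁻¹, hT.inv_mem g hg, map_inv f g⟩
  exists_mem_pow := by
    intro h
    obtain ⟨g, rfl⟩ := hf h
    obtain ⟨n, hn⟩ := hT.exists_mem_pow g
    exact ⟨n, by rw [← Set.image_pow]; exact ⟨g, hn, rfl⟩⟩

theorem pow_of_pos (hT : IsSymmGen T) {k : ℕ} (hk : 0 < k) : IsSymmGen (T ^ k) where
  finite := hT.finite_pow k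
  one_mem := hT.one_mem_pow k
  inv_mem := fun _ hg => hT.inv_mem_pow hg
  exists_mem_pow := by
    intro g
    obtain ⟨n, hn⟩ := hT.exists_mem_pow g
    exact ⟨n, by rw [← pow_mul]; exact hT.pow_mono (Nat.le_mul_of_pos_left n hk) hn⟩

theorem countable (hT : IsSymmGen T) : Countable G := by
  have : (Set.univ : Set G) = ⋃ n : ℕ, T ^ n := by
    ext g; simpa using hT.exists_mem_pow g
  rw [← Set.countable_univ_iff, this]
  exact Set.countable_iUnion fun n => (hT.finite_pow n).countable

end IsSymmGen

end Growth

section SpectralGap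

variable {E : Type*} [NormedAddCommGroup E] [InnerProductSpace ℝ E]

/-- The Dirichlet form of a symmetric contraction. -/
noncomputable def dirichlet (P : E →ₗ[ℝ] E) (f : E) : ℝ := (inner ℝ f f - inner ℝ (P f) f) / 2

/-- The lazy version `(1 + P) / 2`. -/
noncomputable def lazyOp (P : E →ₗ[ℝ] E) (f : E) : E := (1 / 2 : ℝ) • (f + P f)

variable {P : E →ₗ[ℝ] E}

theorem norm_lazyOp_le (hP : ∀ f, ‖P f‖ ≤ ‖f‖) (f : E) : ‖lazyOp P f‖ ≤ ‖f‖ := by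
  unfold lazyOp
  rw [norm_smul]
  have := norm_add_le f (P f)
  have := hP f
  norm_num
  linarith

theorem dirichlet_nonneg (hP : ∀ f, ‖P f‖ ≤ ‖f‖) (f : E) : 0 ≤ dirichlet P f := by
  unfold dirichlet
  have h1 := real_inner_le_norm (P f) f
  have h2 := real_inner_self_eq_norm_sq f
  have := hP f
  have := norm_nonneg f
  nlinarith

theorem norm_sub_lazyOp_sq_le
    (hP : ∀ f, ‖P f‖ ≤ ‖f‖) (f : E) : ‖f - lazyOp P f‖ ^ 2 ≤ dirichlet P f := by
  have h : f - lazyOp P f = (1 / 2 : ℝ) • (f - P f) := by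
    unfold lazyOp
    module
  rw [h, norm_smul, mul_pow, norm_sub_sq_real]
  unfold dirichlet
  rw [real_inner_self_eq_norm_sq, real_inner_comm]
  have := hP f
  have := norm_nonneg (P f)
  norm_num
  nlinarith

theorem dirichlet_lazyOp_le (hs : ∀ f g, inner ℝ (P f) g = inner ℝ f (P g))
    (hP : ∀ f, ‖P f‖ ≤ ‖f‖) (f : E) :
    dirichlet P (lazyOp P f) ≤ dirichlet P f - ‖f - lazyOp P f‖ ^ 2 := by
  set a := f - lazyOp P f with ha
  have hl : lazyOp P f = f - a := by simp [ha]
  have hPf : P f = f - (2 : ℝ) • a := by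
    rw [ha]; unfold lazyOp; module
  rw [hl]
  unfold dirichlet
  rw [map_sub, hPf]
  have h1 : inner ℝ (P a) f = inner ℝ a (P f) := hs a f
  rw [hPf] at h1
  have h2 := real_inner_le_norm (-(P a)) a
  rw [norm_neg, inner_neg_left] at h2
  have h3 := hP a
  have h4 := norm_nonneg a
  have h5 := real_inner_self_eq_norm_sq a
  simp only [inner_sub_left, inner_sub_right, inner_smul_left, inner_smul_right, h1,
    RCLike.conj_to_real]
  simp only [inner_sub_right, inner_smul_right] at h1
  have h6 := real_inner_comm a f
  nlinarith

theorem dirichlet_iterate_le (hs : ∀ f g, inner ℝ (P f) g = inner ℝ f (P g))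
    (hP : ∀ f, ‖P f‖ ≤ ‖f‖) {c : ℝ} (hc1 : c < 1)
    (hgap : ∀ f, c * dirichlet P f ≤ ‖f - lazyOp P f‖ ^ 2) (f : E) (n : ℕ) :
    dirichlet P ((lazyOp P)^[n] f) ≤ (1 - c) ^ n * dirichlet P f := by
  induction n with
  | zero => simp
  | succ n ih =>
    rw [Function.iterate_succ_apply']
    have h1 := dirichlet_lazyOp_le hs hP ((lazyOp P)^[n] f)
    have h2 := hgap ((lazyOp P)^[n] f)
    rw [pow_succ]
    nlinarith

theorem norm_sub_iterate_le (hs : ∀ f g, inner ℝ (P f) g = inner ℝ f (P g))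
    (hP : ∀ f, ‖P f‖ ≤ ‖f‖) {c : ℝ} (hc : 0 < c) (hc1 : c < 1)
    (hgap : ∀ f, c * dirichlet P f ≤ ‖f - lazyOp P f‖ ^ 2) (f : E) (n : ℕ) :
    ‖f - (lazyOp P)^[n] f‖ ≤ √(dirichlet P f) / (1 - √(1 - c)) := by
  set q := √(1 - c) with hq
  have hq0 : 0 ≤ q := Real.sqrt_nonneg _
  have hq2 : q ^ 2 = 1 - c := Real.sq_sqrt (by linarith)
  have hq1 : q < 1 := by nlinarith
  have h : ∀ n, ‖f - (lazyOp P)^[n] f‖ ≤ (∑ i ∈ Finset.range n, q ^ i) * √(dirichlet P f) := by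
    intro n
    induction n with
    | zero => simp
    | succ n ih =>
      rw [Finset.sum_range_succ, add_mul]
      have h1 : ‖(lazyOp P)^[n] f - (lazyOp P)^[n + 1] f‖ ≤ q ^ n * √(dirichlet P f) := by
        rw [Function.iterate_succ_apply']
        have h2 := norm_sub_lazyOp_sq_le hP ((lazyOp P)^[n] f)
        have h3 := dirichlet_iterate_le hs hP hc1 hgap f n
        rw [← hq2] at h3
        refine abs_le_of_sq_le_sq' ?_ (by positivity) |>.2
        rw [mul_pow, Real.sq_sqrt (dirichlet_nonneg hP f), ← pow_mul, mul_comm n 2, pow_mul]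
        linarith
      calc ‖f - (lazyOp P)^[n + 1] f‖ = ‖(f - (lazyOp P)^[n] f) +
            ((lazyOp P)^[n] f - (lazyOp P)^[n + 1] f)‖ := by congr 1; abel
        _ ≤ _ := (norm_add_le _ _).trans (add_le_add ih h1)
  refine (h n).trans ?_
  rw [div_eq_mul_inv, mul_comm]
  refine mul_le_mul_of_nonneg_left ?_ (Real.sqrt_nonneg _)
  rw [← tsum_geometric_of_lt_one hq0 hq1]
  exact (summable_geometric_of_lt_one hq0 hq1).sum_le_tsum _ fun i _ => by positivity

end SpectralGap

section Translation

variable {G : Type*} [Group G]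

/-- Left translation on `ℓ²(G)`. -/
noncomputable def lpTranslate (t : G) :
    lp (fun _ : G => ℝ) 2 →ₗ[ℝ] lp (fun _ : G => ℝ) 2 where
  toFun f := ⟨fun x => f (t * x), by
    have h := lp.memℓp f
    change Memℓp (fun x => f (t * x)) 2
    rw [memℓp_gen_iff (by norm_num)] at h ⊢
    exact (Equiv.mulLeft t).summable_iff.2 h⟩
  map_add' f g := by ext x; rfl
  map_smul' c f := by ext x; rfl

@[simp] theorem lpTranslate_apply (t : G) (f : lp (fun _ : G => ℝ) 2) (x : G) :
    lpTranslate t f x = f (t * x) := rfl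

theorem inner_lpTranslate (t : G) (f g : lp (fun _ : G => ℝ) 2) :
    inner ℝ (lpTranslate t f) g = inner ℝ f (lpTranslate t⁻¹ g) := by
  rw [lp.inner_eq_tsum, lp.inner_eq_tsum, ← (Equiv.mulLeft t⁻¹).tsum_eq]
  simp

theorem norm_lpTranslate (t : G) (f : lp (fun _ : G => ℝ) 2) : ‖lpTranslate t f‖ = ‖f‖ := by
  have h : ‖lpTranslate t f‖ ^ 2 = ‖f‖ ^ 2 := by
    rw [← real_inner_self_eq_norm_sq, ← real_inner_self_eq_norm_sq, inner_lpTranslate]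
    congr 1
    ext x
    simp
  exact (sq_eq_sq₀ (norm_nonneg _) (norm_nonneg _)).1 h

/-- The averaging operator of the random walk driven by `T`. -/
noncomputable def walkOp (T : Finset G) :
    lp (fun _ : G => ℝ) 2 →ₗ[ℝ] lp (fun _ : G => ℝ) 2 :=
  (T.card : ℝ)⁻¹ • ∑ t ∈ T, lpTranslate t

theorem walkOp_eq (T : Finset G) (f : lp (fun _ : G => ℝ) 2) :
    walkOp T f = (T.card : ℝ)⁻¹ • ∑ t ∈ T, lpTranslate t f := by
  simp [walkOp]

theorem inner_walkOp {T : Finset G} (hT : ∀ t ∈ T, t⁻¹ ∈ T) (f g : lp (fun _ : G => ℝ) 2) :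
    inner ℝ (walkOp T f) g = inner ℝ f (walkOp T g) := by
  simp only [walkOp_eq, inner_smul_left, inner_smul_right, sum_inner, inner_sum, inner_lpTranslate,
    RCLike.conj_to_real]
  congr 1
  exact Finset.sum_nbij' (fun t => t⁻¹) (fun t => t⁻¹) hT hT (by simp) (by simp) (by simp)

theorem norm_walkOp_le (T : Finset G) (f : lp (fun _ : G => ℝ) 2) : ‖walkOp T f‖ ≤ ‖f‖ := by
  rw [walkOp_eq, norm_smul]
  have h : ‖∑ t ∈ T, lpTranslate t f‖ ≤ T.card * ‖f‖ := by
    refine (norm_sum_le _ _).trans ?_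
    simp [norm_lpTranslate]
  rcases T.eq_empty_or_nonempty with rfl | hne
  · simp
  have hpos : (0 : ℝ) < T.card := by exact_mod_cast hne.card_pos
  rw [Real.norm_of_nonneg (by positivity), inv_mul_le_iff₀ hpos]
  exact h

/-- The Dirichlet form is the sum of squares of the gradients. -/
theorem sum_norm_gradient_sq {T : Finset G} (hne : T.Nonempty) (f : lp (fun _ : G => ℝ) 2) :
    ∑ t ∈ T, ‖lpTranslate t f - f‖ ^ 2 = 4 * T.card * dirichlet (walkOp T) f := by
  have hpos : (0 : ℝ) < T.card := by exact_mod_cast hne.card_pos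
  unfold dirichlet
  simp only [walkOp_eq, inner_smul_left, sum_inner, RCLike.conj_to_real, norm_sub_sq_real,
    norm_lpTranslate, Finset.sum_add_distrib, Finset.sum_sub_distrib, Finset.sum_const,
    nsmul_eq_mul, ← Finset.mul_sum, real_inner_self_eq_norm_sq]
  field_simp
  ring

end Translation

section Folner

variable {G : Type*} [Group G]

theorem IsSymmGen.exists_lt_ncard_pow [Infinite G] {T : Set G} (hT : IsSymmGen T) (N : ℕ) :
    ∃ m, N < (T ^ m).ncard := by
  obtain ⟨s, hs⟩ := Infinite.exists_subset_card_eq G (N + 1)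
  obtain ⟨m, hm⟩ := hT.exists_subset_pow s.finite_toSet
  refine ⟨m, ?_⟩
  have := Set.ncard_le_ncard hm (hT.finite_pow m)
  rw [Set.ncard_coe_finset, hs] at this
  omega

theorem HasGrowth.exists_ncard_succ_le {d : ℕ} (hG : HasGrowth d G) {T : Set G}
    (hT : IsSymmGen T) {ε : ℝ} (hε : 0 < ε) :
    ∃ m : ℕ, ((T ^ (m + 1)).ncard : ℝ) ≤ (1 + ε) * (T ^ m).ncard := by
  by_contra! h
  obtain ⟨C, hC⟩ := hG T hT.finite
  have h1 : ∀ m : ℕ, (1 + ε) ^ m ≤ (T ^ m).ncard := by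
    intro m
    induction m with
    | zero => simp [← Set.singleton_one]
    | succ m ih => rw [pow_succ']; exact (mul_le_mul_of_nonneg_left ih (by linarith)).trans (h m).le
  have h2 := (tendsto_pow_const_div_const_pow_of_one_lt d (show 1 < 1 + ε by linarith)).comp
    (Filter.tendsto_add_atTop_nat 1)
  have h3 := (h2.const_mul (C * (1 + ε))).eventually_lt_const
    (show (C * (1 + ε)) * 0 < (1 : ℝ) by simp)
  obtain ⟨n, hn⟩ := h3.exists
  have h4 : ((T ^ n).ncard : ℝ) ≤ C * (n + 1) ^ d := by exact_mod_cast hC n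
  have h5 := (h1 n).trans h4
  have h6 : 0 < (1 + ε) ^ n := by positivity
  simp only [Function.comp, pow_succ] at hn
  push_cast at hn
  have h7 : C * (1 + ε) * ((↑n + 1) ^ d / ((1 + ε) ^ n * (1 + ε))) =
      (C * (n + 1) ^ d) / (1 + ε) ^ n := by field_simp
  rw [h7, div_lt_one h6] at hn
  linarith

/-- The indicator function of a finite set in `ℓ²`. -/
noncomputable def lpIndicator {F : Set G} (hF : F.Finite) : lp (fun _ : G => ℝ) 2 :=
  ⟨F.indicator 1, by
    change Memℓp (F.indicator 1) 2
    refine memℓp_gen (summable_of_ne_finset_zero (s := hF.toFinset) fun b hb => ?_)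
    have : b ∉ F := by simpa using hb
    simp [this]⟩

@[simp] theorem lpIndicator_apply {X : Type*} {F : Set X} (hF : F.Finite) (x : X) :
    lpIndicator hF x = F.indicator 1 x := rfl

theorem norm_lpIndicator_sq {X : Type*} {F : Set X} (hF : F.Finite) :
    ‖lpIndicator hF‖ ^ 2 = F.ncard := by
  rw [← real_inner_self_eq_norm_sq, lp.inner_eq_tsum, tsum_eq_sum (s := hF.toFinset)]
  · rw [Set.ncard_eq_toFinset_card F hF, Finset.card_eq_sum_ones]
    push_cast
    refine Finset.sum_congr rfl fun x hx => ?_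
    have : x ∈ F := by simpa using hx
    simp [this]
  · intro b hb
    have : b ∉ F := by simpa using hb
    simp [this]

theorem norm_lpIndicator_sub_sq {X : Type*} {A F : Set X} (hA : A.Finite) (hF : F.Finite)
    (h : A ⊆ F) :
    ‖lpIndicator hF - lpIndicator hA‖ ^ 2 = F.ncard - A.ncard := by
  have h1 : lpIndicator hF - lpIndicator hA =
      lpIndicator (hF.subset (Set.sdiff_subset (t := A))) := by
    ext x
    simp only [lp.coeFn_sub, Pi.sub_apply, lpIndicator_apply]
    by_cases h1 : x ∈ A
    · simp [h1, h h1]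
    · by_cases h2 : x ∈ F <;> simp [h1, h2]
  rw [h1, norm_lpIndicator_sq, Set.ncard_sdiff h hA]
  rw [Nat.cast_sub (Set.ncard_le_ncard h hF)]

theorem dirichlet_lpIndicator_le {T : Set G} (hT : IsSymmGen T) (m : ℕ) :
    dirichlet (walkOp hT.finite.toFinset) (lpIndicator (hT.finite_pow m)) ≤
      (T ^ (m + 1)).ncard - (T ^ m).ncard := by
  have hne : hT.finite.toFinset.Nonempty := ⟨1, by simpa using hT.one_mem⟩
  have hpos : (0 : ℝ) < hT.finite.toFinset.card := by exact_mod_cast hne.card_pos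
  have h1 := sum_norm_gradient_sq hne (lpIndicator (hT.finite_pow m))
  have h2 : ∀ t ∈ hT.finite.toFinset,
      ‖lpTranslate t (lpIndicator (hT.finite_pow m)) - lpIndicator (hT.finite_pow m)‖ ^ 2 ≤
      4 * ((T ^ (m + 1)).ncard - (T ^ m).ncard) := by
    intro t ht
    have ht : t ∈ T := by simpa using ht
    set A := (fun x => t⁻¹ * x) '' (T ^ m) with hA
    have hAf : A.Finite := (hT.finite_pow m).image _
    have hAs : A ⊆ T ^ (m + 1) := by
      rintro _ ⟨x, hx, rfl⟩
      rw [pow_succ']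
      exact Set.mul_mem_mul (hT.inv_mem t ht) hx
    have hAc : A.ncard = (T ^ m).ncard :=
      Set.ncard_image_of_injective _ (mul_right_injective t⁻¹)
    have htr : lpTranslate t (lpIndicator (hT.finite_pow m)) = lpIndicator hAf := by
      ext x
      have : t * x ∈ T ^ m ↔ x ∈ A := by
        constructor
        · intro h; exact ⟨t * x, h, by simp⟩
        · rintro ⟨y, hy, rfl⟩; simpa using hy
      by_cases h : x ∈ A
      · simp [h, this.2 h]
      · simp [h, mt this.1 h]
    have h3 := norm_lpIndicator_sub_sq hAf (hT.finite_pow (m + 1)) hAs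
    have h4 := norm_lpIndicator_sub_sq (hT.finite_pow m) (hT.finite_pow (m + 1))
      (hT.pow_mono (Nat.le_succ m))
    rw [hAc] at h3
    rw [htr]
    have h5 := norm_sub_le_norm_sub_add_norm_sub (lpIndicator hAf)
      (lpIndicator (hT.finite_pow (m + 1))) (lpIndicator (hT.finite_pow m))
    rw [norm_sub_rev (lpIndicator hAf) (lpIndicator (hT.finite_pow (m + 1)))] at h5
    set a := ‖lpIndicator (hT.finite_pow (m + 1)) - lpIndicator hAf‖
    set b := ‖lpIndicator (hT.finite_pow (m + 1)) - lpIndicator (hT.finite_pow m)‖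
    have := norm_nonneg (lpIndicator hAf - lpIndicator (hT.finite_pow m))
    nlinarith [sq_nonneg (a - b)]
  have h3 := Finset.sum_le_sum h2
  rw [h1, Finset.sum_const, nsmul_eq_mul] at h3
  refine le_of_mul_le_mul_left ?_ (show 0 < 4 * (hT.finite.toFinset.card : ℝ) by positivity)
  linarith

theorem sq_apply_le_norm_sq {X : Type*} (f : lp (fun _ : X => ℝ) 2) (s : Finset X) :
    ∑ x ∈ s, f x ^ 2 ≤ ‖f‖ ^ 2 := by
  have h := lp.sum_rpow_le_norm_rpow (p := 2) (by norm_num) f s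
  simpa using h

theorem abs_apply_le_norm {X : Type*} (f : lp (fun _ : X => ℝ) 2) (x : X) : |f x| ≤ ‖f‖ := by
  simpa using lp.norm_apply_le_norm (p := 2) (by norm_num) f x

theorem norm_gradient_le {T : Set G} (hT : IsSymmGen T) (f : lp (fun _ : G => ℝ) 2)
    {t : G} (ht : t ∈ T) : ‖lpTranslate t f - f‖ ^ 2 ≤
      4 * hT.finite.toFinset.card * dirichlet (walkOp hT.finite.toFinset) f := by
  rw [← sum_norm_gradient_sq ⟨1, by simpa using hT.one_mem⟩ f]
  exact Finset.single_le_sum (f := fun t => ‖lpTranslate t f - f‖ ^ 2) (fun _ _ => by positivity)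
    (by simpa using ht)

theorem abs_sub_le_of_gradient_le {T : Set G} {f : G → ℝ} {δ : ℝ}
    (h : ∀ t ∈ T, ∀ x, |f (t * x) - f x| ≤ δ) (m : ℕ) {y : G} (hy : y ∈ T ^ m) (x : G) :
    |f (y * x) - f x| ≤ m * δ := by
  induction m generalizing y with
  | zero =>
    have : y = 1 := by simpa using hy
    simp [this]
  | succ m ih =>
    rw [pow_succ'] at hy
    obtain ⟨t, ht, z, hz, rfl⟩ := hy
    have h1 := h t ht (z * x)
    have h2 := ih hz
    have h3 := abs_sub_le (f (t * (z * x))) (f (z * x)) (f x)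
    simp only [mul_assoc]
    push_cast
    linarith

theorem exists_almost_harmonic [Infinite G] {d : ℕ} (hG : HasGrowth d G) {T : Set G}
    (hT : IsSymmGen T) {η : ℝ} (hη : 0 < η) :
    ∃ f : lp (fun _ : G => ℝ) 2, ‖f - lazyOp (walkOp hT.finite.toFinset) f‖ ^ 2 <
      η * dirichlet (walkOp hT.finite.toFinset) f := by
  by_contra! hgap0
  set P := walkOp hT.finite.toFinset with hPdef
  have hs : ∀ f g, inner ℝ (P f) g = inner ℝ f (P g) :=
    inner_walkOp fun t ht => by
      simp only [Set.Finite.mem_toFinset] at ht ⊢; exact hT.inv_mem t ht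
  have hP : ∀ f, ‖P f‖ ≤ ‖f‖ := norm_walkOp_le _
  set c := min η (1 / 2) with hc
  have hc0 : 0 < c := by positivity
  have hc1 : c < 1 := lt_of_le_of_lt (min_le_right _ _) (by norm_num)
  have hgap : ∀ f, c * dirichlet P f ≤ ‖f - lazyOp P f‖ ^ 2 := fun f =>
    (mul_le_mul_of_nonneg_right (min_le_left _ _) (dirichlet_nonneg hP f)).trans (hgap0 f)
  set k := 1 - √(1 - c) with hk
  have hk0 : 0 < k := by
    have h1 : √(1 - c) < 1 := by
      rw [Real.sqrt_lt' one_pos]; linarith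
    linarith
  obtain ⟨m, hm⟩ := hG.exists_ncard_succ_le hT (ε := k ^ 2 / 4) (by positivity)
  set f := lpIndicator (hT.finite_pow m) with hf
  set N := (T ^ m).ncard with hN
  have hN0 : (0 : ℝ) < N := by exact_mod_cast hT.ncard_pow_pos m
  have hEf : dirichlet P f ≤ k ^ 2 / 4 * N := by
    have := dirichlet_lpIndicator_le hT m
    linarith
  have hfn : ‖f‖ ^ 2 = N := norm_lpIndicator_sq _
  have hdist : ∀ n, ‖f - (lazyOp P)^[n] f‖ ^ 2 ≤ N / 4 := by
    intro n
    have h1 := norm_sub_iterate_le hs hP hc0 hc1 hgap f n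
    have h2 := pow_le_pow_left₀ (norm_nonneg _) h1 2
    rw [div_pow, Real.sq_sqrt (dirichlet_nonneg hP f)] at h2
    refine h2.trans ?_
    rw [div_le_iff₀ (by positivity)]
    linarith
  have hpt : ∀ n, ∃ x, 1 / 2 ≤ (lazyOp P)^[n] f x := by
    intro n
    by_contra! hcon
    have h1 := (sq_apply_le_norm_sq (f - (lazyOp P)^[n] f) (hT.finite_pow m).toFinset).trans
      (hdist n)
    have h2 : ∑ x ∈ (hT.finite_pow m).toFinset, (1 / 4 : ℝ) <
        ∑ x ∈ (hT.finite_pow m).toFinset, (f - (lazyOp P)^[n] f) x ^ 2 := by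
      refine Finset.sum_lt_sum_of_nonempty ⟨1, by simpa using hT.one_mem_pow m⟩ fun x hx => ?_
      have hx : x ∈ T ^ m := by simpa using hx
      have h3 := hcon x
      have h4 : f x = 1 := by simp [hf, hx]
      rw [lp.coeFn_sub, Pi.sub_apply, h4]
      nlinarith
    rw [Finset.sum_const, nsmul_eq_mul, ← Set.ncard_eq_toFinset_card _ (hT.finite_pow m)] at h2
    linarith
  obtain ⟨M, hM⟩ := hT.exists_lt_ncard_pow (16 * N)
  have hcard : (0 : ℝ) < hT.finite.toFinset.card := by
    exact_mod_cast Finset.card_pos.2 ⟨1, by simpa using hT.one_mem⟩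
  have hlim : Filter.Tendsto (fun n : ℕ => (M : ℝ) ^ 2 * (4 * hT.finite.toFinset.card *
      ((1 - c) ^ n * dirichlet P f))) Filter.atTop (nhds 0) := by
    have := tendsto_pow_atTop_nhds_zero_of_lt_one (show 0 ≤ 1 - c by linarith)
      (show 1 - c < 1 by linarith)
    have := ((this.mul_const (dirichlet P f)).const_mul
      (4 * (hT.finite.toFinset.card : ℝ))).const_mul ((M : ℝ) ^ 2)
    simpa using this
  obtain ⟨n, hn⟩ := (hlim.eventually_lt_const (show (0 : ℝ) < 1 / 16 by norm_num)).exists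
  set g := (lazyOp P)^[n] f with hg
  obtain ⟨x, hx⟩ := hpt n
  set δ := √(4 * hT.finite.toFinset.card * dirichlet P g) with hδ
  have hE0 := dirichlet_nonneg hP g
  have hgrad : ∀ t ∈ T, ∀ x, |g (t * x) - g x| ≤ δ := by
    intro t ht x
    refine (abs_apply_le_norm (lpTranslate t g - g) x).trans ?_
    exact Real.le_sqrt_of_sq_le (norm_gradient_le hT g ht)
  have hδM : M * δ ≤ 1 / 4 := by
    refine abs_le_of_sq_le_sq' ?_ (by norm_num) |>.2
    rw [mul_pow, Real.sq_sqrt (by positivity)]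
    refine le_trans ?_ (hn.le.trans (by norm_num))
    gcongr
    exact dirichlet_iterate_le hs hP hc1 hgap f n
  have hgn : ‖g‖ ≤ ‖f‖ := by
    have : ∀ n, ‖(lazyOp P)^[n] f‖ ≤ ‖f‖ := by
      intro n
      induction n with
      | zero => simp
      | succ n ih => rw [Function.iterate_succ_apply']; exact (norm_lazyOp_le hP _).trans ih
    exact this n
  have hlow := sq_apply_le_norm_sq g ((hT.finite_pow M).toFinset.map (mulRightEmbedding x))
  rw [Finset.sum_map] at hlow
  have hlow2 : ∑ y ∈ (hT.finite_pow M).toFinset, (1 / 16 : ℝ) ≤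
      ∑ y ∈ (hT.finite_pow M).toFinset, g (mulRightEmbedding x y) ^ 2 := by
    refine Finset.sum_le_sum fun y hy => ?_
    have hy : y ∈ T ^ M := by simpa using hy
    have h1 := abs_sub_le_of_gradient_le hgrad M hy x
    have h2 := abs_le.1 (h1.trans hδM)
    rw [mulRightEmbedding_apply]
    have : 1 / 4 ≤ g (y * x) := by linarith [h2.1]
    nlinarith
  rw [Finset.sum_const, nsmul_eq_mul, ← Set.ncard_eq_toFinset_card _ (hT.finite_pow M)] at hlow2
  have h1 : ‖g‖ ^ 2 ≤ N := by rw [← hfn]; gcongr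
  have h2 : (16 * N : ℝ) < (T ^ M).ncard := by exact_mod_cast hM
  linarith

end Folner

section Harmonic

variable {G : Type*} [Group G]

theorem lpTranslate_mul (s t : G) (f : lp (fun _ : G => ℝ) 2) :
    lpTranslate (t * s) f = lpTranslate s (lpTranslate t f) := by
  ext x
  simp [mul_assoc]

theorem exists_approx_harmonic [Infinite G] {d : ℕ} (hG : HasGrowth d G) {T : Set G}
    (hT : IsSymmGen T) {η : ℝ} (hη : 0 < η) :
    ∃ h : G → ℝ, h 1 = 0 ∧ (∀ t ∈ T, ∀ x, |h (t * x) - h x| ≤ 1) ∧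
      (∀ x, |∑ t ∈ hT.finite.toFinset, (h (t * x) - h x)| ≤ η) ∧ ∃ t ∈ T, h t = 1 := by
  have hne : hT.finite.toFinset.Nonempty := ⟨1, by simpa using hT.one_mem⟩
  set N : ℝ := (hT.finite.toFinset.card : ℝ) with hN
  have hN0 : 0 < N := Nat.cast_pos.2 hne.card_pos
  obtain ⟨f, hf⟩ := exists_almost_harmonic hG hT (η := η ^ 2 / N ^ 2) (by positivity)
  set P := walkOp hT.finite.toFinset with hPdef
  have hP : ∀ f, ‖P f‖ ≤ ‖f‖ := norm_walkOp_le _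
  have hE : 0 < dirichlet P f := by
    rcases (dirichlet_nonneg hP f).eq_or_lt with h | h
    · rw [← h, mul_zero] at hf
      exact absurd hf (not_lt.2 (by positivity))
    · exact h
  obtain ⟨t₀, ht₀, hmax⟩ := Finset.exists_max_image hT.finite.toFinset
    (fun t => ‖lpTranslate t f - f‖) hne
  set w := lpTranslate t₀ f - f with hw
  have hD : 4 * dirichlet P f ≤ ‖w‖ ^ 2 := by
    have h1 := sum_norm_gradient_sq hne f
    have h2 : ∑ t ∈ hT.finite.toFinset, ‖lpTranslate t f - f‖ ^ 2 ≤
        ∑ t ∈ hT.finite.toFinset, ‖w‖ ^ 2 :=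
      Finset.sum_le_sum fun t ht => pow_le_pow_left₀ (norm_nonneg _) (hmax t ht) 2
    rw [h1, Finset.sum_const, nsmul_eq_mul] at h2
    refine le_of_mul_le_mul_left ?_ hN0
    linarith
  have hw0 : 0 < ‖w‖ := by
    rcases (norm_nonneg w).eq_or_lt with h | h
    · rw [← h] at hD; nlinarith
    · exact h
  set v : lp (fun _ : G => ℝ) 2 := (‖w‖ ^ 2)⁻¹ • w with hv
  have hvn : ‖v‖ = ‖w‖⁻¹ := by
    rw [hv, norm_smul, norm_inv, norm_pow, norm_norm]
    field_simp
  have hdiff : ∀ t x : G, inner ℝ (lpTranslate (t * x) f - f) v - inner ℝ (lpTranslate x f - f) v =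
      inner ℝ (lpTranslate x (lpTranslate t f - f)) v := by
    intro t x
    rw [← inner_sub_left, map_sub, lpTranslate_mul]
    congr 1
    abel
  refine ⟨fun x => inner ℝ (lpTranslate x f - f) v, ?_, ?_, ?_, t₀, by simpa using ht₀, ?_⟩
  · have : lpTranslate 1 f - f = 0 := by ext x; simp
    simp only [this, inner_zero_left]
  · intro t ht x
    simp only
    rw [hdiff]
    refine (abs_real_inner_le_norm _ _).trans ?_
    rw [norm_lpTranslate, hvn, mul_inv_le_iff₀ hw0, one_mul]
    exact hmax t (by simpa using ht)
  · intro x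
    simp only [hdiff]
    rw [← sum_inner, ← map_sum]
    refine (abs_real_inner_le_norm _ _).trans ?_
    rw [norm_lpTranslate, hvn, mul_inv_le_iff₀ hw0]
    have h1 : ∑ t ∈ hT.finite.toFinset, (lpTranslate t f - f) = (-(2 * N)) • (f - lazyOp P f) := by
      have h2 : P f = N⁻¹ • ∑ t ∈ hT.finite.toFinset, lpTranslate t f := walkOp_eq _ _
      have h3 : ∑ t ∈ hT.finite.toFinset, lpTranslate t f = N • P f := by
        rw [h2, smul_smul, mul_inv_cancel₀ hN0.ne', one_smul]
      rw [Finset.sum_sub_distrib, h3, Finset.sum_const, ← Nat.cast_smul_eq_nsmul ℝ, ← hN]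
      unfold lazyOp
      module
    rw [h1, norm_smul, norm_neg, Real.norm_of_nonneg (by positivity)]
    refine abs_le_of_sq_le_sq' ?_ (by positivity) |>.2
    calc (2 * N * ‖f - lazyOp P f‖) ^ 2 = 4 * N ^ 2 * ‖f - lazyOp P f‖ ^ 2 := by ring
      _ ≤ 4 * N ^ 2 * (η ^ 2 / N ^ 2 * dirichlet P f) := by gcongr
      _ = η ^ 2 * (4 * dirichlet P f) := by field_simp
      _ ≤ η ^ 2 * ‖w‖ ^ 2 := by gcongr
      _ = _ := by ring
  · simp only
    rw [← hw, hv, inner_smul_right, real_inner_self_eq_norm_sq]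
    field_simp

/-- An infinite group of polynomial growth carries a nonconstant Lipschitz harmonic function. -/
theorem exists_harmonic [Infinite G] {d : ℕ} (hG : HasGrowth d G) {T : Set G}
    (hT : IsSymmGen T) :
    ∃ h : G → ℝ, h 1 = 0 ∧ (∀ t ∈ T, ∀ x, |h (t * x) - h x| ≤ 1) ∧
      (∀ x, ∑ t ∈ hT.finite.toFinset, (h (t * x) - h x) = 0) ∧ ∃ t, h t ≠ 0 := by
  have : Countable G := hT.countable
  choose! h h1 hlip hharm t ht ht1 using
    fun n : ℕ => exists_approx_harmonic hG hT (η := 1 / ((n : ℝ) + 1)) (by positivity)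
  choose m hm using hT.exists_mem_pow
  have hbd : ∀ n, h n ∈ Set.univ.pi fun x => Set.Icc (-(m x : ℝ)) (m x) := by
    intro n x _
    have := abs_sub_le_of_gradient_le (hlip n) (m x) (hm x) 1
    rw [h1, mul_one, sub_zero, mul_one] at this
    exact abs_le.1 this
  obtain ⟨g, -, φ, hφ, hlim⟩ :=
    (isCompact_univ_pi fun x => isCompact_Icc (a := -(m x : ℝ)) (b := m x)).tendsto_subseq hbd
  rw [tendsto_pi_nhds] at hlim
  refine ⟨g, ?_, ?_, ?_, ?_⟩
  · refine tendsto_nhds_unique (hlim 1) ?_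
    simp [h1]
  · intro t ht x
    refine le_of_tendsto ((hlim (t * x)).sub (hlim x)).abs (Filter.Eventually.of_forall fun n => ?_)
    exact hlip _ t ht x
  · intro x
    have h2 := (tendsto_finsetSum hT.finite.toFinset
      fun t _ => (hlim (t * x)).sub (hlim x)).abs
    have h3 : Filter.Tendsto (fun n : ℕ => 1 / ((φ n : ℝ) + 1)) Filter.atTop (nhds 0) :=
      (tendsto_one_div_add_atTop_nhds_zero_nat (𝕜 := ℝ)).comp hφ.tendsto_atTop
    have h4 := le_of_tendsto_of_tendsto' h2 h3 fun n => hharm (φ n) x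
    exact abs_eq_zero.1 (le_antisymm h4 (abs_nonneg _))
  · by_contra! hcon
    have h2 : Filter.Tendsto (fun n => ∑ s ∈ hT.finite.toFinset, (h (φ n) s) ^ 2)
        Filter.atTop (nhds (∑ s ∈ hT.finite.toFinset, (g s) ^ 2)) :=
      tendsto_finsetSum _ fun s _ => (hlim s).pow 2
    have h3 := ge_of_tendsto' (b := 1) h2 fun n => by
      have := Finset.single_le_sum (f := fun s => (h (φ n) s) ^ 2) (s := hT.finite.toFinset)
        (fun _ _ => by positivity) (a := t (φ n)) (by simpa using ht _)
      simpa [ht1] using this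
    simp [hcon] at h3
    linarith

end Harmonic

section Poincare

variable {G : Type*} [Group G] {T : Set G}

namespace IsSymmGen

/-- The ball of radius `n` around `1` as a finset. -/
noncomputable def ball (hT : IsSymmGen T) (n : ℕ) : Finset G := (hT.finite_pow n).toFinset

@[simp] theorem mem_ball (hT : IsSymmGen T) {n : ℕ} {g : G} : g ∈ hT.ball n ↔ g ∈ T ^ n := by
  simp [ball]

theorem card_ball (hT : IsSymmGen T) (n : ℕ) : (hT.ball n).card = (T ^ n).ncard :=
  (Set.ncard_eq_toFinset_card _ _).symm

theorem ball_mono (hT : IsSymmGen T) {m n : ℕ} (h : m ≤ n) : hT.ball m ⊆ hT.ball n :=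
  fun _ hg => hT.mem_ball.2 (hT.pow_mono h (hT.mem_ball.1 hg))

/-- The squared gradient of `f`. -/
noncomputable def energy (hT : IsSymmGen T) (f : G → ℝ) (w : G) : ℝ :=
  ∑ t ∈ hT.ball 1, (f (t * w) - f w) ^ 2

theorem energy_nonneg (hT : IsSymmGen T) (f : G → ℝ) (w : G) : 0 ≤ hT.energy f w :=
  Finset.sum_nonneg fun _ _ => sq_nonneg _

theorem sq_le_energy (hT : IsSymmGen T) (f : G → ℝ) (w : G) {t : G} (ht : t ∈ T) :
    (f (t * w) - f w) ^ 2 ≤ hT.energy f w :=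
  Finset.single_le_sum (f := fun t => (f (t * w) - f w) ^ 2) (fun _ _ => sq_nonneg _)
    (by simpa using ht)

theorem sum_sq_sub_le (hT : IsSymmGen T) (f : G → ℝ) (A A' : Finset G) (k : ℕ)
    (h : ∀ j ≤ k, ∀ u ∈ T ^ j, ∀ a ∈ A, u * a ∈ A') {u : G} (hu : u ∈ T ^ k) :
    ∑ y ∈ A, (f (u * y) - f y) ^ 2 ≤ (k : ℝ) ^ 2 * ∑ w ∈ A', hT.energy f w := by
  induction k generalizing u with
  | zero =>
    have : u = 1 := by simpa using hu
    simp [this]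
  | succ k ih =>
    rw [pow_succ'] at hu
    obtain ⟨t, ht, u', hu', rfl⟩ := hu
    have ih' := ih (fun j hj => h j (hj.trans (Nat.le_succ k))) hu'
    set E := ∑ w ∈ A', hT.energy f w with hE
    have h1 : ∑ y ∈ A, (f (t * (u' * y)) - f (u' * y)) ^ 2 ≤ E := by
      calc ∑ y ∈ A, (f (t * (u' * y)) - f (u' * y)) ^ 2 ≤ ∑ y ∈ A, hT.energy f (u' * y) :=
            Finset.sum_le_sum fun y _ => hT.sq_le_energy f _ ht
        _ = ∑ w ∈ A.map (mulLeftEmbedding u'), hT.energy f w := by simp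
        _ ≤ E := Finset.sum_le_sum_of_subset_of_nonneg
            (fun w hw => by
              obtain ⟨a, ha, rfl⟩ := Finset.mem_map.1 hw
              exact h k (Nat.le_succ k) u' hu' a ha)
            fun w _ _ => hT.energy_nonneg f w
    simp only [mul_assoc]
    rcases Nat.eq_zero_or_pos k with rfl | hk
    · have : u' = 1 := by simpa using hu'
      subst this
      simpa using h1
    have hk' : (0 : ℝ) < k := by exact_mod_cast hk
    calc ∑ y ∈ A, (f (t * (u' * y)) - f y) ^ 2
        ≤ ∑ y ∈ A, ((k + 1) / k * (f (u' * y) - f y) ^ 2 +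
            (k + 1) * (f (t * (u' * y)) - f (u' * y)) ^ 2) := by
          refine Finset.sum_le_sum fun y _ => ?_
          set a := f (u' * y) - f y
          set b := f (t * (u' * y)) - f (u' * y)
          have : f (t * (u' * y)) - f y = a + b := by simp only [a, b]; ring
          rw [this]
          have h2 : (k + 1) / k * a ^ 2 + (k + 1) * b ^ 2 - (a + b) ^ 2 =
              (a - k * b) ^ 2 / k := by field_simp; ring
          have h3 : 0 ≤ (a - k * b) ^ 2 / k := by positivity
          linarith
      _ = (k + 1) / k * ∑ y ∈ A, (f (u' * y) - f y) ^ 2 +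
            (k + 1) * ∑ y ∈ A, (f (t * (u' * y)) - f (u' * y)) ^ 2 := by
          rw [Finset.sum_add_distrib, Finset.mul_sum, Finset.mul_sum]
      _ ≤ (k + 1) / k * (k ^ 2 * E) + (k + 1) * E := by gcongr
      _ = _ := by push_cast; field_simp

theorem poincare (hT : IsSymmGen T) (f : G → ℝ) (r : ℕ) (hf : ∑ b ∈ hT.ball r, f b = 0) :
    ((T ^ r).ncard : ℝ) * ∑ b ∈ hT.ball r, f b ^ 2 ≤
      2 * (r : ℝ) ^ 2 * (T ^ (2 * r)).ncard * ∑ w ∈ hT.ball (3 * r), hT.energy f w := by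
  have h1 : ∑ y ∈ hT.ball r, ∑ z ∈ hT.ball r, (f z - f y) ^ 2 =
      2 * ((T ^ r).ncard * ∑ b ∈ hT.ball r, f b ^ 2) := by
    have : ∀ y z, (f z - f y) ^ 2 = f z ^ 2 - 2 * f y * f z + f y ^ 2 := fun y z => by ring
    simp only [this, Finset.sum_add_distrib, Finset.sum_sub_distrib, ← Finset.mul_sum, hf,
      Finset.sum_const, nsmul_eq_mul, hT.card_ball, mul_zero]
    ring
  have h2 : ∑ y ∈ hT.ball r, ∑ z ∈ hT.ball r, (f z - f y) ^ 2 ≤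
      ∑ y ∈ hT.ball r, ∑ u ∈ hT.ball (2 * r), (f (u * y) - f y) ^ 2 := by
    refine Finset.sum_le_sum fun y hy => ?_
    have h3 : ∑ z ∈ hT.ball r, (f z - f y) ^ 2 =
        ∑ u ∈ (hT.ball r).map (mulRightEmbedding y⁻¹), (f (u * y) - f y) ^ 2 := by simp
    rw [h3]
    refine Finset.sum_le_sum_of_subset_of_nonneg (fun w hw => ?_) fun _ _ _ => sq_nonneg _
    obtain ⟨z, hz, rfl⟩ := Finset.mem_map.1 hw
    rw [mem_ball] at *
    rw [two_mul]
    exact mul_mem_pow hz (hT.inv_mem_pow hy)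
  rw [h1, Finset.sum_comm] at h2
  have h3 : ∑ u ∈ hT.ball (2 * r), ∑ y ∈ hT.ball r, (f (u * y) - f y) ^ 2 ≤
      ∑ u ∈ hT.ball (2 * r), (2 * r : ℕ) ^ 2 * ∑ w ∈ hT.ball (3 * r), hT.energy f w := by
    refine Finset.sum_le_sum fun u hu => ?_
    refine hT.sum_sq_sub_le f _ _ _ (fun j hj u hu a ha => ?_) (hT.mem_ball.1 hu)
    rw [mem_ball] at *
    exact hT.pow_mono (by omega) (mul_mem_pow hu ha)
  rw [Finset.sum_const, nsmul_eq_mul, hT.card_ball] at h3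
  push_cast at h3
  have := h2.trans h3
  linarith

/-- Packing bound for disjoint balls. -/
theorem packing (hT : IsSymmGen T) {s m : ℕ} (X : Finset G) (z : G)
    (hX : (X : Set G).PairwiseDisjoint fun x => (hT.ball s).map (mulRightEmbedding x))
    (h : ∀ x ∈ X, ∀ b ∈ T ^ s, b * x * z⁻¹ ∈ T ^ m) :
    X.card * (T ^ s).ncard ≤ (T ^ m).ncard := by
  classical
  have h1 : (X.biUnion fun x => (hT.ball s).map (mulRightEmbedding x)).card =
      X.card * (T ^ s).ncard := by
    rw [Finset.card_biUnion (fun x hx y hy hxy => hX hx hy hxy)]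
    simp [hT.card_ball]
  rw [← h1, ← hT.card_ball m, ← Finset.card_map (mulRightEmbedding z) (s := hT.ball m)]
  refine Finset.card_le_card fun w hw => ?_
  rw [Finset.mem_map]
  simp only [Finset.mem_biUnion, Finset.mem_map, mem_ball, mulRightEmbedding_apply] at hw
  obtain ⟨x, hx, b, hb, rfl⟩ := hw
  exact ⟨b * x * z⁻¹, hT.mem_ball.2 (h x hx b hb), by simp⟩

/-- Maximal separated sets. -/
theorem exists_net (hT : IsSymmGen T) (R s : ℕ) : ∃ X : Finset G, X ⊆ hT.ball R ∧
    ((X : Set G).PairwiseDisjoint fun x => (hT.ball s).map (mulRightEmbedding x)) ∧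
    ∀ y ∈ hT.ball R, ∃ x ∈ X, y * x⁻¹ ∈ T ^ (2 * s) := by
  classical
  set S := (hT.ball R).powerset.filter fun X : Finset G => (X : Set G).PairwiseDisjoint
    fun x => (hT.ball s).map (mulRightEmbedding x) with hS
  obtain ⟨X, hX, hmax⟩ := Finset.exists_max_image S (fun X => X.card) ⟨∅, by simp [hS]⟩
  simp only [hS, Finset.mem_filter, Finset.mem_powerset] at hX hmax
  refine ⟨X, hX.1, hX.2, fun y hy => ?_⟩
  by_contra! hcon
  have hyX : y ∉ X := fun h => hcon y h (by simpa using hT.one_mem_pow _)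
  have := hmax (insert y X) ⟨Finset.insert_subset hy hX.1, by
    rw [Finset.coe_insert, Set.pairwiseDisjoint_insert]
    refine ⟨hX.2, fun x hx _ => ?_⟩
    rw [Finset.disjoint_left]
    intro w hw hw'
    simp only [Finset.mem_map, mem_ball, mulRightEmbedding_apply] at hw hw'
    obtain ⟨b, hb, rfl⟩ := hw
    obtain ⟨b', hb', h⟩ := hw'
    refine hcon x hx ?_
    have : y * x⁻¹ = b⁻¹ * b' := by rw [eq_inv_mul_iff_mul_eq, ← mul_assoc, ← h]; group
    rw [this, two_mul]
    exact mul_mem_pow (hT.inv_mem_pow hb) hb'⟩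
  rw [Finset.card_insert_of_notMem hyX] at this
  omega

/-- A function with vanishing averages on the balls around a net is controlled by its energy. -/
theorem sum_sq_le_of_net (hT : IsSymmGen T) (f : G → ℝ) {R s : ℕ} {X : Finset G}
    (hXR : X ⊆ hT.ball R)
    (hX : (X : Set G).PairwiseDisjoint fun x => (hT.ball s).map (mulRightEmbedding x))
    (hcov : ∀ y ∈ hT.ball R, ∃ x ∈ X, y * x⁻¹ ∈ T ^ (2 * s))
    (hf : ∀ x ∈ X, ∑ b ∈ hT.ball (2 * s), f (b * x) = 0) {K : ℝ}
    (hK : ((T ^ (8 * s)).ncard : ℝ) ≤ K * (T ^ s).ncard) :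
    ∑ y ∈ hT.ball R, f y ^ 2 ≤
      8 * (s : ℝ) ^ 2 * K ^ 2 * ∑ w ∈ hT.ball (R + 6 * s), hT.energy f w := by
  classical
  have hvs : (0 : ℝ) < (T ^ s).ncard := by exact_mod_cast hT.ncard_pow_pos s
  have hK0 : 0 < K := by
    have h8 : (0 : ℝ) < (T ^ (8 * s)).ncard := by exact_mod_cast hT.ncard_pow_pos (8 * s)
    by_contra! h
    nlinarith
  have hen := hT.energy_nonneg f
  have h1 : ∑ y ∈ hT.ball R, f y ^ 2 ≤ ∑ x ∈ X, ∑ b ∈ hT.ball (2 * s), f (b * x) ^ 2 := by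
    have : ∀ x ∈ X, ∑ b ∈ hT.ball (2 * s), f (b * x) ^ 2 =
        ∑ y ∈ (hT.ball (2 * s)).map (mulRightEmbedding x), f y ^ 2 := fun x _ => by simp
    rw [Finset.sum_congr rfl this]
    choose! c hcX hc using hcov
    rw [← Finset.sum_fiberwise_of_maps_to hcX]
    refine Finset.sum_le_sum fun x _ => Finset.sum_le_sum_of_subset_of_nonneg (fun y hy => ?_)
      fun _ _ _ => sq_nonneg _
    obtain ⟨hyR, rfl⟩ := Finset.mem_filter.1 hy
    simp only [Finset.mem_map, mem_ball, mulRightEmbedding_apply]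
    exact ⟨_, hc y hyR, by group⟩
  have h2 : ∀ x ∈ X, ∑ b ∈ hT.ball (2 * s), f (b * x) ^ 2 ≤
      8 * (s : ℝ) ^ 2 * K * ∑ w ∈ hT.ball (6 * s), hT.energy f (w * x) := by
    intro x hx
    have hp := hT.poincare (fun b => f (b * x)) (2 * s) (hf x hx)
    have he : ∀ w, hT.energy (fun b => f (b * x)) w = hT.energy f (w * x) := fun w => by
      simp [energy, mul_assoc]
    simp only [he] at hp
    rw [show 3 * (2 * s) = 6 * s by ring, show 2 * (2 * s) = 4 * s by ring] at hp
    set E := ∑ w ∈ hT.ball (6 * s), hT.energy f (w * x) with hE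
    have hE0 : 0 ≤ E := Finset.sum_nonneg fun _ _ => hen _
    have h3 : ((T ^ (4 * s)).ncard : ℝ) ≤ K * (T ^ (2 * s)).ncard := by
      have h4 : ((T ^ (4 * s)).ncard : ℝ) ≤ (T ^ (8 * s)).ncard := by
        exact_mod_cast hT.ncard_pow_mono (by omega)
      have h5 : ((T ^ s).ncard : ℝ) ≤ (T ^ (2 * s)).ncard := by
        exact_mod_cast hT.ncard_pow_mono (by omega)
      have := mul_le_mul_of_nonneg_left h5 hK0.le
      linarith
    have hv2 : (0 : ℝ) < (T ^ (2 * s)).ncard := by exact_mod_cast hT.ncard_pow_pos (2 * s)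
    refine le_of_mul_le_mul_left (hp.trans ?_) hv2
    calc 2 * ((2 * s : ℕ) : ℝ) ^ 2 * (T ^ (4 * s)).ncard * E
        ≤ 2 * ((2 * s : ℕ) : ℝ) ^ 2 * (K * (T ^ (2 * s)).ncard) * E := by gcongr
      _ = _ := by push_cast; ring
  have h3 : ∑ x ∈ X, ∑ w ∈ hT.ball (6 * s), hT.energy f (w * x) ≤
      K * ∑ w ∈ hT.ball (R + 6 * s), hT.energy f w := by
    have e1 : ∀ x ∈ X, ∑ w ∈ hT.ball (6 * s), hT.energy f (w * x) =
        ∑ z ∈ hT.ball (R + 6 * s), if z * x⁻¹ ∈ T ^ (6 * s) then hT.energy f z else 0 := by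
      intro x hx
      rw [← Finset.sum_filter]
      refine Finset.sum_nbij' (fun w => w * x) (fun z => z * x⁻¹) ?_ ?_ ?_ ?_ ?_
      · intro w hw
        have hx' := hXR hx
        simp only [mem_ball, Finset.mem_filter] at *
        exact ⟨by rw [add_comm]; exact mul_mem_pow hw hx', by simpa using hw⟩
      · intro z hz
        simp only [mem_ball, Finset.mem_filter] at *
        exact hz.2
      · intro w _; simp
      · intro w _; simp
      · intro w _; rfl
    rw [Finset.sum_congr rfl e1, Finset.sum_comm, Finset.mul_sum]
    refine Finset.sum_le_sum fun z _ => ?_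
    rw [← Finset.sum_filter, Finset.sum_const, nsmul_eq_mul]
    refine mul_le_mul_of_nonneg_right ?_ (hen z)
    have hpk := hT.packing (s := s) (m := 7 * s) (X.filter fun x => z * x⁻¹ ∈ T ^ (6 * s)) z
      (hX.subset (Finset.coe_subset.2 (Finset.filter_subset _ _))) (fun x hx b hb => by
        have h4 := hT.inv_mem_pow (Finset.mem_filter.1 hx).2
        rw [mul_inv_rev, inv_inv] at h4
        rw [show 7 * s = s + 6 * s by ring, mul_assoc]
        exact mul_mem_pow hb h4)
    have h5 : (((X.filter fun x => z * x⁻¹ ∈ T ^ (6 * s)).card : ℝ)) * (T ^ s).ncard ≤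
        (T ^ (8 * s)).ncard := by
      exact_mod_cast hpk.trans (hT.ncard_pow_mono (by omega))
    exact le_of_mul_le_mul_right (h5.trans hK) hvs
  calc ∑ y ∈ hT.ball R, f y ^ 2 ≤ ∑ x ∈ X, ∑ b ∈ hT.ball (2 * s), f (b * x) ^ 2 := h1
    _ ≤ ∑ x ∈ X, 8 * (s : ℝ) ^ 2 * K * ∑ w ∈ hT.ball (6 * s), hT.energy f (w * x) :=
        Finset.sum_le_sum h2
    _ = 8 * (s : ℝ) ^ 2 * K * ∑ x ∈ X, ∑ w ∈ hT.ball (6 * s), hT.energy f (w * x) := by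
        rw [Finset.mul_sum]
    _ ≤ 8 * (s : ℝ) ^ 2 * K * (K * ∑ w ∈ hT.ball (R + 6 * s), hT.energy f w) := by gcongr
    _ = _ := by ring

end IsSymmGen

end Poincare

section Caccioppoli

variable {G : Type*} [Group G] {T : Set G}

namespace IsSymmGen

/-- The word length with respect to `T`. -/
noncomputable def len (_hT : IsSymmGen T) (g : G) : ℕ := sInf {n | g ∈ T ^ n}

theorem len_le_iff (hT : IsSymmGen T) {g : G} {n : ℕ} : hT.len g ≤ n ↔ g ∈ T ^ n :=
  ⟨fun h => hT.pow_mono h (Nat.sInf_mem (hT.exists_mem_pow g)), fun h => Nat.sInf_le h⟩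

theorem mem_pow_len (hT : IsSymmGen T) (g : G) : g ∈ T ^ hT.len g := hT.len_le_iff.1 le_rfl

theorem len_mul_le (hT : IsSymmGen T) (g h : G) : hT.len (g * h) ≤ hT.len g + hT.len h :=
  hT.len_le_iff.2 (mul_mem_pow (hT.mem_pow_len g) (hT.mem_pow_len h))

/-- `f` is harmonic for the random walk driven by `T`. -/
def Harmonic (hT : IsSymmGen T) (f : G → ℝ) : Prop :=
  ∀ x, ∑ t ∈ hT.ball 1, (f (t * x) - f x) = 0

/-- A cutoff function equal to `1` on the ball of radius `R` and to `0` off the ball of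
radius `2 * R`. -/
noncomputable def cutoff (hT : IsSymmGen T) (R : ℕ) (x : G) : ℝ :=
  max 0 (min 1 ((2 * R - hT.len x) / R))

theorem cutoff_eq_one (hT : IsSymmGen T) {R : ℕ} (hR : 0 < R) {x : G} (hx : x ∈ T ^ R) :
    hT.cutoff R x = 1 := by
  have h1 : (hT.len x : ℝ) ≤ R := by exact_mod_cast hT.len_le_iff.2 hx
  have hR' : (0 : ℝ) < R := by exact_mod_cast hR
  have h2 : 1 ≤ (2 * R - hT.len x) / (R : ℝ) := by rw [le_div_iff₀ hR']; linarith
  rw [cutoff, min_eq_left h2, max_eq_right zero_le_one]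

theorem cutoff_eq_zero (hT : IsSymmGen T) {R : ℕ} {x : G} (hx : x ∉ T ^ (2 * R)) :
    hT.cutoff R x = 0 := by
  have h1 : ((2 * R : ℕ) : ℝ) ≤ hT.len x := by
    exact_mod_cast (not_le.1 (mt hT.len_le_iff.1 hx)).le
  push_cast at h1
  have h2 : (2 * R - hT.len x) / (R : ℝ) ≤ 0 :=
    div_nonpos_of_nonpos_of_nonneg (by linarith) (by positivity)
  rw [cutoff, max_eq_left]
  exact (min_le_right _ _).trans h2

theorem cutoff_sub_sq_le (hT : IsSymmGen T) {R : ℕ} (hR : 0 < R) {t : G} (ht : t ∈ T) (x : G) :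
    (hT.cutoff R x - hT.cutoff R (t * x)) ^ 2 ≤ 1 / (R : ℝ) ^ 2 := by
  have hR' : (0 : ℝ) < R := by exact_mod_cast hR
  have ht1 : ∀ t ∈ T, hT.len t ≤ 1 := fun t ht => hT.len_le_iff.2 (by simpa using ht)
  have h1 : (hT.len (t * x) : ℝ) ≤ 1 + hT.len x := by
    exact_mod_cast (hT.len_mul_le t x).trans (Nat.add_le_add_right (ht1 t ht) _)
  have h2 : (hT.len x : ℝ) ≤ 1 + hT.len (t * x) := by
    have := (hT.len_mul_le t⁻¹ (t * x)).trans
      (Nat.add_le_add_right (ht1 _ (hT.inv_mem t ht)) _)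
    rw [inv_mul_cancel_left] at this
    exact_mod_cast this
  have h3 : |hT.cutoff R x - hT.cutoff R (t * x)| ≤ 1 / R := by
    unfold cutoff
    refine (abs_max_sub_max_le_max _ _ _ _).trans ?_
    rw [sub_self, abs_zero]
    refine max_le (by positivity) ((abs_min_sub_min_le_max _ _ _ _).trans ?_)
    rw [sub_self, abs_zero]
    refine max_le (by positivity) ?_
    rw [← sub_div, abs_div, abs_of_pos hR']
    gcongr
    rw [abs_le]
    constructor <;> linarith
  rw [← sq_abs, one_div, ← inv_pow, ← one_div]
  exact pow_le_pow_left₀ (abs_nonneg _) h3 2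

theorem sum_shift (hT : IsSymmGen T) {m : ℕ} {H : G → ℝ} (hH : ∀ x ∉ T ^ m, H x = 0) {t : G}
    (ht : t ∈ T) : ∑ x ∈ hT.ball (m + 1), H (t * x) = ∑ x ∈ hT.ball (m + 1), H x := by
  rw [← finsum_eq_sum_of_support_subset (fun x => H (t * x)), ← finsum_eq_sum_of_support_subset H]
  · exact finsum_comp_equiv (Equiv.mulLeft t)
  · intro x hx
    have : x ∈ T ^ m := by by_contra h; exact hx (hH x h)
    simpa using hT.pow_mono (Nat.le_succ m) this
  · intro x hx
    have h1 : t * x ∈ T ^ m := by by_contra h; exact hx (hH _ h)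
    have h2 : t⁻¹ * (t * x) ∈ T ^ (m + 1) := by
      rw [pow_succ']; exact Set.mul_mem_mul (hT.inv_mem t ht) h1
    simpa using h2

theorem sum_ball_one_inv (hT : IsSymmGen T) (F : G → ℝ) :
    ∑ t ∈ hT.ball 1, F t⁻¹ = ∑ t ∈ hT.ball 1, F t := by
  have h : ∀ t ∈ hT.ball 1, t⁻¹ ∈ hT.ball 1 := fun t ht => by
    rw [mem_ball] at *; exact hT.inv_mem_pow ht
  exact Finset.sum_nbij' (fun t => t⁻¹) (fun t => t⁻¹) h h (by simp) (by simp) (by simp)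

theorem caccioppoli (hT : IsSymmGen T) {f : G → ℝ} (hf : hT.Harmonic f) {R : ℕ} (hR : 0 < R) :
    ∑ w ∈ hT.ball (R - 1), hT.energy f w ≤
      T.ncard / (R : ℝ) ^ 2 * ∑ y ∈ hT.ball (2 * R + 2), f y ^ 2 := by
  have hR' : (0 : ℝ) < R := by exact_mod_cast hR
  set φ := hT.cutoff R with hφ
  set A := hT.ball (2 * R + 1) with hA
  set B := hT.ball (2 * R + 2) with hB
  have hcard : ((hT.ball 1).card : ℝ) = T.ncard := by rw [hT.card_ball, pow_one]
  have hmem : ∀ {t}, t ∈ hT.ball 1 → t ∈ T := fun h => by simpa using h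
  have e1 : ∑ t ∈ hT.ball 1, ∑ x ∈ A, (f (t * x) - f x) * (φ (t * x) ^ 2 * f (t * x)) = 0 := by
    have h1 : ∀ t ∈ hT.ball 1, ∑ x ∈ A, (f (t * x) - f x) * (φ (t * x) ^ 2 * f (t * x)) =
        ∑ x ∈ A, (f x - f (t⁻¹ * x)) * (φ x ^ 2 * f x) := by
      intro t ht
      rw [← hT.sum_shift (m := 2 * R) (H := fun x => (f x - f (t⁻¹ * x)) * (φ x ^ 2 * f x)) _
        (hmem ht)]
      · simp [hA]
      · intro x hx
        simp [hφ, hT.cutoff_eq_zero hx]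
    rw [Finset.sum_congr rfl h1,
      hT.sum_ball_one_inv (fun t => ∑ x ∈ A, (f x - f (t * x)) * (φ x ^ 2 * f x)),
      Finset.sum_comm]
    refine Finset.sum_eq_zero fun x _ => ?_
    rw [← Finset.sum_mul]
    have := hf x
    have h2 : ∑ t ∈ hT.ball 1, (f x - f (t * x)) = 0 := by
      rw [← neg_eq_zero, ← Finset.sum_neg_distrib]; simpa using this
    rw [h2, zero_mul]
  have e2 : ∑ t ∈ hT.ball 1, ∑ x ∈ A, (f (t * x) - f x) * (φ x ^ 2 * f x) = 0 := by
    rw [Finset.sum_comm]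
    refine Finset.sum_eq_zero fun x _ => ?_
    rw [← Finset.sum_mul, hf x, zero_mul]
  have e3 : ∑ t ∈ hT.ball 1, ∑ x ∈ A, (φ (t * x) * f (t * x) - φ x * f x) ^ 2 =
      ∑ t ∈ hT.ball 1, ∑ x ∈ A, f x * f (t * x) * (φ x - φ (t * x)) ^ 2 := by
    have key : ∑ t ∈ hT.ball 1, ∑ x ∈ A, (φ (t * x) * f (t * x) - φ x * f x) ^ 2 -
        ∑ t ∈ hT.ball 1, ∑ x ∈ A, f x * f (t * x) * (φ x - φ (t * x)) ^ 2 =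
        ∑ t ∈ hT.ball 1, ∑ x ∈ A, (f (t * x) - f x) * (φ (t * x) ^ 2 * f (t * x)) -
        ∑ t ∈ hT.ball 1, ∑ x ∈ A, (f (t * x) - f x) * (φ x ^ 2 * f x) := by
      simp only [← Finset.sum_sub_distrib]
      refine Finset.sum_congr rfl fun t _ => Finset.sum_congr rfl fun x _ => ?_
      ring
    linarith [e1, e2, key]
  have h1 : ∑ w ∈ hT.ball (R - 1), hT.energy f w ≤
      ∑ t ∈ hT.ball 1, ∑ x ∈ A, (φ (t * x) * f (t * x) - φ x * f x) ^ 2 := by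
    unfold energy
    rw [Finset.sum_comm]
    refine Finset.sum_le_sum fun t ht => ?_
    have h2 : ∀ x ∈ hT.ball (R - 1), (f (t * x) - f x) ^ 2 =
        (φ (t * x) * f (t * x) - φ x * f x) ^ 2 := by
      intro x hx
      rw [mem_ball] at hx
      have h3 : t * x ∈ T ^ R := by
        have := mul_mem_pow (T := T) (m := 1) (by simpa using hmem ht) hx
        rwa [show 1 + (R - 1) = R by omega] at this
      rw [hφ, hT.cutoff_eq_one hR h3, hT.cutoff_eq_one hR (hT.pow_mono (Nat.sub_le R 1) hx),
        one_mul, one_mul]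
    rw [Finset.sum_congr rfl h2]
    exact Finset.sum_le_sum_of_subset_of_nonneg (hT.ball_mono (by omega)) fun _ _ _ => sq_nonneg _
  rw [e3] at h1
  refine h1.trans ?_
  have h2 : ∀ t ∈ hT.ball 1, ∑ x ∈ A, f x * f (t * x) * (φ x - φ (t * x)) ^ 2 ≤
      1 / (R : ℝ) ^ 2 * ∑ y ∈ B, f y ^ 2 := by
    intro t ht
    have h3 : ∑ x ∈ A, f (t * x) ^ 2 ≤ ∑ y ∈ B, f y ^ 2 := by
      have : ∑ x ∈ A, f (t * x) ^ 2 = ∑ y ∈ A.map (mulLeftEmbedding t), f y ^ 2 := by simp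
      rw [this]
      refine Finset.sum_le_sum_of_subset_of_nonneg (fun y hy => ?_) fun _ _ _ => sq_nonneg _
      obtain ⟨x, hx, rfl⟩ := Finset.mem_map.1 hy
      rw [hA, mem_ball] at hx
      rw [hB, mem_ball, show 2 * R + 2 = (2 * R + 1) + 1 by ring, pow_succ']
      exact Set.mul_mem_mul (hmem ht) hx
    have h4 : ∑ x ∈ A, f x ^ 2 ≤ ∑ y ∈ B, f y ^ 2 :=
      Finset.sum_le_sum_of_subset_of_nonneg (hT.ball_mono (by omega)) fun _ _ _ => sq_nonneg _
    calc ∑ x ∈ A, f x * f (t * x) * (φ x - φ (t * x)) ^ 2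
        ≤ ∑ x ∈ A, 1 / (R : ℝ) ^ 2 * ((f x ^ 2 + f (t * x) ^ 2) / 2) := by
          refine Finset.sum_le_sum fun x _ => ?_
          have h5 := hT.cutoff_sub_sq_le hR (hmem ht) x
          have h6 := two_mul_le_add_sq (f x) (f (t * x))
          calc f x * f (t * x) * (φ x - φ (t * x)) ^ 2
              ≤ (f x ^ 2 + f (t * x) ^ 2) / 2 * (φ x - φ (t * x)) ^ 2 := by
                gcongr; linarith
            _ ≤ (f x ^ 2 + f (t * x) ^ 2) / 2 * (1 / (R : ℝ) ^ 2) := by gcongr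
            _ = _ := by ring
      _ = 1 / (R : ℝ) ^ 2 * ((∑ x ∈ A, f x ^ 2 + ∑ x ∈ A, f (t * x) ^ 2) / 2) := by
          rw [← Finset.mul_sum, ← Finset.sum_div, Finset.sum_add_distrib]
      _ ≤ _ := by gcongr; linarith
  refine (Finset.sum_le_sum h2).trans ?_
  rw [Finset.sum_const, nsmul_eq_mul, hcard]
  exact le_of_eq (by ring)

/-- Growth of harmonic functions with vanishing averages on the balls around a net. -/
theorem sum_sq_harmonic_le (hT : IsSymmGen T) {f : G → ℝ} (hh : hT.Harmonic f) {R s : ℕ}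
    (hs : 0 < s) (hsR : 6 * s ≤ R) {X : Finset G} (hXR : X ⊆ hT.ball R)
    (hX : (X : Set G).PairwiseDisjoint fun x => (hT.ball s).map (mulRightEmbedding x))
    (hcov : ∀ y ∈ hT.ball R, ∃ x ∈ X, y * x⁻¹ ∈ T ^ (2 * s))
    (hf : ∀ x ∈ X, ∑ b ∈ hT.ball (2 * s), f (b * x) = 0) {K : ℝ}
    (hK : ((T ^ (8 * s)).ncard : ℝ) ≤ K * (T ^ s).ncard) :
    ∑ y ∈ hT.ball R, f y ^ 2 ≤
      2 * K ^ 2 * T.ncard * (s / R : ℝ) ^ 2 * ∑ y ∈ hT.ball (8 * R), f y ^ 2 := by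
  have hR : (0 : ℝ) < R := by
    have : 0 < R := by omega
    exact_mod_cast this
  have h1 := hT.sum_sq_le_of_net f hXR hX hcov hf hK
  have h2 : ∑ w ∈ hT.ball (R + 6 * s), hT.energy f w ≤
      ∑ w ∈ hT.ball (2 * R + 1 - 1), hT.energy f w :=
    Finset.sum_le_sum_of_subset_of_nonneg (hT.ball_mono (by omega))
      fun _ _ _ => hT.energy_nonneg f _
  have h3 := hT.caccioppoli hh (R := 2 * R + 1) (by omega)
  have h4 : ∑ y ∈ hT.ball (2 * (2 * R + 1) + 2), f y ^ 2 ≤ ∑ y ∈ hT.ball (8 * R), f y ^ 2 :=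
    Finset.sum_le_sum_of_subset_of_nonneg (hT.ball_mono (by omega)) fun _ _ _ => sq_nonneg _
  set S := ∑ y ∈ hT.ball (8 * R), f y ^ 2 with hS
  have hS0 : 0 ≤ S := Finset.sum_nonneg fun _ _ => sq_nonneg _
  have h5 : (T.ncard : ℝ) / ((2 * R + 1 : ℕ) : ℝ) ^ 2 * ∑ y ∈ hT.ball (2 * (2 * R + 1) + 2), f y ^ 2
      ≤ T.ncard / (2 * R : ℝ) ^ 2 * S := by
    push_cast
    gcongr
    linarith
  calc ∑ y ∈ hT.ball R, f y ^ 2 ≤ _ := h1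
    _ ≤ 8 * (s : ℝ) ^ 2 * K ^ 2 * (T.ncard / (2 * R : ℝ) ^ 2 * S) :=
        mul_le_mul_of_nonneg_left (h2.trans (h3.trans h5)) (by positivity)
    _ = _ := by field_simp; ring

end IsSymmGen

end Caccioppoli

section Determinant

open Matrix

variable {ι κ : Type*} [Fintype ι] [DecidableEq ι] [Fintype κ]

theorem Matrix.IsHermitian.exists_orthogonal_diagonal {A : Matrix ι ι ℝ} (hA : A.IsHermitian) :
    ∃ U : Matrix ι ι ℝ, Uᵀ * U = 1 ∧ A = U * diagonal hA.eigenvalues * Uᵀ := by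
  refine ⟨(hA.eigenvectorUnitary).1, ?_, ?_⟩
  · have := Unitary.coe_star_mul_self hA.eigenvectorUnitary
    rwa [Matrix.star_eq_conjTranspose, Matrix.conjTranspose_eq_transpose_of_trivial] at this
  · have h3 := hA.spectral_theorem
    rw [Unitary.conjStarAlgAut_apply] at h3
    conv_lhs => rw [h3]
    rw [Matrix.star_eq_conjTranspose,
      Matrix.conjTranspose_eq_transpose_of_trivial]
    rfl

theorem Matrix.PosSemidef.det_le_pow_of_le {H : Matrix ι ι ℝ} (hH : H.PosSemidef)
    (h1 : ∀ c : ι → ℝ, c ⬝ᵥ H *ᵥ c ≤ c ⬝ᵥ c) (ψ : (ι → ℝ) →ₗ[ℝ] (κ → ℝ)) {η : ℝ} (hη : 0 ≤ η)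
    (hη1 : η ≤ 1) (h2 : ∀ c, ψ c = 0 → c ⬝ᵥ H *ᵥ c ≤ η * (c ⬝ᵥ c)) :
    H.det ≤ η ^ (Fintype.card ι - Fintype.card κ) := by
  classical
  set lam := hH.1.eigenvalues with hlam
  obtain ⟨U, hUU, h4⟩ := hH.1.exists_orthogonal_diagonal
  have hdiag : Uᵀ * H * U = diagonal lam := by
    calc Uᵀ * H * U = Uᵀ * (U * diagonal lam * Uᵀ) * U := by rw [← h4]
      _ = (Uᵀ * U) * diagonal lam * (Uᵀ * U) := by
          simp only [Matrix.mul_assoc]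
      _ = _ := by rw [hUU, Matrix.one_mul, Matrix.mul_one]
  have hq : ∀ a : ι → ℝ, (U *ᵥ a) ⬝ᵥ H *ᵥ (U *ᵥ a) = ∑ i, lam i * a i ^ 2 := by
    intro a
    have : (U *ᵥ a) ⬝ᵥ H *ᵥ (U *ᵥ a) = a ⬝ᵥ (Uᵀ * H * U) *ᵥ a := by
      rw [← Matrix.mulVec_mulVec, ← Matrix.mulVec_mulVec, Matrix.dotProduct_mulVec a,
        Matrix.vecMul_transpose]
    rw [this, hdiag]
    simp only [dotProduct, Matrix.mulVec_diagonal]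
    exact Finset.sum_congr rfl fun i _ => by ring
  have hn : ∀ a : ι → ℝ, (U *ᵥ a) ⬝ᵥ (U *ᵥ a) = ∑ i, a i ^ 2 := by
    intro a
    have : (U *ᵥ a) ⬝ᵥ (U *ᵥ a) = a ⬝ᵥ (Uᵀ * U) *ᵥ a := by
      rw [← Matrix.mulVec_mulVec, Matrix.dotProduct_mulVec a, Matrix.vecMul_transpose]
    rw [this, hUU, Matrix.one_mulVec]
    simp only [dotProduct]
    exact Finset.sum_congr rfl fun i _ => by ring
  have hlam0 : ∀ i, 0 ≤ lam i := hH.eigenvalues_nonneg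
  have hlam1 : ∀ i, lam i ≤ 1 := by
    intro i
    have h5 := h1 (U *ᵥ Pi.single i 1)
    rw [hq, hn] at h5
    simpa [Pi.single_apply, ite_pow] using h5
  set I := Finset.univ.filter fun i => η < lam i with hI
  have hcard : I.card ≤ Fintype.card κ := by
    by_contra! hlt
    set E : (I → ℝ) →ₗ[ℝ] (ι → ℝ) := Function.ExtendByZero.linearMap ℝ ((↑) : I → ι) with hE
    have hker : LinearMap.ker (ψ ∘ₗ U.mulVecLin ∘ₗ E) ≠ ⊥ := by
      apply LinearMap.ker_ne_bot_of_finrank_lt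
      simpa using hlt
    obtain ⟨a, ha, ha0⟩ := Submodule.exists_mem_ne_zero_of_ne_bot hker
    have h6 := h2 (U *ᵥ E a) (by simpa using ha)
    rw [hq, hn, Finset.mul_sum, ← sub_nonpos, ← Finset.sum_sub_distrib] at h6
    have hEa : ∀ i : I, E a i = a i := fun i => by
      simp [hE, Function.ExtendByZero.linearMap_apply]
    have hEa' : ∀ i, i ∉ I → E a i = 0 := fun i hi => by
      simp only [hE, Function.ExtendByZero.linearMap_apply]
      rw [Function.extend_apply']
      · rfl
      · rintro ⟨j, rfl⟩; exact hi j.2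
    have hpos : ∀ i, 0 ≤ lam i * E a i ^ 2 - η * E a i ^ 2 := by
      intro i
      by_cases hi : i ∈ I
      · have : η < lam i := by simpa [hI] using hi
        rw [← sub_mul]
        exact mul_nonneg (by linarith) (sq_nonneg _)
      · simp [hEa' i hi]
    apply ha0
    ext i
    have h7 := (Finset.sum_eq_zero_iff_of_nonneg fun i _ => hpos i).1
      (le_antisymm h6 (Finset.sum_nonneg fun i _ => hpos i)) i (Finset.mem_univ _)
    have h8 : η < lam i := (Finset.mem_filter.1 i.2).2
    rw [hEa, ← sub_mul] at h7
    rcases mul_eq_zero.1 h7 with h | h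
    · linarith
    · simpa using h
  have hdet : H.det = ∏ i, lam i := by simpa using hH.1.det_eq_prod_eigenvalues
  rw [hdet, ← Finset.prod_mul_prod_compl I lam]
  have h9 : ∏ i ∈ Iᶜ, lam i ≤ η ^ (Iᶜ).card := by
    rw [← Finset.prod_const]
    exact Finset.prod_le_prod (fun i _ => hlam0 i) fun i hi => by simpa [hI] using hi
  have h10 : ∏ i ∈ I, lam i ≤ 1 := Finset.prod_le_one (fun i _ => hlam0 i) fun i _ => hlam1 i
  calc (∏ i ∈ I, lam i) * ∏ i ∈ Iᶜ, lam i ≤ 1 * η ^ (Iᶜ).card :=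
        mul_le_mul h10 h9 (Finset.prod_nonneg fun i _ => hlam0 i) zero_le_one
    _ ≤ _ := by
        rw [one_mul, Finset.card_compl]
        exact pow_le_pow_of_le_one hη hη1 (by omega)

theorem Matrix.PosDef.exists_conj_eq_one {M : Matrix ι ι ℝ} (hM : M.PosDef) :
    ∃ C : Matrix ι ι ℝ, Cᵀ * M * C = 1 := by
  set lam := hM.1.eigenvalues with hlam
  obtain ⟨U, hUU, h4⟩ := hM.1.exists_orthogonal_diagonal
  have hlam0 : ∀ i, 0 < lam i := hM.eigenvalues_pos
  refine ⟨U * diagonal fun i => (Real.sqrt (lam i))⁻¹, ?_⟩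
  rw [Matrix.transpose_mul, Matrix.diagonal_transpose]
  calc _ = diagonal (fun i => (Real.sqrt (lam i))⁻¹) * Uᵀ * (U * diagonal lam * Uᵀ) *
        (U * diagonal fun i => (Real.sqrt (lam i))⁻¹) := by rw [← h4]
    _ = diagonal (fun i => (Real.sqrt (lam i))⁻¹) * (Uᵀ * U) * diagonal lam * (Uᵀ * U) *
        diagonal (fun i => (Real.sqrt (lam i))⁻¹) := by simp only [Matrix.mul_assoc]
    _ = 1 := by
      rw [hUU, Matrix.mul_one, Matrix.mul_one, Matrix.diagonal_mul_diagonal,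
        Matrix.diagonal_mul_diagonal, ← Matrix.diagonal_one]
      congr 1
      ext i
      have := Real.sqrt_pos.2 (hlam0 i)
      rw [inv_mul_eq_div, div_mul_eq_mul_div, ← div_eq_mul_inv, div_div,
        Real.mul_self_sqrt (hlam0 i).le]
      exact div_self (hlam0 i).ne'

theorem Matrix.PosSemidef.det_le_pow_mul_det {M M' : Matrix ι ι ℝ} (hM : M.PosSemidef)
    (hM' : M'.PosDef) (h1 : ∀ c : ι → ℝ, c ⬝ᵥ M *ᵥ c ≤ c ⬝ᵥ M' *ᵥ c)
    (ψ : (ι → ℝ) →ₗ[ℝ] (κ → ℝ)) {η : ℝ} (hη : 0 ≤ η) (hη1 : η ≤ 1)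
    (h2 : ∀ c, ψ c = 0 → c ⬝ᵥ M *ᵥ c ≤ η * (c ⬝ᵥ M' *ᵥ c)) :
    M.det ≤ η ^ (Fintype.card ι - Fintype.card κ) * M'.det := by
  obtain ⟨C, hC⟩ := hM'.exists_conj_eq_one
  have hq : ∀ (A : Matrix ι ι ℝ) (a : ι → ℝ),
      a ⬝ᵥ (Cᵀ * A * C) *ᵥ a = (C *ᵥ a) ⬝ᵥ A *ᵥ (C *ᵥ a) := by
    intro A a
    rw [← Matrix.mulVec_mulVec, ← Matrix.mulVec_mulVec, Matrix.dotProduct_mulVec a,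
        Matrix.vecMul_transpose]
  have hone : ∀ a : ι → ℝ, a ⬝ᵥ a = (C *ᵥ a) ⬝ᵥ M' *ᵥ (C *ᵥ a) := by
    intro a; rw [← hq, hC, Matrix.one_mulVec]
  have hP : (Cᵀ * M * C).PosSemidef := by
    have := hM.conjTranspose_mul_mul_same C
    rwa [Matrix.conjTranspose_eq_transpose_of_trivial] at this
  have key := hP.det_le_pow_of_le (fun c => by rw [hq, hone]; exact h1 _) (ψ ∘ₗ C.mulVecLin)
    hη hη1 (fun c hc => by rw [hq, hone]; exact h2 _ (by simpa using hc))
  have hdet : C.det ^ 2 * M'.det = 1 := by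
    have := congrArg Matrix.det hC
    rw [Matrix.det_mul, Matrix.det_mul, Matrix.det_transpose, Matrix.det_one] at this
    linarith
  rw [Matrix.det_mul, Matrix.det_mul, Matrix.det_transpose] at key
  have h0 := hM'.det_pos
  calc M.det = (C.det * M.det * C.det) * M'.det := by linear_combination (-M.det) * hdet
    _ ≤ _ := mul_le_mul_of_nonneg_right key h0.le

end Determinant

section FiniteDimension

variable {G : Type*} [Group G] {T : Set G}

open Matrix

theorem exists_increment_lt_one {u : ℕ → ℝ} {c C : ℝ} (hc : c < 1) (hu : ∀ j, u j ≤ c * j + C)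
    (j₀ : ℕ) : ∃ j ≥ j₀, u (j + 1) - u j < 1 := by
  by_contra! h
  have h1 : ∀ n : ℕ, u j₀ + n ≤ u (j₀ + n) := by
    intro n
    induction n with
    | zero => simp
    | succ n ih =>
      have := h (j₀ + n) (by omega)
      rw [← add_assoc]
      push_cast
      linarith
  obtain ⟨n, hn⟩ := exists_nat_gt ((c * j₀ + C - u j₀) / (1 - c))
  rw [div_lt_iff₀ (by linarith)] at hn
  have h2 := h1 n
  have h3 := hu (j₀ + n)
  push_cast at h3
  linarith

namespace IsSymmGen

theorem abs_le_of_gradient_le {f : G → ℝ} (hf1 : f 1 = 0) {L : ℝ}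
    (hL : ∀ t ∈ T, ∀ x, |f (t * x) - f x| ≤ L) (m : ℕ) {y : G} (hy : y ∈ T ^ m) :
    |f y| ≤ m * L := by
  simpa [hf1] using abs_sub_le_of_gradient_le hL m hy 1

variable {D : ℕ}

/-- The Gram matrix of a family of functions on a ball. -/
noncomputable def gram (hT : IsSymmGen T) (f : Fin D → G → ℝ) (R : ℕ) :
    Matrix (Fin D) (Fin D) ℝ :=
  fun i j => ∑ x ∈ hT.ball R, f i x * f j x

theorem dotProduct_gram_mulVec (hT : IsSymmGen T) (f : Fin D → G → ℝ) (R : ℕ) (c : Fin D → ℝ) :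
    c ⬝ᵥ hT.gram f R *ᵥ c = ∑ x ∈ hT.ball R, (∑ i, c i * f i x) ^ 2 := by
  simp only [dotProduct, mulVec, gram, sq, Finset.sum_mul_sum]
  rw [Finset.sum_comm]
  refine Finset.sum_congr rfl fun i _ => ?_
  rw [Finset.sum_comm, Finset.mul_sum]
  refine Finset.sum_congr rfl fun j _ => ?_
  rw [Finset.sum_mul, Finset.mul_sum]
  exact Finset.sum_congr rfl fun x _ => by ring

theorem gram_posSemidef (hT : IsSymmGen T) (f : Fin D → G → ℝ) (R : ℕ) :
    (hT.gram f R).PosSemidef := by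
  refine PosSemidef.of_dotProduct_mulVec_nonneg ?_ fun c => ?_
  · ext i j
    simp [gram, mul_comm]
  · simp only [star_trivial, dotProduct_gram_mulVec]
    exact Finset.sum_nonneg fun _ _ => sq_nonneg _

theorem exists_gram_posDef (hT : IsSymmGen T) {f : Fin D → G → ℝ} (hf : LinearIndependent ℝ f) :
    ∃ R₀, ∀ R ≥ R₀, (hT.gram f R).PosDef := by
  let K : ℕ →o (Submodule ℝ (Fin D → ℝ))ᵒᵈ :=
    { toFun := fun R => OrderDual.toDual
        (LinearMap.ker ((LinearMap.funLeft ℝ ℝ ((↑) : hT.ball R → G)) ∘ₗ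
          Fintype.linearCombination ℝ f))
      monotone' := by
        intro R R' h
        rw [OrderDual.toDual_le_toDual]
        intro c hc
        simp only [LinearMap.mem_ker, LinearMap.comp_apply, funext_iff, LinearMap.funLeft_apply]
          at hc ⊢
        exact fun x => hc ⟨x, hT.ball_mono h x.2⟩ }
  have hK : ∀ R c, c ∈ OrderDual.ofDual (K R) ↔ ∀ x ∈ hT.ball R, ∑ i, c i * f i x = 0 := by
    intro R c
    change c ∈ LinearMap.ker _ ↔ _
    simp [funext_iff, LinearMap.funLeft_apply, Fintype.linearCombination_apply]
  obtain ⟨R₀, hR₀⟩ := IsArtinian.monotone_stabilizes K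
  refine ⟨R₀, fun R hR => PosDef.of_dotProduct_mulVec_pos (hT.gram_posSemidef f R).1
    fun c hc => ?_⟩
  rw [star_trivial, dotProduct_gram_mulVec]
  refine lt_of_le_of_ne (Finset.sum_nonneg fun _ _ => sq_nonneg _) fun h0 => hc ?_
  have h1 := (Finset.sum_eq_zero_iff_of_nonneg fun _ _ => sq_nonneg _).1 h0.symm
  have h2 : c ∈ OrderDual.ofDual (K R) := by
    rw [hK]
    exact fun x hx => by simpa using h1 x hx
  have h3 : ∀ x, ∑ i, c i * f i x = 0 := by
    intro x
    obtain ⟨n, hn⟩ := hT.exists_mem_pow x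
    have h4 : c ∈ OrderDual.ofDual (K (max n R₀)) := by
      rw [← hR₀ _ (le_max_right _ _), hR₀ R hR]; exact h2
    rw [hK] at h4
    exact h4 x (hT.ball_mono (le_max_left _ _) (hT.mem_ball.2 hn))
  funext i
  refine Fintype.linearIndependent_iff.1 hf c (funext fun x => ?_) i
  simpa using h3 x

theorem det_gram_le (hT : IsSymmGen T) (f : Fin D → G → ℝ) (hf1 : ∀ i, f i 1 = 0) {L : ℝ}
    (hL : ∀ i, ∀ t ∈ T, ∀ x, |f i (t * x) - f i x| ≤ L) (R : ℕ) :
    (hT.gram f R).det ≤ D.factorial * ((T ^ R).ncard * (R * L) ^ 2) ^ D := by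
  have h1 : ∀ i j, |hT.gram f R i j| ≤ (T ^ R).ncard * (R * L) ^ 2 := by
    intro i j
    unfold gram
    refine (Finset.abs_sum_le_sum_abs _ _).trans ?_
    rw [← hT.card_ball R, ← nsmul_eq_mul]
    refine Finset.sum_le_card_nsmul _ _ _ fun x hx => ?_
    rw [abs_mul, sq]
    have hx' := hT.mem_ball.1 hx
    have h2 := abs_le_of_gradient_le (hf1 i) (hL i) R hx'
    exact mul_le_mul h2 (abs_le_of_gradient_le (hf1 j) (hL j) R hx') (abs_nonneg _)
      ((abs_nonneg _).trans h2)
  have := Matrix.det_le (abv := AbsoluteValue.abs) h1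
  simpa using (le_abs_self _).trans this

theorem det_gram_mono (hT : IsSymmGen T) (f : Fin D → G → ℝ) {R R' : ℕ} (h : R ≤ R')
    (hpos : (hT.gram f R').PosDef) : (hT.gram f R).det ≤ (hT.gram f R').det := by
  have h1 : ∀ c : Fin D → ℝ, c ⬝ᵥ hT.gram f R *ᵥ c ≤ c ⬝ᵥ hT.gram f R' *ᵥ c := by
    intro c
    simp only [dotProduct_gram_mulVec]
    exact Finset.sum_le_sum_of_subset_of_nonneg (hT.ball_mono h) fun _ _ _ => sq_nonneg _
  have := (hT.gram_posSemidef f R).det_le_pow_mul_det hpos h1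
    (0 : (Fin D → ℝ) →ₗ[ℝ] (Fin 0 → ℝ)) zero_le_one le_rfl (fun c _ => by rw [one_mul]; exact h1 c)
  simpa using this

theorem det_gram_le_of_scale (hT : IsSymmGen T) {f : Fin D → G → ℝ} (hh : ∀ i, hT.Harmonic (f i))
    {R s N : ℕ} (hs : 0 < s) (hsR : 6 * s ≤ R) {K η : ℝ} (hη1 : η ≤ 1)
    (hK : ((T ^ (8 * s)).ncard : ℝ) ≤ K * (T ^ s).ncard)
    (hN : (T ^ (R + s)).ncard ≤ N * (T ^ s).ncard)
    (hη : 2 * K ^ 2 * T.ncard * (s / R : ℝ) ^ 2 ≤ η) (hpos : (hT.gram f (8 * R)).PosDef) :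
    (hT.gram f R).det ≤ η ^ (D - N) * (hT.gram f (8 * R)).det := by
  obtain ⟨X, hXR, hX, hcov⟩ := hT.exists_net R s
  have hXN : X.card ≤ N := by
    have h1 := hT.packing (m := R + s) X 1 hX fun x hx b hb => by
      rw [inv_one, mul_one, add_comm]
      exact mul_mem_pow hb (hT.mem_ball.1 (hXR hx))
    exact Nat.le_of_mul_le_mul_right (h1.trans hN) (hT.ncard_pow_pos s)
  have hη0 : 0 ≤ η := le_trans (by positivity) hη
  let ψ : (Fin D → ℝ) →ₗ[ℝ] (X → ℝ) := LinearMap.pi fun x =>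
    Fintype.linearCombination ℝ fun i => ∑ b ∈ hT.ball (2 * s), f i (b * x)
  have hψ : ∀ c, ψ c = 0 → ∀ x ∈ X, ∑ b ∈ hT.ball (2 * s), ∑ i, c i * f i (b * x) = 0 := by
    intro c hc x hx
    have := congrFun hc ⟨x, hx⟩
    simp only [ψ, LinearMap.pi_apply, Fintype.linearCombination_apply, smul_eq_mul,
      Pi.zero_apply] at this
    rw [Finset.sum_comm]
    simpa only [Finset.mul_sum] using this
  have hharm : ∀ c : Fin D → ℝ, hT.Harmonic fun x => ∑ i, c i * f i x := by
    intro c x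
    simp only [← Finset.sum_sub_distrib, ← mul_sub]
    rw [Finset.sum_comm]
    refine Finset.sum_eq_zero fun i _ => ?_
    rw [← Finset.mul_sum, hh i x, mul_zero]
  have key := (hT.gram_posSemidef f R).det_le_pow_mul_det hpos
    (fun c => by
      simp only [dotProduct_gram_mulVec]
      exact Finset.sum_le_sum_of_subset_of_nonneg (hT.ball_mono (by omega))
        fun _ _ _ => sq_nonneg _) ψ hη0 hη1 (fun c hc => by
      simp only [dotProduct_gram_mulVec]
      exact (hT.sum_sq_harmonic_le (hharm c) hs hsR hXR hX hcov (hψ c hc) hK).trans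
        (mul_le_mul_of_nonneg_right hη (Finset.sum_nonneg fun _ _ => sq_nonneg _)))
  refine key.trans (mul_le_mul_of_nonneg_right ?_ hpos.det_pos.le)
  refine pow_le_pow_of_le_one hη0 hη1 ?_
  simp only [Fintype.card_fin, Fintype.card_coe]
  omega

end IsSymmGen

end FiniteDimension

section FiniteDimension

variable {G : Type*} [Group G] {T : Set G} {d : ℕ}

namespace IsSymmGen

theorem log_ncard_pow_le (hT : IsSymmGen T) {C : ℕ} (hC : ∀ n, (T ^ n).ncard ≤ C * (n + 1) ^ d)
    (j : ℕ) :
    Real.log (T ^ 8 ^ j).ncard ≤ (d * Real.log 8) * j + (Real.log C + d * Real.log 8) := by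
  have h0 : 0 < C := by
    have := (hT.ncard_pow_pos 0).trans_le (hC 0)
    simpa using this
  have h1 : ((T ^ 8 ^ j).ncard : ℝ) ≤ C * (8 ^ (j + 1)) ^ d := by
    have h2 : (8 : ℕ) ^ j + 1 ≤ 8 ^ (j + 1) := by
      have := Nat.one_le_pow j 8 (by norm_num)
      rw [pow_succ]; omega
    have := (hC (8 ^ j)).trans (Nat.mul_le_mul_left C (Nat.pow_le_pow_left h2 d))
    exact_mod_cast this
  have h3 : (0 : ℝ) < (T ^ 8 ^ j).ncard := by exact_mod_cast hT.ncard_pow_pos _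
  have hC0 : (0 : ℝ) < C := by exact_mod_cast h0
  refine (Real.log_le_log h3 h1).trans (le_of_eq ?_)
  rw [Real.log_mul hC0.ne' (by positivity), ← pow_mul, Real.log_pow]
  push_cast
  ring

set_option maxHeartbeats 1000000 in
theorem card_le_of_linearIndependent (hG : HasGrowth d G) (hT : IsSymmGen T) :
    ∃ N : ℕ, ∀ (D : ℕ) (f : Fin D → G → ℝ), (∀ i, hT.Harmonic (f i)) → (∀ i, f i 1 = 0) →
      (∃ L : ℝ, ∀ i, ∀ t ∈ T, ∀ x, |f i (t * x) - f i x| ≤ L) → LinearIndependent ℝ f → D ≤ N := by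
  obtain ⟨C, hC⟩ := hG T hT.finite
  have hl8 : 0 < Real.log 8 := Real.log_pos (by norm_num)
  set c : ℝ := (d + 1) * Real.log 8 with hc
  have hc0 : 0 < c := by positivity
  set C₁ : ℝ := Real.log C + d * Real.log 8 with hC₁
  have hlog : ∀ j : ℕ, Real.log (T ^ 8 ^ j).ncard ≤ c * j + C₁ := by
    intro j
    refine (hT.log_ncard_pow_le hC j).trans ?_
    have : (d * Real.log 8) * (j : ℝ) ≤ c * j := by
      gcongr; rw [hc]; nlinarith
    linarith
  have hv : ∀ n, (0 : ℝ) < (T ^ n).ncard := fun n => by exact_mod_cast hT.ncard_pow_pos n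
  have hmono : ∀ j : ℕ, Real.log (T ^ 8 ^ j).ncard ≤ Real.log (T ^ 8 ^ (j + 1)).ncard := fun j =>
    Real.log_le_log (hv _) (by
      exact_mod_cast hT.ncard_pow_mono (Nat.pow_le_pow_right (by norm_num) (Nat.le_succ j)))
  set K₀ : ℝ := Real.exp (4 * c) with hK₀
  set η : ℝ := 8⁻¹ ^ (8 * (d + 2)) with hη
  have hη0 : 0 < η := by positivity
  have hη1 : η ≤ 1 := pow_le_one₀ (by norm_num) (by norm_num)
  obtain ⟨a, ha1, ha⟩ : ∃ a : ℕ, 1 ≤ a ∧ 2 * K₀ ^ 2 * T.ncard * (1 / 8 ^ a : ℝ) ^ 2 ≤ η := by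
    have h1 : Filter.Tendsto (fun a : ℕ => 2 * K₀ ^ 2 * T.ncard * (1 / 8 ^ a : ℝ) ^ 2)
        Filter.atTop (nhds (2 * K₀ ^ 2 * T.ncard * 0 ^ 2)) := by
      refine ((Filter.Tendsto.pow ?_ 2)).const_mul _
      simpa using tendsto_pow_atTop_nhds_zero_of_lt_one (r := (8⁻¹ : ℝ)) (by norm_num) (by norm_num)
    have h2 := (h1.eventually_lt_const (by simpa using hη0)).and (Filter.eventually_ge_atTop 1)
    obtain ⟨a, h3, h4⟩ := h2.exists
    exact ⟨a, h4, h3.le⟩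
  set κ : ℝ := 4 * ((a + 1) * c) with hκ
  have hκ0 : 0 < κ := by positivity
  obtain ⟨N, hN⟩ := exists_nat_ge (Real.exp κ)
  refine ⟨2 * N, fun D f hh hf1 ⟨L, hL⟩ hf => ?_⟩
  by_contra! hD
  have hD0 : (0 : ℝ) < D := by
    have : 0 < D := by omega
    exact_mod_cast this
  obtain ⟨R₀, hpos⟩ := hT.exists_gram_posDef hf
  have hL' : ∀ i, ∀ t ∈ T, ∀ x, |f i (t * x) - f i x| ≤ max L 1 :=
    fun i t ht x => (hL i t ht x).trans (le_max_left _ _)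
  set b : ℕ := R₀ with hb
  have hRge : ∀ j, R₀ ≤ 8 ^ (j + a + b) := fun j =>
    (Nat.lt_pow_self (by norm_num : 1 < 8)).le.trans (Nat.pow_le_pow_right (by norm_num) (by omega))
  set w : ℕ → ℝ := fun j => Real.log (hT.gram f (8 ^ (j + a + b))).det with hw
  set κ₃ : ℝ := 4 * (D * ((d + 2) * Real.log 8)) with hκ₃
  have hκ₃0 : 0 < κ₃ := by positivity
  set l : ℕ → ℝ := fun j => Real.log (T ^ 8 ^ j).ncard with hl
  set u : ℕ → ℝ := fun j => l (j + b) / (4 * c) +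
    (∑ i ∈ Finset.range (a + 1), l (j + b + i)) / κ + w j / κ₃ with hu
  obtain ⟨C₃, hC₃⟩ : ∃ C₃, ∀ j : ℕ, w j ≤ (D * ((d + 2) * Real.log 8)) * j + C₃ := by
    refine ⟨Real.log D.factorial + D * (d * Real.log 8 * (a + b) + C₁ +
      2 * ((a + b) * Real.log 8) + 2 * Real.log (max L 1)), fun j => ?_⟩
    have h1 := hT.det_gram_le f hf1 hL' (8 ^ (j + a + b))
    have h2 := (hpos _ (hRge j)).det_pos
    have hL1 : (0 : ℝ) < max L 1 := lt_max_of_lt_right one_pos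
    have h3 := Real.log_le_log h2 h1
    have h4 := hv (8 ^ (j + a + b))
    have h5 : (0 : ℝ) < D.factorial := by exact_mod_cast D.factorial_pos
    rw [Real.log_mul h5.ne' (by positivity), Real.log_pow,
      Real.log_mul h4.ne' (by positivity), Real.log_pow, Real.log_mul (by positivity) hL1.ne'] at h3
    push_cast at h3
    rw [Real.log_pow] at h3
    have h6 := hT.log_ncard_pow_le hC (j + a + b)
    push_cast at h3 h6
    refine h3.trans ?_
    have h7 := mul_le_mul_of_nonneg_left h6 hD0.le
    rw [← hC₁] at h7
    nlinarith [h7]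
  have hub : ∃ C₄, ∀ j : ℕ, u j ≤ (3 / 4) * j + C₄ := by
    refine ⟨(c * b + C₁) / (4 * c) + (a + 1) * (c * (b + a) + C₁) / κ + C₃ / κ₃, fun j => ?_⟩
    have t1 : l (j + b) / (4 * c) ≤ j / 4 + (c * b + C₁) / (4 * c) := by
      have h1 : l (j + b) / (4 * c) ≤ (c * (j + b : ℕ) + C₁) / (4 * c) := by
        gcongr; exact hlog _
      refine h1.trans (le_of_eq ?_)
      push_cast
      field_simp
      ring
    have t2 : (∑ i ∈ Finset.range (a + 1), l (j + b + i)) / κ ≤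
        j / 4 + (a + 1) * (c * (b + a) + C₁) / κ := by
      have h1 : ∑ i ∈ Finset.range (a + 1), l (j + b + i) ≤
          (a + 1) * (c * (j + b + a) + C₁) := by
        have h2 : ∀ i ∈ Finset.range (a + 1), l (j + b + i) ≤ c * (j + b + a) + C₁ := by
          intro i hi
          refine (hlog _).trans ?_
          have h3 : (i : ℝ) ≤ a := by
            have := Finset.mem_range.1 hi
            exact_mod_cast (by omega : i ≤ a)
          push_cast
          gcongr
        refine (Finset.sum_le_card_nsmul _ _ _ h2).trans (le_of_eq ?_)
        rw [Finset.card_range, nsmul_eq_mul]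
        push_cast
        ring
      have h4 : (∑ i ∈ Finset.range (a + 1), l (j + b + i)) / κ ≤
          (a + 1) * (c * (j + b + a) + C₁) / κ := by gcongr
      refine h4.trans (le_of_eq ?_)
      rw [hκ]
      field_simp
      ring
    have t3 : w j / κ₃ ≤ j / 4 + C₃ / κ₃ := by
      have h1 : w j / κ₃ ≤ ((D * ((d + 2) * Real.log 8)) * j + C₃) / κ₃ := by
        gcongr; exact hC₃ j
      refine h1.trans (le_of_eq ?_)
      rw [hκ₃]
      field_simp
    simp only [hu]
    linarith
  obtain ⟨C₄, hC₄⟩ := hub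
  obtain ⟨j, -, hj⟩ := exists_increment_lt_one (by norm_num) hC₄ 0
  have hlm : ∀ j, l j ≤ l (j + 1) := hmono
  have hlm' : Monotone l := monotone_nat_of_le_succ hlm
  have e2 : (∑ i ∈ Finset.range (a + 1), l (j + 1 + b + i)) -
      ∑ i ∈ Finset.range (a + 1), l (j + b + i) = l (j + b + (a + 1)) - l (j + b) := by
    have := Finset.sum_range_sub (fun i => l (j + b + i)) (a + 1)
    rw [add_zero] at this
    rw [← Finset.sum_sub_distrib, ← this]
    refine Finset.sum_congr rfl fun i _ => ?_
    rw [show j + 1 + b + i = j + b + (i + 1) by ring]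
  have hR8 : 8 * 8 ^ (j + a + b) = 8 ^ (j + 1 + a + b) := by
    rw [show j + 1 + a + b = (j + a + b) + 1 by ring, pow_succ]; ring
  have hp8 : (hT.gram f (8 * 8 ^ (j + a + b))).PosDef := by rw [hR8]; exact hpos _ (hRge _)
  have hpd := (hpos _ (hRge j)).det_pos
  have e3 : w j ≤ w (j + 1) := by
    refine Real.log_le_log hpd ?_
    rw [← hR8]
    exact hT.det_gram_mono f (by omega) hp8
  have i1 : 0 ≤ (l (j + 1 + b) - l (j + b)) / (4 * c) :=
    div_nonneg (sub_nonneg.2 (hlm' (by omega))) (by positivity)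
  have i2 : 0 ≤ (l (j + b + (a + 1)) - l (j + b)) / κ :=
    div_nonneg (sub_nonneg.2 (hlm' (by omega))) (by positivity)
  have i3 : 0 ≤ (w (j + 1) - w j) / κ₃ := div_nonneg (sub_nonneg.2 e3) (by positivity)
  have hsum : (l (j + 1 + b) - l (j + b)) / (4 * c) + (l (j + b + (a + 1)) - l (j + b)) / κ +
      (w (j + 1) - w j) / κ₃ < 1 := by
    rw [← e2]
    simp only [hu] at hj
    rw [sub_div, sub_div, sub_div]
    linarith
  have g1 : l (j + 1 + b) - l (j + b) < 4 * c := by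
    have : (l (j + 1 + b) - l (j + b)) / (4 * c) < 1 := by linarith
    rwa [div_lt_one (by positivity)] at this
  have g2 : l (j + b + (a + 1)) - l (j + b) < κ := by
    have : (l (j + b + (a + 1)) - l (j + b)) / κ < 1 := by linarith
    rwa [div_lt_one (by positivity)] at this
  have g3 : w (j + 1) - w j < κ₃ := by
    have : (w (j + 1) - w j) / κ₃ < 1 := by linarith
    rwa [div_lt_one (by positivity)] at this
  set s : ℕ := 8 ^ (j + b) with hs
  have hs0 : 0 < s := by positivity
  have hRs : 8 ^ (j + a + b) = 8 ^ a * s := by rw [hs, ← pow_add]; congr 1; ring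
  have h8a : 8 ≤ 8 ^ a := by
    calc 8 = 8 ^ 1 := by norm_num
      _ ≤ 8 ^ a := Nat.pow_le_pow_right (by norm_num) ha1
  have hsR : 6 * s ≤ 8 ^ (j + a + b) := by
    rw [hRs]; exact Nat.mul_le_mul_right s (by omega)
  have hexp : ∀ {m : ℕ} {x : ℝ}, l m - l (j + b) ≤ x →
      ((T ^ 8 ^ m).ncard : ℝ) ≤ Real.exp x * (T ^ s).ncard := by
    intro m x h
    have h1 : Real.log (T ^ 8 ^ m).ncard ≤ x + Real.log (T ^ s).ncard := by
      simp only [hl] at h; linarith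
    rw [Real.log_le_iff_le_exp (hv _), Real.exp_add, Real.exp_log (hv _)] at h1
    exact h1
  have hK : ((T ^ (8 * s)).ncard : ℝ) ≤ K₀ * (T ^ s).ncard := by
    have := hexp g1.le
    rwa [show (8 : ℕ) ^ (j + 1 + b) = 8 * s by rw [hs]; ring] at this
  have hNN : (T ^ (8 ^ (j + a + b) + s)).ncard ≤ N * (T ^ s).ncard := by
    have h1 := hexp g2.le
    have h2 : (T ^ (8 ^ (j + a + b) + s)).ncard ≤ (T ^ 8 ^ (j + b + (a + 1))).ncard := by
      refine hT.ncard_pow_mono ?_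
      rw [show (8 : ℕ) ^ (j + b + (a + 1)) = 8 * (8 ^ a * s) by rw [hs]; ring, hRs]
      have : s ≤ 8 ^ a * s := Nat.le_mul_of_pos_left s (by positivity)
      omega
    have h3 : ((T ^ (8 ^ (j + a + b) + s)).ncard : ℝ) ≤ N * (T ^ s).ncard :=
      (Nat.cast_le.2 h2).trans (h1.trans (mul_le_mul_of_nonneg_right hN (hv _).le))
    exact_mod_cast h3
  have hηR : 2 * K₀ ^ 2 * T.ncard * ((s : ℝ) / (8 ^ (j + a + b) : ℕ)) ^ 2 ≤ η := by
    have hs0' : (0 : ℝ) < s := by exact_mod_cast hs0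
    have h1 : (s : ℝ) / (8 ^ (j + a + b) : ℕ) = 1 / 8 ^ a := by
      rw [hRs]
      push_cast
      field_simp
    rw [h1]
    exact ha
  have hfin := hT.det_gram_le_of_scale hh hs0 hsR hη1 hK hNN hηR hp8
  have h1 : (hT.gram f (8 * 8 ^ (j + a + b))).det <
      Real.exp κ₃ * (hT.gram f (8 ^ (j + a + b))).det := by
    have h2 : Real.log (hT.gram f (8 * 8 ^ (j + a + b))).det <
        κ₃ + Real.log (hT.gram f (8 ^ (j + a + b))).det := by
      simp only [hw] at g3
      rw [hR8]
      linarith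
    rwa [Real.log_lt_iff_lt_exp hp8.det_pos, Real.exp_add, Real.exp_log hpd] at h2
  have h3 : Real.exp κ₃ = 8 ^ (4 * D * (d + 2)) := by
    rw [hκ₃, ← Real.exp_log (show (0 : ℝ) < 8 ^ (4 * D * (d + 2)) by positivity), Real.log_pow]
    congr 1
    push_cast
    ring
  have h4 : η ^ (D - N) ≤ (8⁻¹ : ℝ) ^ (4 * D * (d + 2)) := by
    rw [hη, ← pow_mul]
    refine pow_le_pow_of_le_one (by norm_num) (by norm_num) ?_
    have h8 : D ≤ 2 * (D - N) := by omega
    calc 4 * D * (d + 2) ≤ 4 * (2 * (D - N)) * (d + 2) := by gcongr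
      _ = 8 * (d + 2) * (D - N) := by ring
  have h5 : η ^ (D - N) * Real.exp κ₃ ≤ 1 := by
    rw [h3]
    calc η ^ (D - N) * 8 ^ (4 * D * (d + 2)) ≤ (8⁻¹ : ℝ) ^ (4 * D * (d + 2)) * 8 ^ (4 * D * (d + 2)) := by
          gcongr
      _ = 1 := by rw [← mul_pow]; norm_num
  have h6 : η ^ (D - N) * (hT.gram f (8 * 8 ^ (j + a + b))).det <
      η ^ (D - N) * (Real.exp κ₃ * (hT.gram f (8 ^ (j + a + b))).det) :=
    mul_lt_mul_of_pos_left h1 (by positivity)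
  have h7 := mul_le_mul_of_nonneg_right h5 hpd.le
  rw [one_mul, mul_assoc] at h7
  exact absurd (hfin.trans_lt h6) (not_lt.2 h7)

/-- Harmonic functions of bounded gradient vanishing at the identity. -/
def lipschitzHarmonic (hT : IsSymmGen T) : Submodule ℝ (G → ℝ) where
  carrier := {f | hT.Harmonic f ∧ f 1 = 0 ∧ ∃ L : ℝ, ∀ t ∈ T, ∀ x, |f (t * x) - f x| ≤ L}
  zero_mem' := ⟨fun x => by simp, rfl, 0, by simp⟩
  add_mem' := by
    rintro f g ⟨hf, hf1, L, hL⟩ ⟨hg, hg1, L', hL'⟩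
    refine ⟨fun x => ?_, by simp [hf1, hg1], L + L', fun t ht x => ?_⟩
    · have := congrArg₂ (· + ·) (hf x) (hg x)
      simp only [← Finset.sum_add_distrib, add_zero] at this
      rw [← this]
      exact Finset.sum_congr rfl fun t _ => by simp only [Pi.add_apply]; ring
    · have := abs_add_le (f (t * x) - f x) (g (t * x) - g x)
      have e : (f + g) (t * x) - (f + g) x = (f (t * x) - f x) + (g (t * x) - g x) := by
        simp only [Pi.add_apply]; ring
      rw [e]
      linarith [hL t ht x, hL' t ht x]
  smul_mem' := by
    rintro c f ⟨hf, hf1, L, hL⟩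
    refine ⟨fun x => ?_, by simp [hf1], |c| * L, fun t ht x => ?_⟩
    · simp only [Pi.smul_apply, smul_eq_mul, ← mul_sub]
      rw [← Finset.mul_sum, hf x, mul_zero]
    · simp only [Pi.smul_apply, smul_eq_mul, ← mul_sub, abs_mul]
      exact mul_le_mul_of_nonneg_left (hL t ht x) (abs_nonneg c)

theorem finiteDimensional_lipschitzHarmonic (hG : HasGrowth d G) (hT : IsSymmGen T) :
    FiniteDimensional ℝ hT.lipschitzHarmonic := by
  obtain ⟨N, hN⟩ := hT.card_le_of_linearIndependent hG
  have h1 : Module.rank ℝ hT.lipschitzHarmonic ≤ N := by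
    refine rank_le fun s hs => ?_
    let e := s.equivFin.symm
    have h2 : LinearIndependent ℝ fun i => ((e i : hT.lipschitzHarmonic) : G → ℝ) :=
      (hs.comp e e.injective).map' hT.lipschitzHarmonic.subtype (Submodule.ker_subtype _)
    choose L hL using fun i => (e i).1.2.2.2
    refine hN _ _ (fun i => (e i).1.2.1) (fun i => (e i).1.2.2.1)
      ⟨∑ i, |L i|, fun i t ht x => (hL i t ht x).trans ((le_abs_self _).trans ?_)⟩ h2
    exact Finset.single_le_sum (f := fun i => |L i|) (fun _ _ => abs_nonneg _) (Finset.mem_univ i)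
  exact Module.rank_lt_aleph0_iff.1 (h1.trans_lt Cardinal.natCast_lt_aleph0)

end IsSymmGen

end FiniteDimension

section CommutatorContraction

variable {G : Type*} [Group G] {A : Type*} [NormedRing A] {d : ℕ}

/-- The product of the powers `g i ^ a₀`, `g (i + 1) ^ a₁`, … prescribed by a list. -/
def powWord (g : ℕ → G) : ℕ → List ℕ → G
  | _, [] => 1
  | i, a :: l => g i ^ a * powWord g (i + 1) l

theorem powWord_mem_pow {T : Set G} (h1 : (1 : G) ∈ T) {g : ℕ → G}
    (hg : ∀ i, g i ∈ T ^ 4 ^ i) {N : ℕ} (l : List ℕ) (hl : ∀ a ∈ l, a ≤ N) (i : ℕ) :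
    powWord g i l ∈ T ^ (N * (4 ^ (i + l.length) - 4 ^ i)) := by
  induction l generalizing i with
  | nil => exact Set.pow_subset_pow_right h1 (Nat.zero_le _) (by simp [powWord])
  | cons a l ih =>
    have h2 := ih (fun b hb => hl b (List.mem_cons_of_mem _ hb)) (i + 1)
    have h3 : g i ^ a ∈ T ^ (4 ^ i * a) := by
      rw [pow_mul]; exact Set.pow_mem_pow (hg i)
    have h4 := Set.mul_mem_mul h3 h2
    rw [← pow_add] at h4
    refine Set.pow_subset_pow_right h1 ?_ h4
    have ha : a ≤ N := hl a List.mem_cons_self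
    have h5 : i + 1 + l.length = i + (a :: l).length := by simp; omega
    rw [h5]
    have h6 : 4 ^ (i + 1) ≤ 4 ^ (i + (a :: l).length) :=
      Nat.pow_le_pow_right (by norm_num) (by simp)
    calc 4 ^ i * a + N * (4 ^ (i + (a :: l).length) - 4 ^ (i + 1))
        ≤ N * 4 ^ i + N * (4 ^ (i + (a :: l).length) - 4 ^ (i + 1)) := by
          rw [mul_comm]; gcongr
      _ = N * (4 ^ i + (4 ^ (i + (a :: l).length) - 4 ^ (i + 1))) := by ring
      _ ≤ _ := by
          gcongr
          rw [pow_succ] at h6 ⊢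
          omega

variable (π : G →* A) {M : ℝ}

theorem norm_pow_sub_one_le (hM : ∀ g, ‖π g‖ ≤ M) (g : G) (n : ℕ) :
    ‖π (g ^ n) - 1‖ ≤ n * M * ‖π g - 1‖ := by
  induction n with
  | zero => simp
  | succ n ih =>
    have e : π (g ^ (n + 1)) - 1 = π (g ^ n) * (π g - 1) + (π (g ^ n) - 1) := by
      rw [pow_succ, map_mul]; noncomm_ring
    rw [e]
    refine (norm_add_le _ _).trans ?_
    have := (norm_mul_le (π (g ^ n)) (π g - 1)).trans
      (mul_le_mul_of_nonneg_right (hM (g ^ n)) (norm_nonneg _))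
    push_cast
    linarith

theorem norm_map_commutator_sub_one_le (hM : ∀ g, ‖π g‖ ≤ M) (g s : G) :
    ‖π ⁅g, s⁆ - 1‖ ≤ 2 * M * ‖π s - 1‖ * ‖π g - 1‖ := by
  have e : π ⁅g, s⁆ - 1 = ((π g - 1) * (π s - 1) - (π s - 1) * (π g - 1)) * π (g⁻¹ * s⁻¹) := by
    have h1 : π ⁅g, s⁆ = π g * π s * π (g⁻¹ * s⁻¹) := by
      rw [← map_mul, ← map_mul, commutatorElement_def]; congr 1; group
    have h2 : (1 : A) = π s * π g * π (g⁻¹ * s⁻¹) := by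
      rw [← map_mul, ← map_mul, ← map_one π]; congr 1; group
    rw [h1]
    nth_rw 1 [h2]
    noncomm_ring
  rw [e]
  refine (norm_mul_le _ _).trans ?_
  have h3 : ‖(π g - 1) * (π s - 1) - (π s - 1) * (π g - 1)‖ ≤ 2 * (‖π g - 1‖ * ‖π s - 1‖) := by
    refine (norm_sub_le _ _).trans ?_
    have := norm_mul_le (π g - 1) (π s - 1)
    have := norm_mul_le (π s - 1) (π g - 1)
    linarith
  calc _ ≤ 2 * (‖π g - 1‖ * ‖π s - 1‖) * M :=
        mul_le_mul h3 (hM _) (norm_nonneg _) (by positivity)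
    _ = _ := by ring

theorem norm_powWord_sub_one_le (hM : ∀ g, ‖π g‖ ≤ M) (hM1 : 1 ≤ M) (hκ : κ ≤ 1 / 2)
    (hg : ∀ i, ‖π (g (i + 1)) - 1‖ ≤ κ * ‖π (g i) - 1‖) (l : List ℕ) (hl : ∀ a ∈ l, a ≤ N)
    (i : ℕ) : ‖π (powWord g i l) - 1‖ ≤ 2 * N * M ^ 2 * ‖π (g i) - 1‖ := by
  induction l generalizing i with
  | nil =>
    simp only [powWord, map_one, sub_self, norm_zero]
    positivity
  | cons a l ih =>
    have e : π (powWord g i (a :: l)) - 1 =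
        (π (g i ^ a) - 1) * π (powWord g (i + 1) l) + (π (powWord g (i + 1) l) - 1) := by
      simp only [powWord, map_mul]; noncomm_ring
    rw [e]
    refine (norm_add_le _ _).trans ?_
    have h1 := ih (fun b hb => hl b (List.mem_cons_of_mem _ hb)) (i + 1)
    have h2 : 2 * N * M ^ 2 * ‖π (g (i + 1)) - 1‖ ≤ 2 * N * M ^ 2 * (1 / 2 * ‖π (g i) - 1‖) := by
      gcongr
      exact (hg i).trans (mul_le_mul_of_nonneg_right hκ (norm_nonneg _))
    have ha : (a : ℝ) ≤ N := by exact_mod_cast hl a List.mem_cons_self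
    have h3 : ‖π (g i ^ a) - 1‖ ≤ N * M * ‖π (g i) - 1‖ :=
      (norm_pow_sub_one_le π hM (g i) a).trans (by gcongr)
    have h4 := (norm_mul_le (π (g i ^ a) - 1) (π (powWord g (i + 1) l))).trans
      (mul_le_mul h3 (hM _) (norm_nonneg _) (by positivity))
    nlinarith

variable [NormedAlgebra ℝ A]

theorem le_norm_pow_sub_one (hM : ∀ g, ‖π g‖ ≤ M) (hM1 : 1 ≤ M) {g : G} {N n : ℕ} (hn : n ≤ N)
    (hn0 : 0 < n) (hg : N * M * ‖π g - 1‖ ≤ 1 / 2) : ‖π g - 1‖ / 2 ≤ ‖π (g ^ n) - 1‖ := by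
  have key : ∀ m ≤ N, ‖π (g ^ m) - 1 - (m : ℝ) • (π g - 1)‖ ≤ m * (‖π g - 1‖ / 2) := by
    intro m hm
    induction m with
    | zero => simp
    | succ m ih =>
      have e : π (g ^ (m + 1)) - 1 - ((m + 1 : ℕ) : ℝ) • (π g - 1) =
          (π (g ^ m) - 1) * (π g - 1) + (π (g ^ m) - 1 - (m : ℝ) • (π g - 1)) := by
        rw [pow_succ, map_mul]; push_cast; rw [add_smul, one_smul]; noncomm_ring
      rw [e]
      refine (norm_add_le _ _).trans ?_
      have h1 := (norm_pow_sub_one_le π hM g m)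
      have h2 : (m : ℝ) * M * ‖π g - 1‖ ≤ 1 / 2 := by
        refine le_trans ?_ hg
        have : (m : ℝ) ≤ N := by exact_mod_cast (by omega : m ≤ N)
        gcongr
      have h3 := (norm_mul_le (π (g ^ m) - 1) (π g - 1)).trans
        (mul_le_mul_of_nonneg_right (h1.trans h2) (norm_nonneg _))
      have h4 := ih (by omega)
      push_cast
      linarith
  have h5 := key n hn
  have h6 := norm_sub_norm_le ((n : ℝ) • (π g - 1)) (π (g ^ n) - 1)
  rw [norm_sub_rev ((n : ℝ) • (π g - 1)), norm_smul, Real.norm_natCast] at h6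
  have h7 : (1 : ℝ) ≤ n := by exact_mod_cast hn0
  nlinarith [norm_nonneg (π g - 1)]

section Words

variable {g : ℕ → G} {N : ℕ} {κ : ℝ}

theorem powWord_injOn (hM : ∀ g, ‖π g‖ ≤ M) (hM1 : 1 ≤ M) (hκ : κ ≤ 1 / 2)
    (hκ' : 4 * N * M ^ 3 * κ < 1 / 2) (hδ : ∀ i, N * M * ‖π (g i) - 1‖ ≤ 1 / 2)
    (hg : ∀ i, ‖π (g (i + 1)) - 1‖ ≤ κ * ‖π (g i) - 1‖) (hne : ∀ i, π (g i) ≠ 1)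
    (l l' : List ℕ) (hlen : l.length = l'.length) (hl : ∀ a ∈ l, a ≤ N) (hl' : ∀ a ∈ l', a ≤ N)
    (i : ℕ) (h : powWord g i l = powWord g i l') : l = l' := by
  have main : ∀ (i a b : ℕ) (l l' : List ℕ), (∀ a ∈ l, a ≤ N) → (∀ a ∈ l', a ≤ N) → b ≤ N →
      a < b → powWord g i (a :: l) ≠ powWord g i (b :: l') := by
    intro i a b l l' hl hl' hb hab heq
    have h1 : g i ^ (b - a) = powWord g (i + 1) l * (powWord g (i + 1) l')⁻¹ := by
      simp only [powWord] at heq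
      rw [eq_mul_inv_iff_mul_eq]
      refine mul_left_cancel (a := g i ^ a) ?_
      rw [heq, ← mul_assoc, ← pow_add, Nat.add_sub_cancel' hab.le]
    have h2 := le_norm_pow_sub_one π hM hM1 (n := b - a) (by omega) (by omega) (hδ i)
    set x := powWord g (i + 1) l
    set y := powWord g (i + 1) l'
    have e : π (x * y⁻¹) - 1 = ((π x - 1) - (π y - 1)) * π y⁻¹ := by
      have : (1 : A) = π y * π y⁻¹ := by rw [← map_mul, mul_inv_cancel, map_one]
      rw [map_mul]
      nth_rw 1 [this]
      noncomm_ring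
    rw [h1, e] at h2
    have h3 := norm_powWord_sub_one_le π hM hM1 hκ hg l hl (i + 1)
    have h4 := norm_powWord_sub_one_le π hM hM1 hκ hg l' hl' (i + 1)
    have h5 : ‖(π x - 1) - (π y - 1)‖ ≤ 2 * (2 * N * M ^ 2 * (κ * ‖π (g i) - 1‖)) := by
      refine (norm_sub_le _ _).trans ?_
      have : 2 * N * M ^ 2 * ‖π (g (i + 1)) - 1‖ ≤ 2 * N * M ^ 2 * (κ * ‖π (g i) - 1‖) :=
        mul_le_mul_of_nonneg_left (hg i) (by positivity)
      linarith
    have h6 := (norm_mul_le ((π x - 1) - (π y - 1)) (π y⁻¹)).trans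
      (mul_le_mul h5 (hM _) (norm_nonneg _) ((norm_nonneg _).trans h5))
    have h7 : 0 < ‖π (g i) - 1‖ := norm_pos_iff.2 (sub_ne_zero.2 (hne i))
    nlinarith
  induction l generalizing l' i with
  | nil => exact (List.length_eq_zero_iff.1 hlen.symm).symm
  | cons a l ih =>
    obtain _ | ⟨b, l'⟩ := l'
    · simp at hlen
    have t1 : ∀ c ∈ l, c ≤ N := fun c hc => hl c (List.mem_cons_of_mem _ hc)
    have t2 : ∀ c ∈ l', c ≤ N := fun c hc => hl' c (List.mem_cons_of_mem _ hc)
    rcases lt_trichotomy a b with hab | rfl | hab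
    · exact absurd h (main i a b l l' t1 t2 (hl' b List.mem_cons_self) hab)
    · rw [ih l' (by simpa using hlen) t1 t2 (i + 1) (by simpa [powWord] using h)]
    · exact absurd h.symm (main i b a l' l t2 t1 (hl a List.mem_cons_self) hab)

end Words

theorem powWord_commutator_mem {T : Set G} (h1 : (1 : G) ∈ T) (hinv : ∀ t ∈ T, t⁻¹ ∈ T)
    {g s : ℕ → G} (h0 : g 0 ∈ T) (hs : ∀ i, s i ∈ T) (hg : ∀ i, g (i + 1) = ⁅g i, s i⁆) (i : ℕ) :
    g i ∈ T ^ 4 ^ i := by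
  have hT : T⁻¹ = T := by
    ext t; exact ⟨fun h => by simpa using hinv _ h, fun h => hinv _ h⟩
  induction i with
  | zero => simpa using h0
  | succ i ih =>
    have h2 : (g i)⁻¹ ∈ T ^ 4 ^ i := by
      have := Set.inv_mem_inv.2 ih
      rwa [← inv_pow, hT] at this
    have h3 := Set.mul_mem_mul (Set.mul_mem_mul (Set.mul_mem_mul ih (hs i)) h2) (hinv _ (hs i))
    rw [hg, commutatorElement_def]
    refine Set.pow_subset_pow_right h1 ?_ (by rwa [← pow_succ, ← pow_add, ← pow_succ] at h3)
    have := Nat.one_le_pow i 4 (by norm_num)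
    rw [pow_succ]
    omega

/-- In a group of polynomial growth, iterated commutators with elements that act almost trivially
under a bounded representation must eventually act trivially. -/
theorem exists_pos_commutator_eq_one (hG : HasGrowth d G) (hM : ∀ g, ‖π g‖ ≤ M) (hM1 : 1 ≤ M) :
    ∃ ε > 0, ∀ g s : ℕ → G, (Set.range s).Finite → (∀ i, ‖π (s i) - 1‖ < ε) →
      ‖π (g 0) - 1‖ < ε → (∀ i, g (i + 1) = ⁅g i, s i⁆) → ∃ i, π (g i) = 1 := by
  set N : ℕ := 2 * 4 ^ d with hN
  have hN0 : (0 : ℝ) < N := by rw [hN]; positivity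
  have hM0 : 0 < M := by linarith
  set ε : ℝ := 1 / (32 * N * M ^ 4) with hε
  have hε0 : 0 < ε := by positivity
  have hN1 : (1 : ℝ) ≤ N := by
    have : 1 ≤ N := by rw [hN]; have := Nat.one_le_pow d 4 (by norm_num); omega
    exact_mod_cast this
  have hM4 : (1 : ℝ) ≤ M ^ 3 := one_le_pow₀ hM1
  set κ : ℝ := 2 * M * ε with hκ
  have hκ1 : 4 * N * M ^ 3 * κ = 1 / 4 := by rw [hκ, hε]; field_simp; norm_num
  have hκ0 : 0 < κ := by positivity
  have hNM : (1 : ℝ) ≤ N * M ^ 3 := one_le_mul_of_one_le_of_one_le hN1 hM4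
  have hκ2 : κ ≤ 1 / 2 := by nlinarith
  have hNε : N * M * ε ≤ 1 / 2 := by
    have : N * M * ε = N * κ / 2 := by rw [hκ]; ring
    rw [this]
    nlinarith
  refine ⟨ε, hε0, fun g s hfin hs h0 hg => ?_⟩
  by_contra! hne
  have hstep : ∀ i, ‖π (g (i + 1)) - 1‖ ≤ κ * ‖π (g i) - 1‖ := fun i => by
    rw [hg]
    refine (norm_map_commutator_sub_one_le π hM _ _).trans ?_
    rw [hκ]
    have := (hs i).le
    gcongr
  have hle : ∀ i, ‖π (g i) - 1‖ ≤ ε := by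
    intro i
    induction i with
    | zero => exact h0.le
    | succ i ih =>
      refine (hstep i).trans ?_
      nlinarith [norm_nonneg (π (g i) - 1)]
  have hδ : ∀ i, N * M * ‖π (g i) - 1‖ ≤ 1 / 2 := fun i =>
    (mul_le_mul_of_nonneg_left (hle i) (by positivity)).trans hNε
  set T₀ : Set G := insert 1 (insert (g 0) (Set.range s)) with hT₀
  set T : Set G := T₀ ∪ T₀⁻¹ with hT
  have hTfin : T.Finite := by
    have : T₀.Finite := (hfin.insert _).insert _
    exact this.union this.inv
  have hT1 : (1 : G) ∈ T := Or.inl (Set.mem_insert _ _)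
  have hTinv : ∀ t ∈ T, t⁻¹ ∈ T := by
    rintro t (h | h)
    · exact Or.inr (by simpa using h)
    · exact Or.inl h
  have hmem := powWord_commutator_mem hT1 hTinv (g := g) (s := s)
    (Or.inl (Set.mem_insert_of_mem _ (Set.mem_insert _ _)))
    (fun i => Or.inl (Set.mem_insert_of_mem _ (Set.mem_insert_of_mem _ ⟨i, rfl⟩))) hg
  obtain ⟨C, hC⟩ := hG T hTfin
  have hcount : ∀ m : ℕ, N ^ m ≤ C * (N * 4 ^ m + 1) ^ d := by
    intro m
    refine le_trans ?_ (hC (N * 4 ^ m))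
    let F : (Fin m → Fin N) → G := fun a => powWord g 0 (List.ofFn fun i => (a i : ℕ))
    have hF : Function.Injective F := by
      intro a b hab
      have h5 := powWord_injOn π hM hM1 hκ2 (by rw [hκ1]; norm_num) hδ hstep hne
        (List.ofFn fun i => (a i : ℕ)) (List.ofFn fun i => (b i : ℕ)) (by simp)
        (by simp only [List.mem_ofFn]; rintro _ ⟨i, rfl⟩; exact (a i).2.le)
        (by simp only [List.mem_ofFn]; rintro _ ⟨i, rfl⟩; exact (b i).2.le) 0 hab
      have h6 := List.ofFn_injective h5
      funext i
      exact Fin.ext (congrFun h6 i)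
    have h7 : (Set.range F).ncard = N ^ m := by
      rw [← Set.image_univ, Set.ncard_image_of_injective _ hF]; simp
    rw [← h7]
    refine Set.ncard_le_ncard ?_ (set_finite_pow hTfin _)
    rintro _ ⟨a, rfl⟩
    have := powWord_mem_pow hT1 hmem (N := N) (List.ofFn fun i => (a i : ℕ))
      (by simp only [List.mem_ofFn]; rintro _ ⟨i, rfl⟩; exact (a i).2.le) 0
    refine Set.pow_subset_pow_right hT1 (Nat.mul_le_mul_left N ?_) this
    simp
  have hexp : ∀ m : ℕ, 2 ^ m ≤ C * (N + 1) ^ d := by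
    intro m
    have h8 : C * (N * 4 ^ m + 1) ^ d ≤ C * ((N + 1) * 4 ^ m) ^ d := by
      gcongr
      have := Nat.one_le_pow m 4 (by norm_num)
      nlinarith
    have h9 := (hcount m).trans h8
    rw [mul_pow, hN, mul_pow, ← pow_mul, ← pow_mul, mul_comm d m, ← mul_assoc] at h9
    exact Nat.le_of_mul_le_mul_right h9 (by positivity)
  have := hexp (C * (N + 1) ^ d)
  exact absurd this (not_le.2 (Nat.lt_two_pow_self))

end CommutatorContraction

section FiniteIndex

variable {G : Type*} [Group G]

theorem exists_finite_subset_closure_eq {S : Set G} (hS : (Subgroup.closure S).FG) :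
    ∃ F ⊆ S, F.Finite ∧ Subgroup.closure F = Subgroup.closure S := by
  have key : ∀ x ∈ Subgroup.closure S, ∃ F ⊆ S, F.Finite ∧ x ∈ Subgroup.closure F := by
    intro x hx
    induction hx using Subgroup.closure_induction with
    | mem x hx =>
      exact ⟨{x}, by simpa using hx, Set.finite_singleton x, Subgroup.subset_closure rfl⟩
    | one => exact ⟨∅, Set.empty_subset _, Set.finite_empty, Subgroup.one_mem _⟩
    | mul x y _ _ hx hy =>
      obtain ⟨F, hF, hFf, hxF⟩ := hx
      obtain ⟨F', hF', hFf', hyF⟩ := hy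
      exact ⟨F ∪ F', Set.union_subset hF hF', hFf.union hFf',
        Subgroup.mul_mem _ (Subgroup.closure_mono Set.subset_union_left hxF)
          (Subgroup.closure_mono Set.subset_union_right hyF)⟩
    | inv x _ hx =>
      obtain ⟨F, hF, hFf, hxF⟩ := hx
      exact ⟨F, hF, hFf, Subgroup.inv_mem _ hxF⟩
  obtain ⟨X, hX⟩ := hS
  choose! F hFS hFf hF using key
  have hXS : ∀ x ∈ X, x ∈ Subgroup.closure S := fun x hx => hX ▸ Subgroup.subset_closure hx
  have hU : (⋃ x ∈ X, F x) ⊆ S := Set.iUnion₂_subset fun x hx => hFS x (hXS x hx)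
  refine ⟨⋃ x ∈ X, F x, hU, X.finite_toSet.biUnion fun x hx => hFf x (hXS x hx), ?_⟩
  refine le_antisymm (Subgroup.closure_mono hU) ?_
  rw [← hX, Subgroup.closure_le]
  exact fun x hx => Subgroup.closure_mono (Set.subset_biUnion_of_mem (u := F) hx)
    (hF x (hXS x hx))

variable {A : Type*} [NormedRing A] [ProperSpace A] (π : G →* A) {M : ℝ}

theorem finiteIndex_closure_norm_sub_one_lt (hM : ∀ g, ‖π g‖ ≤ M) {ε : ℝ} (hε : 0 < ε) :
    (Subgroup.closure {g | ‖π g - 1‖ < ε}).FiniteIndex := by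
  set H := Subgroup.closure {g | ‖π g - 1‖ < ε}
  have hM0 : 0 ≤ M := (norm_nonneg _).trans (hM 1)
  set r := ε / (2 * (M + 1)) with hr
  have hr0 : 0 < r := by positivity
  obtain ⟨t, -, htf, ht⟩ :=
    (isCompact_closedBall (0 : A) M).finite_cover_balls hr0
  have hcov : ∀ q : G ⧸ H, ∃ a ∈ t, ‖π q.out - a‖ < r := by
    intro q
    have := ht (show π q.out ∈ _ by simpa using hM q.out)
    simpa [dist_eq_norm] using this
  choose f hft hf using hcov
  have hinj : Function.Injective (fun q => (⟨f q, hft q⟩ : t)) := by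
    intro p q hpq
    have hpq' : f p = f q := congrArg Subtype.val hpq
    rw [← Quotient.out_eq' p, ← Quotient.out_eq' q]
    refine QuotientGroup.eq.2 (Subgroup.subset_closure ?_)
    have e : π (p.out⁻¹ * q.out) - 1 = π p.out⁻¹ * (π q.out - π p.out) := by
      rw [mul_sub, ← map_mul, ← map_mul, inv_mul_cancel, map_one]
    have h1 : ‖π q.out - π p.out‖ < 2 * r := by
      have : π q.out - π p.out = (π q.out - f q) - (π p.out - f p) := by rw [hpq']; abel
      rw [this]
      linarith [norm_sub_le (π q.out - f q) (π p.out - f p), hf p, hf q]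
    show ‖π (p.out⁻¹ * q.out) - 1‖ < ε
    rw [e]
    calc _ ≤ ‖π p.out⁻¹‖ * ‖π q.out - π p.out‖ := norm_mul_le _ _
      _ ≤ M * (2 * r) := by gcongr; exact hM _
      _ < (M + 1) * (2 * r) := by nlinarith
      _ = ε := by rw [hr]; field_simp
  have : Finite t := htf
  have : Finite (G ⧸ H) := Finite.of_injective _ hinj
  exact Subgroup.finiteIndex_of_finite_quotient

end FiniteIndex

section Matrix

attribute [local instance] Matrix.linftyOpNormedRing Matrix.linftyOpNormedAlgebra

variable {G : Type*} [Group G] {d n : ℕ} (π : G →* Matrix (Fin n) (Fin n) ℂ) {M : ℝ}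

theorem map_commutator_eq_one_of_scalar (hn : 0 < n) (g s : G) {η : ℝ}
    (hη : ∀ z : ℂ, z ^ n = 1 → ‖z - 1‖ < η → z = 1) (hgs : ‖π ⁅g, s⁆ - 1‖ < η)
    (hc : π ⁅g, s⁆ ∈ Set.center (Matrix (Fin n) (Fin n) ℂ)) : π ⁅g, s⁆ = 1 := by
  have : Nonempty (Fin n) := ⟨⟨0, hn⟩⟩
  rw [Matrix.center_eq_range] at hc
  obtain ⟨z, hz⟩ := hc
  have hdet : (π ⁅g, s⁆).det = 1 := by
    have : ((Matrix.detMonoidHom).comp π) ⁅g, s⁆ = 1 := by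
      have h1 : ∀ a, ((Matrix.detMonoidHom).comp π) a * ((Matrix.detMonoidHom).comp π) a⁻¹ = 1 := by
        intro a; rw [← map_mul, mul_inv_cancel, map_one]
      rw [commutatorElement_def, map_mul, map_mul, map_mul]
      linear_combination h1 g * (((Matrix.detMonoidHom).comp π) s *
        ((Matrix.detMonoidHom).comp π) s⁻¹) + h1 s
    exact this
  have hzn : z ^ n = 1 := by
    rw [← hz] at hdet
    simpa using hdet
  have hz1 : ‖z - 1‖ < η := by
    have e : π ⁅g, s⁆ - 1 = (z - 1) • (1 : Matrix (Fin n) (Fin n) ℂ) := by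
      rw [← hz, sub_smul, one_smul]
      simp [Matrix.smul_one_eq_diagonal]
    rw [e, norm_smul, norm_one, mul_one] at hgs
    exact hgs
  rw [← hz, hη z hzn hz1]
  simp

theorem exists_forall_norm_sub_one_lt (hn : 0 < n) :
    ∃ η > 0, ∀ z : ℂ, z ^ n = 1 → ‖z - 1‖ < η → z = 1 := by
  have hfin : Set.Finite {z : ℂ | z ^ n = 1 ∧ z ≠ 1} :=
    (Polynomial.nthRootsFinset n (1 : ℂ)).finite_toSet.subset fun z hz => by
      simpa [Polynomial.mem_nthRootsFinset hn] using hz.1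
  have h1 : (1 : ℂ) ∈ {z : ℂ | z ^ n = 1 ∧ z ≠ 1}ᶜ := by simp
  obtain ⟨η, hη, hsub⟩ := Metric.isOpen_iff.1 hfin.isClosed.isOpen_compl 1 h1
  refine ⟨η, hη, fun z hz hz1 => ?_⟩
  by_contra hne
  exact hsub (show z ∈ Metric.ball 1 η by simpa [dist_eq_norm] using hz1) ⟨hz, hne⟩

/-- A bounded complex linear group of polynomial growth has a finite index subgroup that either
is scalar or centralizes one of its own non-scalar elements. -/
theorem exists_finiteIndex_scalar_or_commute [Group.FG G] (hG : HasGrowth d G) (hn : 0 < n)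
    (hM : ∀ g, ‖π g‖ ≤ M) :
    ∃ H : Subgroup G, H.FiniteIndex ∧
      ((∀ h ∈ H, π h ∈ Set.center (Matrix (Fin n) (Fin n) ℂ)) ∨
        ∃ c ∈ H, π c ∉ Set.center (Matrix (Fin n) (Fin n) ℂ) ∧
          ∀ h ∈ H, π c * π h = π h * π c) := by
  have : Nonempty (Fin n) := ⟨⟨0, hn⟩⟩
  have : ProperSpace (Matrix (Fin n) (Fin n) ℂ) := FiniteDimensional.proper ℂ _
  have hM1 : 1 ≤ M := by
    have := hM 1
    rwa [map_one, norm_one] at this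
  obtain ⟨η, hη, hroot⟩ := exists_forall_norm_sub_one_lt hn
  obtain ⟨ε, hε, hcore⟩ := exists_pos_commutator_eq_one π hG hM hM1
  set δ := min ε (η / (2 * M * (M + 1) + 1)) with hδ
  have hδ0 : 0 < δ := by positivity
  set H := Subgroup.closure {g | ‖π g - 1‖ < δ} with hH
  have hfi : H.FiniteIndex := finiteIndex_closure_norm_sub_one_lt π hM hδ0
  refine ⟨H, hfi, ?_⟩
  by_contra! hcon
  obtain ⟨⟨h, hhH, hh⟩, hcon⟩ := hcon
  obtain ⟨F, hFS, hFf, hF⟩ := exists_finite_subset_closure_eq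
    (S := {g | ‖π g - 1‖ < δ}) ((Group.fg_iff_subgroup_fg H).1 inferInstance)
  rw [← hH] at hF
  have hFH : ∀ s ∈ F, s ∈ H := fun s hs => hF ▸ Subgroup.subset_closure hs
  have hinv : ∀ g, π g * π g⁻¹ = 1 := fun g => by rw [← map_mul, mul_inv_cancel, map_one]
  have hinv' : ∀ g, π g⁻¹ * π g = 1 := fun g => by rw [← map_mul, inv_mul_cancel, map_one]
  have hcl : ∀ c : Matrix (Fin n) (Fin n) ℂ, (∀ s ∈ F, c * π s = π s * c) →
      ∀ h ∈ H, c * π h = π h * c := by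
    intro c hc h hh
    rw [← hF] at hh
    induction hh using Subgroup.closure_induction with
    | mem x hx => exact hc x hx
    | one => simp
    | mul x y _ _ hx hy => rw [map_mul, ← mul_assoc, hx, mul_assoc, hy, mul_assoc]
    | inv x _ hx =>
      calc c * π x⁻¹ = π x⁻¹ * (π x * c) * π x⁻¹ := by
            rw [← mul_assoc (π x⁻¹), hinv', one_mul]
        _ = _ := by rw [← hx, mul_assoc, mul_assoc, hinv, mul_one]
  have hnext : ∀ c ∈ H, π c ∉ Set.center (Matrix (Fin n) (Fin n) ℂ) →
      ∃ s ∈ F, ⁅c, s⁆ ∈ H ∧ π ⁅c, s⁆ ∉ Set.center (Matrix (Fin n) (Fin n) ℂ) := by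
    intro c hc hcc
    obtain ⟨h, hh, hne⟩ := hcon c hc hcc
    obtain ⟨s, hs, hsne⟩ : ∃ s ∈ F, π c * π s ≠ π s * π c := by
      by_contra! hall
      exact hne (hcl _ hall h hh)
    refine ⟨s, hs, ?_, fun hcen => hsne ?_⟩
    · rw [commutatorElement_def]
      exact H.mul_mem (H.mul_mem (H.mul_mem hc (hFH s hs)) (H.inv_mem hc)) (H.inv_mem (hFH s hs))
    have hlt : ‖π ⁅c, s⁆ - 1‖ < η := by
      have hb := norm_map_commutator_sub_one_le π hM c s
      have h1 : ‖π c - 1‖ ≤ M + 1 := (norm_sub_le _ _).trans (by rw [norm_one]; linarith [hM c])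
      have h2 : ‖π s - 1‖ ≤ η / (2 * M * (M + 1) + 1) := (hFS hs).le.trans (min_le_right _ _)
      have h0 : 0 < M := by linarith
      calc _ ≤ 2 * M * (η / (2 * M * (M + 1) + 1)) * (M + 1) := hb.trans (by gcongr)
        _ = (2 * M * (M + 1)) / (2 * M * (M + 1) + 1) * η := by ring
        _ < 1 * η := by
            gcongr
            rw [div_lt_one (by positivity)]
            linarith
        _ = η := one_mul _
    have h1 := map_commutator_eq_one_of_scalar π hn c s hroot hlt hcen
    have h2 : π ⁅c, s⁆ * (π s * π c) = π c * π s := by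
      rw [← map_mul, ← map_mul, ← map_mul, commutatorElement_def]
      congr 1; group
    rw [h1, one_mul] at h2
    exact h2.symm
  obtain ⟨s₀, hs₀, hs₀c⟩ : ∃ s ∈ F, π s ∉ Set.center (Matrix (Fin n) (Fin n) ℂ) := by
    by_contra! hall
    refine hh (Semigroup.mem_center_iff.2 fun B => ?_)
    exact hcl B (fun s hs => Semigroup.mem_center_iff.1 (hall s hs) B) h hhH
  choose! nx hnxF hnxH hnxc using hnext
  let g : ℕ → G := fun i => Nat.rec s₀ (fun _ x => ⁅x, nx x⁆) i
  have hg : ∀ i, g i ∈ H ∧ π (g i) ∉ Set.center (Matrix (Fin n) (Fin n) ℂ) := by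
    intro i
    induction i with
    | zero => exact ⟨hFH _ hs₀, hs₀c⟩
    | succ i ih => exact ⟨hnxH _ ih.1 ih.2, hnxc _ ih.1 ih.2⟩
  obtain ⟨i, hi⟩ := hcore g (fun i => nx (g i))
    (hFf.subset (by rintro _ ⟨i, rfl⟩; exact hnxF _ (hg i).1 (hg i).2))
    (fun i => lt_of_lt_of_le (hFS (hnxF _ (hg i).1 (hg i).2)) (min_le_left _ _))
    (lt_of_lt_of_le (hFS hs₀) (min_le_left _ _)) (fun i => rfl)
  exact (hg i).2 (hi ▸ Set.one_mem_center)

end Matrix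

section WeaklyBounded

/-- A representation all of whose matrix coefficients are bounded. -/
def WeaklyBounded {G V : Type*} [Group G] [AddCommGroup V] [Module ℂ V]
    (ρ : Representation ℂ G V) : Prop :=
  ∀ (v : V) (φ : V →ₗ[ℂ] ℂ), ∃ C : ℝ, ∀ g, ‖φ (ρ g v)‖ ≤ C

variable {G V : Type*} [Group G] [AddCommGroup V] [Module ℂ V] {ρ : Representation ℂ G V}

theorem WeaklyBounded.comp {H : Type*} [Group H] (hρ : WeaklyBounded ρ) (f : H →* G) :
    WeaklyBounded (ρ.comp f : Representation ℂ H V) := fun v φ =>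
  (hρ v φ).imp fun _ hC h => hC (f h)

theorem WeaklyBounded.subrepresentation (hρ : WeaklyBounded ρ) (W : Submodule ℂ V)
    (hW : ∀ g, W ≤ W.comap (ρ g)) : WeaklyBounded (ρ.subrepresentation W hW) := by
  intro v φ
  obtain ⟨ψ, hψ⟩ := φ.exists_extend
  obtain ⟨C, hC⟩ := hρ v ψ
  refine ⟨C, fun g => ?_⟩
  have := hC g
  rw [← hψ]
  exact this

theorem WeaklyBounded.quotient (hρ : WeaklyBounded ρ) (W : Submodule ℂ V)
    (hW : ∀ g, W ≤ W.comap (ρ g)) : WeaklyBounded (ρ.quotient W hW) := by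
  intro v φ
  obtain ⟨v, rfl⟩ := W.mkQ_surjective v
  exact hρ v (φ ∘ₗ W.mkQ)

theorem WeaklyBounded.eq_one_of_unipotent (hρ : WeaklyBounded ρ) (u : G)
    (hu : ∀ v, ρ u (ρ u v - v) = ρ u v - v) : ρ u = 1 := by
  have hpow : ∀ (n : ℕ) v, ρ (u ^ n) v = v + n • (ρ u v - v) := by
    intro n v
    induction n with
    | zero => simp
    | succ n ih =>
      rw [pow_succ', map_mul, Module.End.mul_apply, ih, map_add, map_nsmul, hu, succ_nsmul]
      abel
  ext v
  rw [Module.End.one_apply, ← sub_eq_zero, ← Module.forall_dual_apply_eq_zero_iff ℂ]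
  intro φ
  obtain ⟨C, hC⟩ := hρ v φ
  by_contra hne
  have hpos : 0 < ‖φ (ρ u v - v)‖ := norm_pos_iff.2 hne
  obtain ⟨n, hn⟩ := exists_nat_gt ((C + ‖φ v‖) / ‖φ (ρ u v - v)‖)
  rw [div_lt_iff₀ hpos] at hn
  have h1 := hC (u ^ n)
  rw [hpow, map_add, map_nsmul] at h1
  have h2 : ‖n • φ (ρ u v - v)‖ = n * ‖φ (ρ u v - v)‖ := by
    rw [nsmul_eq_mul, norm_mul, Complex.norm_natCast]
  have h3 := norm_sub_le (φ v + n • φ (ρ u v - v)) (φ v)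
  rw [add_sub_cancel_left, h2] at h3
  linarith

attribute [local instance] Matrix.linftyOpNormedRing Matrix.linftyOpNormedAlgebra in
theorem WeaklyBounded.exists_norm_toMatrix_le {n : ℕ} (hρ : WeaklyBounded ρ)
    (b : Module.Basis (Fin n) ℂ V) :
    ∃ M : ℝ, ∀ g, ‖LinearMap.toMatrixAlgEquiv b (ρ g)‖ ≤ M := by
  choose C hC using fun i j : Fin n => hρ (b j) (b.coord i)
  refine ⟨∑ i, ∑ j, C i j * ‖Matrix.single i j (1 : ℂ)‖, fun g => ?_⟩
  rw [Matrix.matrix_eq_sum_single (LinearMap.toMatrixAlgEquiv b (ρ g))]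
  refine (norm_sum_le _ _).trans (Finset.sum_le_sum fun i _ => ?_)
  refine (norm_sum_le _ _).trans (Finset.sum_le_sum fun j _ => ?_)
  have e : Matrix.single i j (LinearMap.toMatrixAlgEquiv b (ρ g) i j) =
      (LinearMap.toMatrixAlgEquiv b (ρ g) i j) • Matrix.single i j (1 : ℂ) := by
    simp [Matrix.smul_single]
  rw [e, norm_smul]
  gcongr
  simpa [LinearMap.toMatrixAlgEquiv_apply] using hC i j g

theorem exists_finiteIndex_commute {d : ℕ} (n : ℕ) :
    ∀ (G : Type u) [Group G] [Group.FG G] (_ : HasGrowth d G)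
      (V : Type v) [AddCommGroup V] [Module ℂ V] [FiniteDimensional ℂ V]
      (_ : Module.finrank ℂ V = n) (ρ : Representation ℂ G V) (_ : WeaklyBounded ρ),
      ∃ H : Subgroup G, H.FiniteIndex ∧ ∀ h ∈ H, ∀ h' ∈ H, ρ h * ρ h' = ρ h' * ρ h := by
  induction n using Nat.strong_induction_on with
  | _ n ih =>
  intro G _ _ hG V _ _ _ hV ρ hρ
  rcases Nat.eq_zero_or_pos n with hn | hn
  · have : Subsingleton V := Module.finrank_zero_iff.1 (hV.trans hn)
    exact ⟨⊤, inferInstance, fun _ _ _ _ => Subsingleton.elim _ _⟩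
  let b : Module.Basis (Fin n) ℂ V := Module.finBasisOfFinrankEq ℂ V hV
  obtain ⟨M, hM⟩ := hρ.exists_norm_toMatrix_le b
  let π : G →* Matrix (Fin n) (Fin n) ℂ :=
    ((LinearMap.toMatrixAlgEquiv b : (V →ₗ[ℂ] V) ≃ₐ[ℂ] _) : (V →ₗ[ℂ] V) →* _).comp ρ
  have hinj : ∀ x y : V →ₗ[ℂ] V,
      LinearMap.toMatrixAlgEquiv b x = LinearMap.toMatrixAlgEquiv b y → x = y :=
    fun x y h => (LinearMap.toMatrixAlgEquiv b).injective h
  obtain ⟨H, hHfi, hH | ⟨c, hcH, hc, hcH'⟩⟩ := exists_finiteIndex_scalar_or_commute π hG hn hM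
  · refine ⟨H, hHfi, fun h hh h' _ => hinj _ _ ?_⟩
    rw [map_mul, map_mul]
    exact (Semigroup.mem_center_iff.1 (hH h hh) _).symm
  have hcomm : ∀ h ∈ H, ρ c * ρ h = ρ h * ρ c := by
    intro h hh
    refine hinj _ _ ?_
    rw [map_mul, map_mul]
    exact hcH' h hh
  have : Nontrivial V := Module.nontrivial_of_finrank_pos (hV ▸ hn)
  obtain ⟨μ, hμ⟩ := Module.End.exists_eigenvalue (ρ c)
  set W := Module.End.eigenspace (ρ c) μ with hW
  have hWbot : W ≠ ⊥ := hμ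
  have hWtop : W ≠ ⊤ := by
    intro htop
    apply hc
    have e : ρ c = algebraMap ℂ (V →ₗ[ℂ] V) μ := by
      ext v
      have : v ∈ W := htop ▸ Submodule.mem_top
      rw [hW, Module.End.mem_eigenspace_iff] at this
      rw [this]; rfl
    have e2 : π c = algebraMap ℂ _ μ := by
      show LinearMap.toMatrixAlgEquiv b (ρ c) = _
      rw [e, AlgEquiv.commutes]
    rw [e2]
    exact Semigroup.mem_center_iff.2 fun B => (Algebra.commutes _ _).symm
  let σ : Representation ℂ H V := ρ.comp H.subtype
  have hσ : WeaklyBounded σ := hρ.comp H.subtype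
  have hinv : ∀ h : H, W ≤ W.comap (σ h) := by
    intro h v hv
    rw [hW, Module.End.mem_eigenspace_iff] at hv
    rw [Submodule.mem_comap, hW, Module.End.mem_eigenspace_iff]
    have := LinearMap.congr_fun (hcomm h h.2) v
    simp only [Module.End.mul_apply] at this
    show ρ c (ρ h v) = μ • ρ h v
    rw [this, hv, map_smul]
  have hlt1 : Module.finrank ℂ W < n := hV ▸ Submodule.finrank_lt hWtop
  have hlt2 : Module.finrank ℂ (V ⧸ W) < n := by
    have h1 := Submodule.finrank_quotient_add_finrank W
    have h2 : 0 < Module.finrank ℂ W := by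
      have : Nontrivial W := Submodule.nontrivial_iff_ne_bot.2 hWbot
      exact Module.finrank_pos
    omega
  obtain ⟨K₁, hK₁, hc₁⟩ := ih _ hlt1 H (hG.subgroup H) W rfl _ (hσ.subrepresentation W hinv)
  obtain ⟨K₂, hK₂, hc₂⟩ := ih _ hlt2 H (hG.subgroup H) (V ⧸ W) rfl _ (hσ.quotient W hinv)
  refine ⟨(K₁ ⊓ K₂).map H.subtype, ⟨?_⟩, ?_⟩
  · rw [Subgroup.index_map_subtype]
    exact mul_ne_zero Subgroup.FiniteIndex.index_ne_zero hHfi.index_ne_zero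
  have key : ∀ k ∈ K₁ ⊓ K₂, ∀ k' ∈ K₁ ⊓ K₂, σ k * σ k' = σ k' * σ k := by
    intro k hk k' hk'
    have hW1 : ∀ w ∈ W, σ k (σ k' w) = σ k' (σ k w) := by
      intro w hw
      have := LinearMap.congr_fun (hc₁ k hk.1 k' hk'.1) ⟨w, hw⟩
      exact congrArg Subtype.val this
    have hQ : ∀ v, σ k (σ k' v) - σ k' (σ k v) ∈ W := by
      intro v
      rw [← Submodule.Quotient.eq]
      exact LinearMap.congr_fun (hc₂ k hk.2 k' hk'.2) (W.mkQ v)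
    have hmul : ∀ (x y : H) v, σ (x * y) v = σ x (σ y v) := fun x y v => by
      rw [map_mul]; rfl
    have hu1 : ∀ w ∈ W, σ (k * k' * (k' * k)⁻¹) w = w := by
      intro w hw
      rw [hmul, hmul]
      rw [hW1 _ (hinv _ hw), ← hmul, ← hmul, mul_inv_cancel, map_one]
      rfl
    have hu2 : ∀ v, σ (k * k' * (k' * k)⁻¹) v - v ∈ W := by
      intro v
      have := hQ (σ (k' * k)⁻¹ v)
      rw [hmul, hmul]
      have e : σ k' (σ k (σ (k' * k)⁻¹ v)) = v := by
        rw [← hmul, ← hmul, mul_inv_cancel, map_one]; rfl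
      rwa [e] at this
    have h1 := hσ.eq_one_of_unipotent (k * k' * (k' * k)⁻¹) fun v => hu1 _ (hu2 v)
    calc σ k * σ k' = σ (k * k' * (k' * k)⁻¹) * σ (k' * k) := by
          rw [← map_mul, ← map_mul]; congr 1; group
      _ = _ := by rw [h1, one_mul, map_mul]
  rintro _ ⟨k, hk, rfl⟩ _ ⟨k', hk', rfl⟩
  exact key k hk k' hk'

end WeaklyBounded

section SurjectiveInt

theorem AddCommGroup.exists_surjective_int (A : Type*) [AddCommGroup A] [AddGroup.FG A]
    [Infinite A] : ∃ χ : A →+ ℤ, Function.Surjective χ := by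
  have : Module.Finite ℤ A := Module.Finite.iff_addGroup_fg.2 inferInstance
  let Q := A ⧸ Submodule.torsion ℤ A
  let b := Module.Free.chooseBasis ℤ Q
  have hne : Nonempty (Module.Free.ChooseBasisIndex ℤ Q) := by
    by_contra hemp
    rw [not_nonempty_iff] at hemp
    have hQ : Subsingleton Q := b.repr.toEquiv.subsingleton
    have htors : Module.IsTorsion ℤ A := by
      exact (Submodule.isTorsion'_iff_torsion'_eq_top _).2
        (Submodule.Quotient.subsingleton_iff.1 hQ)
    have := Module.finite_of_fg_torsion A htors
    exact not_finite A
  obtain ⟨i⟩ := hne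
  refine ⟨((b.coord i) ∘ₗ (Submodule.mkQ _)).toAddMonoidHom, fun n => ?_⟩
  obtain ⟨a, ha⟩ := Submodule.mkQ_surjective (Submodule.torsion ℤ A) (n • b i)
  refine ⟨a, ?_⟩
  show b.coord i (Submodule.mkQ _ a) = n
  rw [ha]
  simp

theorem exists_surjective_int_of_commute {H U : Type*} [Group H] [Group.FG H] [Group U]
    (f : H →* U) (hcomm : ∀ a b, f a * f b = f b * f a) (hinf : Infinite f.range) :
    ∃ χ : H →* Multiplicative ℤ, Function.Surjective χ := by
  let : CommGroup f.range :=
    { (inferInstance : Group f.range) with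
      mul_comm := by
        rintro ⟨_, a, rfl⟩ ⟨_, b, rfl⟩
        exact Subtype.ext (hcomm a b) }
  have : Group.FG f.range := Group.fg_range f
  have : AddGroup.FG (Additive f.range) := GroupFG.iff_add_fg.1 this
  have : Infinite (Additive f.range) := hinf
  obtain ⟨χ, hχ⟩ := AddCommGroup.exists_surjective_int (Additive f.range)
  refine ⟨(AddMonoidHom.toMultiplicativeRight χ).comp f.rangeRestrict, ?_⟩
  exact Function.Surjective.comp (g := AddMonoidHom.toMultiplicativeRight χ) hχ
    f.rangeRestrict_surjective

end SurjectiveInt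

namespace IsSymmGen

variable {G : Type*} [Group G] {T : Set G} {d : ℕ}

/-- Complex functions whose real and imaginary parts are Lipschitz harmonic. -/
def complexHarmonic (hT : IsSymmGen T) : Submodule ℂ (G → ℂ) where
  carrier := {f | (fun x => (f x).re) ∈ hT.lipschitzHarmonic ∧
    (fun x => (f x).im) ∈ hT.lipschitzHarmonic}
  zero_mem' := ⟨hT.lipschitzHarmonic.zero_mem, hT.lipschitzHarmonic.zero_mem⟩
  add_mem' := fun hf hg =>
    ⟨hT.lipschitzHarmonic.add_mem hf.1 hg.1, hT.lipschitzHarmonic.add_mem hf.2 hg.2⟩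
  smul_mem' := by
    rintro c f ⟨hf, hg⟩
    refine ⟨?_, ?_⟩
    · convert hT.lipschitzHarmonic.sub_mem (hT.lipschitzHarmonic.smul_mem c.re hf)
        (hT.lipschitzHarmonic.smul_mem c.im hg) using 1
      ext x; simp
    · convert hT.lipschitzHarmonic.add_mem (hT.lipschitzHarmonic.smul_mem c.re hg)
        (hT.lipschitzHarmonic.smul_mem c.im hf) using 1
      ext x; simp

theorem finiteDimensional_complexHarmonic (hG : HasGrowth d G) (hT : IsSymmGen T) :
    FiniteDimensional ℂ hT.complexHarmonic := by
  have := finiteDimensional_lipschitzHarmonic hG hT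
  let e : hT.complexHarmonic →ₗ[ℝ] hT.lipschitzHarmonic × hT.lipschitzHarmonic :=
    { toFun := fun f => (⟨_, f.2.1⟩, ⟨_, f.2.2⟩)
      map_add' := fun f g => rfl
      map_smul' := fun c f => by
        refine Prod.ext (Subtype.ext ?_) (Subtype.ext ?_) <;> ext x <;> simp }
  have hinj : Function.Injective e := by
    intro f g hfg
    refine Subtype.ext (funext fun x => Complex.ext ?_ ?_)
    · exact congrFun (congrArg Subtype.val (congrArg Prod.fst hfg)) x
    · exact congrFun (congrArg Subtype.val (congrArg Prod.snd hfg)) x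
  have : FiniteDimensional ℝ hT.complexHarmonic := Module.Finite.of_injective e hinj
  exact FiniteDimensional.right ℝ ℂ hT.complexHarmonic

theorem translate_mem_lipschitzHarmonic (hT : IsSymmGen T) {f : G → ℝ}
    (hf : f ∈ hT.lipschitzHarmonic) (g : G) :
    (fun x => f (x * g) - f g) ∈ hT.lipschitzHarmonic := by
  obtain ⟨hh, h1, L, hL⟩ := hf
  refine ⟨fun x => ?_, by simp, L, fun t ht x => ?_⟩
  · rw [← hh (x * g)]
    exact Finset.sum_congr rfl fun t _ => by dsimp only; rw [mul_assoc]; ring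
  · have := hL t ht (x * g)
    rw [← mul_assoc] at this
    simpa using this

/-- The action of `G` by right translation on harmonic functions modulo constants. -/
def harmonicRep (hT : IsSymmGen T) : Representation ℂ G hT.complexHarmonic where
  toFun g :=
    { toFun := fun f => ⟨fun x => f.1 (x * g) - f.1 g,
        by simpa using translate_mem_lipschitzHarmonic hT f.2.1 g,
        by simpa using translate_mem_lipschitzHarmonic hT f.2.2 g⟩
      map_add' := fun f f' => Subtype.ext (funext fun x => by simp; ring)
      map_smul' := fun c f => Subtype.ext (funext fun x => by simp; ring) }
  map_one' := by
    ext f x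
    have : f.1 1 = 0 := Complex.ext f.2.1.2.1 f.2.2.2.1
    simp [this]
  map_mul' g g' := by
    ext f x
    simp [mul_assoc]

theorem harmonicRep_apply (hT : IsSymmGen T) (g : G) (f : hT.complexHarmonic) (x : G) :
    (hT.harmonicRep g f).1 x = f.1 (x * g) - f.1 g := rfl

theorem weaklyBounded_harmonicRep (hG : HasGrowth d G) (hT : IsSymmGen T) :
    WeaklyBounded hT.harmonicRep := by
  have := finiteDimensional_complexHarmonic hG hT
  intro f
  let ev : G → (hT.complexHarmonic →ₗ[ℂ] ℂ) := fun x =>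
    LinearMap.proj x ∘ₗ hT.complexHarmonic.subtype
  have hspan : Submodule.span ℂ (Set.range ev) = ⊤ := by
    refine Submodule.span_eq_top_of_ne_zero fun z hz => ?_
    by_contra! hall
    exact hz (Subtype.ext (funext fun x => hall (ev x) ⟨x, rfl⟩))
  intro φ
  have hφ : φ ∈ Submodule.span ℂ (Set.range ev) := hspan ▸ Submodule.mem_top
  induction hφ using Submodule.span_induction with
  | mem φ hφ =>
    obtain ⟨x, rfl⟩ := hφ
    obtain ⟨L, hL⟩ := f.2.1.2.2
    obtain ⟨L', hL'⟩ := f.2.2.2.2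
    obtain ⟨m, hm⟩ := hT.exists_mem_pow x
    refine ⟨m * L + m * L', fun g => ?_⟩
    have h1 := abs_sub_le_of_gradient_le (f := fun x => (f.1 x).re) hL m hm g
    have h2 := abs_sub_le_of_gradient_le (f := fun x => (f.1 x).im) hL' m hm g
    refine (Complex.norm_le_abs_re_add_abs_im _).trans (add_le_add ?_ ?_)
    · rw [← Complex.sub_re] at h1; exact h1
    · rw [← Complex.sub_im] at h2; exact h2
  | zero => exact ⟨0, fun g => by simp⟩
  | add φ ψ _ _ h1 h2 =>
    obtain ⟨C, hC⟩ := h1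
    obtain ⟨C', hC'⟩ := h2
    exact ⟨C + C', fun g => (norm_add_le _ _).trans (add_le_add (hC g) (hC' g))⟩
  | smul c φ _ h1 =>
    obtain ⟨C, hC⟩ := h1
    refine ⟨‖c‖ * C, fun g => ?_⟩
    rw [LinearMap.smul_apply, norm_smul]
    exact mul_le_mul_of_nonneg_left (hC g) (norm_nonneg _)

theorem Harmonic.eq_of_finite_range (hT : IsSymmGen T) {f : G → ℝ} (hf : hT.Harmonic f)
    (hfin : (Set.range f).Finite) (x y : G) : f x = f y := by
  obtain ⟨_, ⟨x₀, rfl⟩, hmax⟩ := Set.exists_max_image (Set.range f) id hfin ⟨_, 1, rfl⟩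
  have hmax' : ∀ z, f z ≤ f x₀ := fun z => hmax _ ⟨z, rfl⟩
  have hstep : ∀ t ∈ T, ∀ z, f z = f x₀ → f (t * z) = f x₀ := by
    intro t ht z hz
    have h0 : ∀ s ∈ hT.ball 1, f (s * z) - f z ≤ 0 := fun s _ => by
      rw [hz]; linarith [hmax' (s * z)]
    have := (Finset.sum_eq_zero_iff_of_nonpos h0).1 (hf z) t (by rw [mem_ball, pow_one]; exact ht)
    linarith
  have hall : ∀ n : ℕ, ∀ g ∈ T ^ n, f (g * x₀) = f x₀ := by
    intro n
    induction n with
    | zero => intro g hg; simp at hg; simp [hg]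
    | succ n ih =>
      intro g hg
      rw [pow_succ'] at hg
      obtain ⟨t, ht, g', hg', rfl⟩ := hg
      simp only [mul_assoc]
      exact hstep t ht _ (ih g' hg')
  have : ∀ z, f z = f x₀ := by
    intro z
    obtain ⟨n, hn⟩ := hT.exists_mem_pow (z * x₀⁻¹)
    simpa using hall n _ hn
  rw [this x, this y]

end IsSymmGen

/-- An infinite group of polynomial growth virtually surjects onto the integers. -/
theorem exists_finiteIndex_surjective_int {G : Type*} [Group G] [Group.FG G] [Infinite G] {d : ℕ}
    (hG : HasGrowth d G) :
    ∃ H : Subgroup G, H.FiniteIndex ∧ ∃ χ : H →* Multiplicative ℤ, Function.Surjective χ := by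
  obtain ⟨T, hT⟩ := IsSymmGen.exists_of_fg (G := G)
  have := hT.finiteDimensional_complexHarmonic hG
  obtain ⟨H, hH, hcomm⟩ := exists_finiteIndex_commute _ G hG hT.complexHarmonic rfl
    hT.harmonicRep (hT.weaklyBounded_harmonicRep hG)
  let σ : H →* (hT.complexHarmonic →ₗ[ℂ] hT.complexHarmonic)ˣ :=
    (hT.harmonicRep.comp H.subtype).toHomUnits
  have hσ : ∀ h : H, ((σ h : _) : hT.complexHarmonic →ₗ[ℂ] hT.complexHarmonic) =
    hT.harmonicRep h := fun h => rfl
  by_cases hinf : Infinite σ.range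
  · exact ⟨H, hH, exists_surjective_int_of_commute σ
      (fun a b => Units.ext (hcomm a a.2 b b.2)) hinf⟩
  rw [not_infinite_iff_finite] at hinf
  have hker : σ.ker.FiniteIndex := Subgroup.finiteIndex_ker σ
  set K : Subgroup G := σ.ker.map H.subtype with hK
  have hKfi : K.FiniteIndex := by
    refine ⟨?_⟩
    rw [hK, Subgroup.index_map_subtype]
    exact mul_ne_zero hker.index_ne_zero hH.index_ne_zero
  obtain ⟨f, hf1, hfL, hfh, t₀, ht₀⟩ := exists_harmonic hG hT
  have hfV : f ∈ hT.lipschitzHarmonic := by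
    refine ⟨fun x => ?_, hf1, 1, hfL⟩
    rw [← hfh x]
    refine Finset.sum_congr ?_ fun _ _ => rfl
    ext t; simp [IsSymmGen.mem_ball]
  let F : hT.complexHarmonic := ⟨fun x => (f x : ℂ), by simpa using hfV,
    by simp only [Complex.ofReal_im]; exact hT.lipschitzHarmonic.zero_mem⟩
  have hadd : ∀ k ∈ K, ∀ x, f (x * k) = f x + f k := by
    rintro _ ⟨k, hk, rfl⟩ x
    have h1 : hT.harmonicRep k = 1 := by
      rw [← hσ, show σ k = 1 from hk]; rfl
    have h2 : (hT.harmonicRep k F).1 x = F.1 x := by rw [h1]; rfl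
    rw [IsSymmGen.harmonicRep_apply] at h2
    have h3 : ((f (x * k) : ℝ) : ℂ) - (f k : ℝ) = (f x : ℝ) := h2
    norm_cast at h3
    show f (x * k) = f x + f k
    linarith
  let χ : K →* Multiplicative ℝ :=
    { toFun := fun k => Multiplicative.ofAdd (f k)
      map_one' := by simp [hf1]
      map_mul' := fun a b => by
        rw [← ofAdd_add, ← hadd b b.2]; rfl }
  by_cases hzero : ∀ k ∈ K, f k = 0
  · exfalso
    have hfin : (Set.range f).Finite := by
      have : Finite (G ⧸ K) := inferInstance
      refine (Set.finite_range fun q : G ⧸ K => f q.out).subset ?_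
      rintro _ ⟨x, rfl⟩
      refine ⟨(x : G ⧸ K), ?_⟩
      have h1 : x⁻¹ * (x : G ⧸ K).out ∈ K := by
        rw [← QuotientGroup.eq]; simp
      have := hadd _ h1 x
      rw [mul_inv_cancel_left, hzero _ h1, add_zero] at this
      exact this
    exact ht₀ ((IsSymmGen.Harmonic.eq_of_finite_range hT hfV.1 hfin t₀ 1).trans hf1)
  push Not at hzero
  obtain ⟨k, hk, hfk⟩ := hzero
  refine ⟨K, hKfi, exists_surjective_int_of_commute χ (fun a b => mul_comm _ _) ?_⟩
  refine Infinite.of_injective (fun n : ℕ => (⟨χ ⟨k, hk⟩ ^ n, ⟨k, hk⟩ ^ n, map_pow _ _ _⟩ : χ.range))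
    fun m n hmn => ?_
  have h1 : χ ⟨k, hk⟩ ^ m = χ ⟨k, hk⟩ ^ n := congrArg Subtype.val hmn
  have h2 : (m : ℝ) * f k = n * f k := by
    have := congrArg Multiplicative.toAdd h1
    simpa [toAdd_pow, χ] using this
  exact_mod_cast mul_right_cancel₀ hfk h2

section Milnor

variable {G : Type*} [Group G] {d : ℕ}

/-- In a group of polynomial growth, two of the words `a ^ ε₁ * t * ⋯ * a ^ εₙ * t` with
`εᵢ ∈ {0, 1}` differ by a factor `a` for some `n`. -/
theorem HasGrowth.exists_mul_eq (hG : HasGrowth d G) (t a : G) (p : ℕ → G → Prop) (h0 : p 0 1)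
    (h1 : ∀ n x, p n x → p (n + 1) (x * t)) (h2 : ∀ n x, p n x → p (n + 1) (x * (a * t))) :
    ∃ n x y, p n x ∧ p n y ∧ y * a = x := by
  by_contra! hcon
  have key : ∀ n : ℕ, ∃ X : Set G, X ⊆ ({1, a, t} : Set G) ^ (2 * n) ∧ X.ncard = 2 ^ n ∧
      ∀ x ∈ X, p n x := by
    intro n
    induction n with
    | zero => exact ⟨{1}, by simp, by simp, by simpa using h0⟩
    | succ n ih =>
      obtain ⟨X, hX1, hX2, hX3⟩ := ih
      have hXf : X.Finite := (set_finite_pow (by simp) _).subset hX1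
      refine ⟨(· * t) '' X ∪ (· * (a * t)) '' X, ?_, ?_, ?_⟩
      · rw [show 2 * (n + 1) = 2 * n + (1 + 1) by ring, pow_add, pow_add, pow_one]
        rintro _ (⟨x, hx, rfl⟩ | ⟨x, hx, rfl⟩)
        · exact Set.mul_mem_mul (hX1 hx) ⟨1, by simp, t, by simp, by simp⟩
        · exact Set.mul_mem_mul (hX1 hx) (Set.mul_mem_mul (by simp) (by simp))
      · rw [Set.ncard_union_eq ?_ (hXf.image _) (hXf.image _),
          Set.ncard_image_of_injective _ (mul_left_injective _),
          Set.ncard_image_of_injective _ (mul_left_injective _), hX2, pow_succ, mul_two]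
        rw [Set.disjoint_left]
        rintro _ ⟨x, hx, rfl⟩ ⟨y, hy, hxy⟩
        refine hcon n x y (hX3 x hx) (hX3 y hy) ?_
        have : y * a * t = x * t := by rw [mul_assoc]; exact hxy
        exact mul_right_cancel this
      · rintro _ (⟨x, hx, rfl⟩ | ⟨x, hx, rfl⟩)
        exacts [h1 n x (hX3 x hx), h2 n x (hX3 x hx)]
  obtain ⟨C, hC⟩ := hG ({1, a, t} : Set G) (by simp)
  obtain ⟨n, hn⟩ : ∃ n : ℕ, C * (2 * n + 1) ^ d < 2 ^ n := by
    have h1 : (fun n : ℕ => ((n : ℝ)) ^ d) =o[Filter.atTop] fun n : ℕ => (2 : ℝ) ^ n :=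
      isLittleO_pow_const_const_pow_of_one_lt d (by norm_num)
    have h2 := h1.def (c := 1 / (2 * (C + 1) * 3 ^ d)) (by positivity)
    obtain ⟨n, hn, hn1⟩ := (h2.and (Filter.eventually_ge_atTop 1)).exists
    refine ⟨n, ?_⟩
    rw [Real.norm_of_nonneg (by positivity), Real.norm_of_nonneg (by positivity),
      div_mul_eq_mul_div,
      one_mul, le_div_iff₀ (by positivity)] at hn
    have h3 : ((2 * n + 1 : ℕ) : ℝ) ≤ 3 * n := by
      have : (1 : ℝ) ≤ n := by exact_mod_cast hn1
      push_cast; linarith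
    have h4 : ((C * (2 * n + 1) ^ d : ℕ) : ℝ) < ((2 ^ n : ℕ) : ℝ) := by
      push_cast at h3 ⊢
      calc (C : ℝ) * (2 * n + 1) ^ d ≤ C * (3 * n) ^ d := by gcongr
        _ = C * (3 ^ d * n ^ d) := by rw [mul_pow]
        _ < 2 * (C + 1) * (3 ^ d * n ^ d) := by
            have : (1 : ℝ) ≤ n := by exact_mod_cast hn1
            gcongr
            linarith [Nat.cast_nonneg (α := ℝ) C]
        _ ≤ 2 ^ n := by linarith
    exact_mod_cast h4
  obtain ⟨X, hX1, hX2, -⟩ := key n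
  have := Set.ncard_le_ncard hX1 (set_finite_pow (by simp) _)
  have := hC (2 * n)
  omega

theorem exists_conj_mem_closure_of_lt (hG : HasGrowth d G) (t a : G) :
    ∃ k : ℕ, t ^ k * a * (t ^ k)⁻¹ ∈
      Subgroup.closure ((fun i : ℕ => t ^ i * a * (t ^ i)⁻¹) '' Set.Iio k) := by
  set N : ℕ → Subgroup G := fun k =>
    Subgroup.closure ((fun i : ℕ => t ^ i * a * (t ^ i)⁻¹) '' Set.Iio k) with hN
  have hNmono : ∀ n, N n ≤ N (n + 1) := fun n =>
    Subgroup.closure_mono (Set.image_mono (Set.Iio_subset_Iio (Nat.le_succ n)))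
  have hNmem : ∀ n, t ^ n * a * (t ^ n)⁻¹ ∈ N (n + 1) := fun n =>
    Subgroup.subset_closure ⟨n, Nat.lt_succ_self n, rfl⟩
  have key := hG.exists_mul_eq t a (fun n x => x * (t ^ n)⁻¹ ∈ N n) (by simp)
    (by
      intro n x hx
      have : x * t * (t ^ (n + 1))⁻¹ = x * (t ^ n)⁻¹ := by rw [pow_succ]; group
      simp only [this]
      exact hNmono n hx)
    (by
      intro n x hx
      have : x * (a * t) * (t ^ (n + 1))⁻¹ =
        (x * (t ^ n)⁻¹) * (t ^ n * a * (t ^ n)⁻¹) := by rw [pow_succ]; group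
      simp only [this]
      exact (N (n + 1)).mul_mem (hNmono n hx) (hNmem n))
  obtain ⟨n, x, y, hx, hy, rfl⟩ := key
  refine ⟨n, ?_⟩
  have h2 := (N n).mul_mem ((N n).inv_mem hy) hx
  convert h2 using 1
  group

theorem exists_forall_conj_mem_closure (hG : HasGrowth d G) (t a : G) :
    ∃ F : Set G, F.Finite ∧ F ⊆ Set.range (fun i : ℤ => t ^ i * a * (t ^ i)⁻¹) ∧
      ∀ n : ℕ, t ^ n * a * (t ^ n)⁻¹ ∈ Subgroup.closure F := by
  obtain ⟨k, hk⟩ := exists_conj_mem_closure_of_lt hG t a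
  set F := (fun i : ℕ => t ^ i * a * (t ^ i)⁻¹) '' Set.Iio k
  refine ⟨F, (Set.finite_Iio k).image _, ?_, fun n => ?_⟩
  · rintro _ ⟨i, -, rfl⟩; exact ⟨i, by simp⟩
  induction n using Nat.strong_induction_on with
  | _ n ih =>
  rcases lt_or_ge n k with hn | hn
  · exact Subgroup.subset_closure ⟨n, hn, rfl⟩
  obtain ⟨m, rfl⟩ := Nat.exists_eq_add_of_le' hn
  have h1 : ∀ x ∈ Subgroup.closure F, t ^ m * x * (t ^ m)⁻¹ ∈ Subgroup.closure
      ((fun i : ℕ => t ^ i * a * (t ^ i)⁻¹) '' Set.Iio (m + k)) := by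
    intro x hx
    have h2 : MulAut.conj (t ^ m) x ∈ (Subgroup.closure F).map
        (MulAut.conj (t ^ m)).toMonoidHom := ⟨x, hx, rfl⟩
    rw [MonoidHom.map_closure] at h2
    refine Subgroup.closure_mono ?_ h2
    rintro _ ⟨_, ⟨i, hi, rfl⟩, rfl⟩
    refine ⟨m + i, by simpa using hi, ?_⟩
    change t ^ (m + i) * a * (t ^ (m + i))⁻¹ = t ^ m * (t ^ i * a * (t ^ i)⁻¹) * (t ^ m)⁻¹
    simp [pow_add, mul_assoc]
  have h3 := h1 _ hk
  have h4 : t ^ m * (t ^ k * a * (t ^ k)⁻¹) * (t ^ m)⁻¹ = t ^ (m + k) * a * (t ^ (m + k))⁻¹ := by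
    rw [pow_add]; group
  rw [h4] at h3
  refine (Subgroup.closure_le _).2 ?_ h3
  rintro _ ⟨i, hi, rfl⟩
  exact ih i hi

/-- In a group of polynomial growth, the conjugates of an element by the powers of another one
generate a finitely generated subgroup. -/
theorem fg_closure_conj_zpow (hG : HasGrowth d G) (t a : G) :
    (Subgroup.closure (Set.range fun i : ℤ => t ^ i * a * (t ^ i)⁻¹)).FG := by
  obtain ⟨F, hF, hF1, hF2⟩ := exists_forall_conj_mem_closure hG t a
  obtain ⟨F', hF', hF1', hF2'⟩ := exists_forall_conj_mem_closure hG t⁻¹ a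
  refine (Subgroup.fg_iff _).2 ⟨F ∪ F', le_antisymm (Subgroup.closure_mono ?_) ?_, hF.union hF'⟩
  · refine Set.union_subset hF1 (hF1'.trans ?_)
    rintro _ ⟨i, rfl⟩
    exact ⟨-i, by simp⟩
  · rw [Subgroup.closure_le]
    rintro _ ⟨i, rfl⟩
    rcases Int.eq_nat_or_neg i with ⟨n, rfl | rfl⟩
    · exact Subgroup.closure_mono Set.subset_union_left (by simpa using hF2 n)
    · exact Subgroup.closure_mono Set.subset_union_right (by simpa using hF2' n)

theorem HasGrowth.ker_of_surjective_int (hG : HasGrowth (d + 1) G) (χ : G →* Multiplicative ℤ)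
    (hχ : Function.Surjective χ) : HasGrowth d χ.ker := by
  intro S hS
  obtain ⟨t, ht⟩ := hχ (Multiplicative.ofAdd 1)
  set S' : Set G := insert 1 (insert t (Subtype.val '' S)) with hS'
  have hS'f : S'.Finite := ((hS.image _).insert _).insert _
  obtain ⟨C, hC⟩ := hG S' hS'f
  refine ⟨C * 2 ^ (d + 1), fun n => ?_⟩
  have hpow : ∀ k ∈ S ^ n, (k : G) ∈ S' ^ n := by
    have : (Subtype.val '' (S ^ n)) = (Subtype.val '' S) ^ n :=
      Set.image_pow χ.ker.subtype S n
    intro k hk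
    have h1 : (k : G) ∈ (Subtype.val '' S) ^ n := this ▸ ⟨k, hk, rfl⟩
    exact Set.pow_subset_pow_left (by intro x hx; simp [hS', hx]) h1
  let f : χ.ker × ℕ → G := fun p => p.1 * t ^ p.2
  have hf : Set.InjOn f ((S ^ n) ×ˢ (Finset.range (n + 1) : Set ℕ)) := by
    rintro ⟨k, i⟩ - ⟨k', i'⟩ - h
    have h1 : χ (k * t ^ i) = χ (k' * t ^ i') := congrArg χ h
    rw [map_mul, map_mul, show χ k = 1 from k.2, show χ k' = 1 from k'.2, one_mul, one_mul,
      map_pow, map_pow, ht, ← ofAdd_nsmul, ← ofAdd_nsmul] at h1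
    have h2 : i = i' := by simpa using h1
    subst h2
    have h3 : (k : G) = k' := mul_right_cancel h
    exact Prod.ext (Subtype.ext h3) rfl
  have hsub : f '' ((S ^ n) ×ˢ (Finset.range (n + 1) : Set ℕ)) ⊆ S' ^ (2 * n) := by
    rintro _ ⟨⟨k, i⟩, ⟨hk, hi⟩, rfl⟩
    rw [two_mul, pow_add]
    refine Set.mul_mem_mul (hpow k hk) ?_
    have : i ≤ n := by simpa [Nat.lt_succ_iff] using hi
    exact Set.pow_subset_pow_right (by simp [hS']) this (Set.pow_mem_pow (by simp [hS']))
  have h1 := Set.ncard_le_ncard hsub (set_finite_pow hS'f _)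
  rw [hf.ncard_image, Set.ncard_prod, Set.ncard_coe_finset, Finset.card_range] at h1
  have h2 : (S ^ n).ncard * (n + 1) ≤ (C * 2 ^ (d + 1) * (n + 1) ^ d) * (n + 1) := by
    refine h1.trans ((hC _).trans ?_)
    calc C * (2 * n + 1) ^ (d + 1) ≤ C * (2 * (n + 1)) ^ (d + 1) := by gcongr; omega
      _ = _ := by rw [mul_pow]; ring
  exact Nat.le_of_mul_le_mul_right h2 (Nat.succ_pos n)

theorem fg_ker_of_surjective_int [Group.FG G] (hG : HasGrowth d G) (χ : G →* Multiplicative ℤ)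
    {t : G} (ht : χ t = Multiplicative.ofAdd 1) : Group.FG χ.ker := by
  obtain ⟨T, hT⟩ := IsSymmGen.exists_of_fg (G := G)
  let e : G → ℤ := fun g => Multiplicative.toAdd (χ g)
  let b : G → G := fun g => g * (t ^ e g)⁻¹
  have hχt : ∀ i : ℤ, χ (t ^ i) = Multiplicative.ofAdd i := fun i => by
    rw [map_zpow, ht, ← ofAdd_zsmul]; simp
  have hb : ∀ g, b g ∈ χ.ker := fun g => by
    rw [MonoidHom.mem_ker, map_mul, map_inv, hχt]; simp [e]
  set N : Subgroup G := Subgroup.closure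
    (⋃ g ∈ T, Set.range fun i : ℤ => t ^ i * b g * (t ^ i)⁻¹) with hN
  have hNfg : N.FG := by
    choose F hF hFf using fun g => (Subgroup.fg_iff _).1 (fg_closure_conj_zpow hG t (b g))
    refine (Subgroup.fg_iff _).2 ⟨⋃ g ∈ T, F g, ?_, hT.finite.biUnion fun g _ => hFf g⟩
    rw [hN, Subgroup.closure_iUnion, Subgroup.closure_iUnion]
    refine iSup_congr fun g => ?_
    rw [Subgroup.closure_iUnion, Subgroup.closure_iUnion, hF]
  have hNconj : ∀ (i : ℤ), ∀ x ∈ N, t ^ i * x * (t ^ i)⁻¹ ∈ N := by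
    intro i x hx
    have h2 : MulAut.conj (t ^ i) x ∈ N.map (MulAut.conj (t ^ i)).toMonoidHom := ⟨x, hx, rfl⟩
    rw [hN, MonoidHom.map_closure] at h2
    refine Subgroup.closure_mono ?_ h2
    rintro _ ⟨x, hx, rfl⟩
    simp only [Set.mem_iUnion] at hx ⊢
    obtain ⟨g, hg, j, rfl⟩ := hx
    refine ⟨g, hg, i + j, ?_⟩
    change t ^ (i + j) * b g * (t ^ (i + j))⁻¹ = t ^ i * (t ^ j * b g * (t ^ j)⁻¹) * (t ^ i)⁻¹
    simp [zpow_add, mul_assoc]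
  have hrep : ∀ (n : ℕ), ∀ g ∈ T ^ n, ∃ j : ℤ, g * (t ^ j)⁻¹ ∈ N := by
    intro n
    induction n with
    | zero => intro g hg; exact ⟨0, by simp at hg; simp [hg, N.one_mem]⟩
    | succ n ih =>
      intro g hg
      rw [pow_succ'] at hg
      obtain ⟨s, hs, g, hg, rfl⟩ := hg
      obtain ⟨j, hj⟩ := ih g hg
      refine ⟨e s + j, ?_⟩
      have h1 : b s ∈ N := Subgroup.subset_closure
        (Set.mem_biUnion hs ⟨0, by simp⟩)
      have h2 := N.mul_mem h1 (hNconj (e s) _ hj)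
      convert h2 using 1
      simp only [b, zpow_add]
      group
  have hNle : N ≤ χ.ker := by
    rw [hN, Subgroup.closure_le]
    intro x hx
    simp only [Set.mem_iUnion] at hx
    obtain ⟨g, -, i, rfl⟩ := hx
    exact Subgroup.Normal.conj_mem inferInstance _ (hb g) _
  have hker : χ.ker = N := by
    refine le_antisymm (fun g hg => ?_) hNle
    obtain ⟨n, hn⟩ := hT.exists_mem_pow g
    obtain ⟨j, hj⟩ := hrep n g hn
    have h1 : χ (g * (t ^ j)⁻¹) = 1 := hNle hj
    rw [map_mul, map_inv, hχt, show χ g = 1 from hg, one_mul, inv_eq_one] at h1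
    have h2 : j = 0 := by simpa using h1
    simpa [h2] using hj
  rw [hker]
  exact (Group.fg_iff_subgroup_fg N).2 hNfg

end Milnor

section Eigenvalues

variable {G : Type*} [Group G] {d : ℕ}

theorem HasGrowth.norm_eigenvalue_le_one (hG : HasGrowth d G) {M : Type*} [Group M] (f : M →* G)
    (hf : Function.Injective f) (τ : M → M) (t : G) (hτ : ∀ x, f (τ x) = t * f x * t⁻¹)
    (φ : M → ℂ) (hφ : ∀ x y, φ (x * y) = φ x + φ y) (μ : ℂ) (hμ : ∀ x, φ (τ x) = μ * φ x)
    (a : M) (ha : φ a ≠ 0) : ‖μ‖ ≤ 1 := by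
  by_contra! hlt
  obtain ⟨p, hp⟩ := pow_unbounded_of_one_lt 4 hlt
  have hit : ∀ n x, f (τ^[n] x) = t ^ n * f x * (t ^ n)⁻¹ ∧ φ (τ^[n] x) = μ ^ n * φ x := by
    intro n
    induction n with
    | zero => simp
    | succ n ih =>
      intro x
      rw [Function.iterate_succ_apply', hτ, hμ, (ih x).1, (ih x).2, pow_succ', pow_succ']
      constructor
      · group
      · ring
  set R : ℝ := ‖μ‖ ^ p with hR
  have hφ1 : φ 1 = 0 := by simpa using hφ 1 1
  have ha' : 0 < ‖φ a‖ := norm_pos_iff.2 ha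
  have key := hG.exists_mul_eq (t ^ p) (f a)
    (fun n x => ∃ u, x = f u * (t ^ p) ^ n ∧ 3 * ‖φ u‖ ≤ (R ^ n - 1) * ‖φ a‖)
    ⟨1, by simp, by simp [hφ1]⟩
    (by
      rintro n _ ⟨u, rfl, hu⟩
      refine ⟨u, by rw [pow_succ, mul_assoc], hu.trans ?_⟩
      gcongr
      · linarith
      · omega)
    (by
      rintro n _ ⟨u, rfl, hu⟩
      refine ⟨u * τ^[p * n] a, ?_, ?_⟩
      · rw [map_mul, (hit _ _).1, pow_succ, pow_mul]; group
      · rw [hφ, (hit _ _).2]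
        have h3 := norm_add_le (φ u) (μ ^ (p * n) * φ a)
        rw [norm_mul, norm_pow, pow_mul ‖μ‖, ← hR] at h3
        have h4 : 4 * R ^ n ≤ R ^ (n + 1) := by
          rw [pow_succ']; gcongr
        nlinarith)
  obtain ⟨n, x, y, ⟨u, rfl, hu⟩, ⟨v, rfl, hv⟩, h⟩ := key
  have h1 : f (v * τ^[p * n] a) = f u := by
    rw [map_mul, (hit _ _).1, pow_mul]
    rw [← mul_inv_eq_iff_eq_mul] at h
    rw [← h]; group
  have h2 := congrArg φ (hf h1)
  rw [hφ, (hit _ _).2] at h2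
  have h3 : ‖μ ^ (p * n) * φ a‖ ≤ ‖φ u‖ + ‖φ v‖ := by
    rw [← eq_sub_iff_add_eq'] at h2
    rw [h2]; exact norm_sub_le _ _
  rw [norm_mul, norm_pow, pow_mul ‖μ‖, ← hR] at h3
  have h4 : 1 ≤ R ^ n := one_le_pow₀ (by linarith)
  nlinarith

end Eigenvalues

section Kronecker

open Matrix

theorem Matrix.exists_pow_mulVec_eq {ι : Type*} [Fintype ι] [DecidableEq ι] [Nonempty ι]
    (B : Matrix ι ι ℤ) (hB : B.det ≠ 0)
    (h : ∀ (μ : ℂ) (v : ι → ℂ), v ≠ 0 → v ᵥ* B.map (Int.castRingHom ℂ) = μ • v → ‖μ‖ ≤ 1) :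
    ∃ m, 0 < m ∧ ∃ w : ι → ℤ, w ≠ 0 ∧ (B ^ m) *ᵥ w = w := by
  set Bc := B.map (Int.castRingHom ℂ) with hBc
  have hchar : B.charpoly.map (Int.castRingHom ℂ) = Bc.charpoly := (Matrix.charpoly_map _ _).symm
  have hroot : ∀ μ ∈ Bc.charpoly.roots, ∃ v : ι → ℂ, v ≠ 0 ∧ v ᵥ* Bc = μ • v := by
    intro μ hμ
    have hμ := Polynomial.isRoot_of_mem_roots hμ
    rw [Polynomial.IsRoot, Matrix.eval_charpoly] at hμ
    obtain ⟨v, hv, hv'⟩ := Matrix.exists_vecMul_eq_zero_iff.2 hμ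
    refine ⟨v, hv, ?_⟩
    rw [Matrix.vecMul_sub, sub_eq_zero] at hv'
    rw [← hv', Matrix.scalar_apply, Matrix.vecMul_diagonal_const]
    ext i; simp [mul_comm]
  have hmahler : (B.charpoly.map (Int.castRingHom ℂ)).mahlerMeasure = 1 := by
    rw [hchar, Polynomial.mahlerMeasure_eq_leadingCoeff_mul_prod_roots,
      (Matrix.charpoly_monic Bc).leadingCoeff, norm_one, one_mul]
    refine Multiset.prod_eq_one fun x hx => ?_
    obtain ⟨μ, hμ, rfl⟩ := Multiset.mem_map.1 hx
    obtain ⟨v, hv, hv'⟩ := hroot μ hμ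
    exact max_eq_left (h μ v hv hv')
  obtain ⟨μ, hμ⟩ : ∃ μ, Bc.charpoly.IsRoot μ := by
    refine IsAlgClosed.exists_root _ ?_
    rw [Matrix.charpoly_degree_eq_dim]
    simp
  have hμr : μ ∈ Bc.charpoly.roots := (Polynomial.mem_roots (Matrix.charpoly_monic Bc).ne_zero).2 hμ
  obtain ⟨v, hv, hv'⟩ := hroot μ hμr
  have hμ0 : μ ≠ 0 := by
    rintro rfl
    rw [zero_smul] at hv'
    apply hB
    have h1 := Matrix.exists_vecMul_eq_zero_iff.1 ⟨v, hv, hv'⟩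
    have h2 : (Int.castRingHom ℂ) B.det = 0 := by rw [RingHom.map_det]; exact h1
    exact (map_eq_zero_iff _ Int.cast_injective).1 h2
  obtain ⟨m, hm, hm'⟩ := Polynomial.pow_eq_one_of_mahlerMeasure_eq_one hmahler hμ0
    (by rw [Polynomial.aroots_def, algebraMap_int_eq, hchar]; exact hμr)
  refine ⟨m, hm, ?_⟩
  have hpow : ∀ n, v ᵥ* Bc ^ n = μ ^ n • v := by
    intro n
    induction n with
    | zero => simp
    | succ n ih => rw [pow_succ, ← Matrix.vecMul_vecMul, ih, Matrix.smul_vecMul, hv', smul_smul,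
        pow_succ]
  have h1 : (Bc ^ m - 1).det = 0 := Matrix.exists_vecMul_eq_zero_iff.1
    ⟨v, hv, by rw [Matrix.vecMul_sub, hpow, hm']; simp⟩
  have h2 : (Int.castRingHom ℂ) (B ^ m - 1).det = 0 := by
    rw [RingHom.map_det, map_sub, map_pow, map_one]; exact h1
  obtain ⟨w, hw, hw'⟩ := Matrix.exists_mulVec_eq_zero_iff.2
    ((map_eq_zero_iff _ Int.cast_injective).1 h2)
  refine ⟨w, hw, ?_⟩
  rwa [Matrix.sub_mulVec, Matrix.one_mulVec, sub_eq_zero] at hw'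

end Kronecker

/-- An injective endomorphism of an infinite finitely generated abelian group whose eigenvalues have
modulus at most one has a power fixing an element of infinite order. -/
theorem AddMonoidHom.exists_iterate_eq {A : Type*} [AddCommGroup A] [AddGroup.FG A] [Infinite A]
    (τ : A →+ A) (hτ : Function.Injective τ)
    (h : ∀ (μ : ℂ) (φ : A →+ ℂ), φ ≠ 0 → (∀ x, φ (τ x) = μ * φ x) → ‖μ‖ ≤ 1) :
    ∃ m, 0 < m ∧ ∃ z : A, addOrderOf z = 0 ∧ τ^[m] z = z := by
  have hfin : Module.Finite ℤ A := Module.Finite.iff_addGroup_fg.2 inferInstance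
  set N := Submodule.torsion ℤ A with hN
  let f : A →ₗ[ℤ] A := τ.toIntLinearMap
  have hNfin : Finite N := Module.finite_of_fg_torsion N Submodule.torsion_isTorsion
  obtain ⟨e, he0, he⟩ : ∃ e : ℕ, 0 < e ∧ ∀ x ∈ N, e • x = 0 := by
    refine ⟨Nat.card N, Nat.card_pos, fun x hx => ?_⟩
    have := card_nsmul_eq_zero' (G := N) (x := ⟨x, hx⟩)
    exact congrArg Subtype.val this
  have hfN : N ≤ N.comap f := by
    intro x hx
    obtain ⟨a, ha⟩ := (Submodule.mem_torsion_iff x).1 hx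
    refine (Submodule.mem_torsion_iff _).2 ⟨a, ?_⟩
    have := congrArg f ha
    rw [map_zero] at this
    rw [← this]
    exact (map_zsmul τ (a : ℤ) x).symm
  let g : (A ⧸ N) →ₗ[ℤ] (A ⧸ N) := N.mapQ N f hfN
  have hg : Function.Injective g := by
    rw [injective_iff_map_eq_zero]
    intro x
    obtain ⟨x, rfl⟩ := N.mkQ_surjective x
    intro hx
    have h1 : f x ∈ N := (Submodule.Quotient.mk_eq_zero N).1 hx
    have h2 := he _ h1
    refine (Submodule.Quotient.mk_eq_zero N).2 ((Submodule.mem_torsion_iff x).2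
      ⟨⟨(e : ℤ), by simp [he0.ne']⟩, ?_⟩)
    apply hτ
    rw [map_zero, ← h2]
    change τ ((e : ℤ) • x) = _
    rw [natCast_zsmul, map_nsmul]; rfl
  have hfree : Module.Free ℤ (A ⧸ N) := inferInstance
  let b := Module.Free.chooseBasis ℤ (A ⧸ N)
  set ι := Module.Free.ChooseBasisIndex ℤ (A ⧸ N)
  have hι : Nonempty ι := by
    by_contra hcon
    rw [not_nonempty_iff] at hcon
    have h1 : Subsingleton (A ⧸ N) := b.repr.toEquiv.subsingleton
    have h2 : N = ⊤ := Submodule.Quotient.subsingleton_iff.1 h1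
    have h3 : Finite A := Finite.of_surjective (fun x : N => (x : A))
      fun x => ⟨⟨x, h2 ▸ Submodule.mem_top⟩, rfl⟩
    exact not_finite A
  set B := LinearMap.toMatrix b b g with hB
  have hrepr : ∀ x, B.mulVec (b.repr x) = b.repr (g x) := LinearMap.toMatrix_mulVec_repr b b g
  have hlift : ∀ w : ι → ℤ, w ≠ 0 → ∃ x, x ≠ 0 ∧ (b.repr x : ι → ℤ) = w := by
    intro w hw
    refine ⟨b.equivFun.symm w, (map_ne_zero_iff _ b.equivFun.symm.injective).2 hw, ?_⟩
    exact b.equivFun.apply_symm_apply w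
  have hdet : B.det ≠ 0 := by
    intro h0
    obtain ⟨w, hw, hw'⟩ := Matrix.exists_mulVec_eq_zero_iff.2 h0
    obtain ⟨x, hx, rfl⟩ := hlift w hw
    rw [hrepr] at hw'
    apply hx
    apply hg
    rw [map_zero]
    apply b.repr.injective
    ext i
    simpa using congrFun hw' i
  obtain ⟨m, hm, w, hw, hw'⟩ := B.exists_pow_mulVec_eq hdet (by
    intro μ v hv hv'
    let φ : A →+ ℂ :=
      { toFun := fun x => v ⬝ᵥ fun i => ((b.repr (N.mkQ x) i : ℤ) : ℂ)
        map_zero' := by simp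
        map_add' := fun x y => by
          rw [← dotProduct_add]; congr 1; ext i; simp }
    refine h μ φ ?_ fun x => ?_
    · intro h0
      apply hv
      ext i
      obtain ⟨x, hx⟩ := N.mkQ_surjective (b i)
      have h1 := DFunLike.congr_fun h0 x
      change v ⬝ᵥ (fun j => ((b.repr (N.mkQ x) j : ℤ) : ℂ)) = 0 at h1
      rw [hx] at h1
      simpa [dotProduct, Finsupp.single_apply] using h1
    · change v ⬝ᵥ (fun i => ((b.repr (g (N.mkQ x)) i : ℤ) : ℂ)) =
        μ * v ⬝ᵥ (fun i => ((b.repr (N.mkQ x) i : ℤ) : ℂ))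
      rw [← hrepr, ← smul_eq_mul, ← smul_dotProduct, ← hv', ← Matrix.dotProduct_mulVec]
      congr 1
      ext i
      simp [Matrix.mulVec, dotProduct])
  obtain ⟨x, hx, rfl⟩ := hlift w hw
  obtain ⟨y, rfl⟩ := N.mkQ_surjective x
  have hiter : ∀ n, (B ^ n).mulVec (b.repr (N.mkQ y)) = b.repr (N.mkQ (τ^[n] y)) := by
    intro n
    induction n with
    | zero => simp
    | succ n ih =>
      rw [pow_succ', ← Matrix.mulVec_mulVec, ih, hrepr, Function.iterate_succ_apply']; rfl
  rw [hiter] at hw'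
  have h1 : N.mkQ (τ^[m] y) = N.mkQ y := b.repr.injective (DFunLike.coe_injective hw')
  have h2 : τ^[m] y - y ∈ N := (Submodule.Quotient.eq N).1 h1
  have h3 : ∀ n, τ^[n] (e • y) = e • τ^[n] y := by
    intro n
    induction n with
    | zero => simp
    | succ n ih => rw [Function.iterate_succ_apply', ih, map_nsmul, Function.iterate_succ_apply']
  refine ⟨m, hm, e • y, ?_, ?_⟩
  · rw [addOrderOf_eq_zero_iff']
    intro n hn h0
    apply hx
    refine (Submodule.Quotient.mk_eq_zero N).2 ((Submodule.mem_torsion_iff y).2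
      ⟨⟨((n * e : ℕ) : ℤ), by simp [he0.ne', hn.ne']⟩, ?_⟩)
    change ((n * e : ℕ) : ℤ) • y = 0
    rw [natCast_zsmul, mul_smul, h0]
  · have h4 := he _ h2
    rw [smul_sub, sub_eq_zero] at h4
    rw [h3, h4]

/-- A finite index subgroup of `G` has a central element of infinite order. -/
def HasVirtualCenter (G : Type*) [Group G] : Prop :=
  ∃ H : Subgroup G, H.FiniteIndex ∧ ∃ z ∈ H, orderOf z = 0 ∧ ∀ h ∈ H, h * z = z * h

theorem HasVirtualCenter.of_finiteIndex {G : Type*} [Group G] {H : Subgroup G}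
    (hH : H.FiniteIndex) (h : HasVirtualCenter H) : HasVirtualCenter G := by
  obtain ⟨L, hL, z, hz, hz0, hzc⟩ := h
  refine ⟨L.map H.subtype, ⟨?_⟩, z, ⟨z, hz, rfl⟩, by rwa [Subgroup.orderOf_coe], ?_⟩
  · rw [Subgroup.index_map_subtype]
    exact mul_ne_zero hL.index_ne_zero hH.index_ne_zero
  · rintro _ ⟨y, hy, rfl⟩
    exact congrArg Subtype.val (hzc y hy)

theorem Group.FG.finite_monoidHom (G Q : Type*) [Group G] [Group.FG G] [Group Q] [Finite Q] :
    Finite (G →* Q) := by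
  obtain ⟨S, hS, hSf⟩ := Group.fg_iff.1 (inferInstance : Group.FG G)
  have : Finite S := hSf
  refine Finite.of_injective (fun (f : G →* Q) (s : S) => f s) fun f g hfg => ?_
  exact MonoidHom.eq_of_eqOn_dense hS fun s hs => congrFun hfg ⟨s, hs⟩

theorem Subgroup.exists_characteristic_le {G : Type*} [Group G] [Group.FG G] (H : Subgroup G)
    (hH : H.FiniteIndex) : ∃ C ≤ H, C.FiniteIndex ∧ C.Characteristic := by
  let Q := Equiv.Perm (G ⧸ H)
  have := Group.FG.finite_monoidHom G Q
  refine ⟨⨅ f : G →* Q, f.ker, ?_,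
    Subgroup.finiteIndex_iInf fun f => Subgroup.finiteIndex_ker f, ?_⟩
  · refine (iInf_le _ (MulAction.toPermHom G (G ⧸ H))).trans ?_
    rw [← Subgroup.normalCore_eq_ker]
    exact H.normalCore_le
  · rw [Subgroup.characteristic_iff_le_comap]
    intro φ x hx
    rw [Subgroup.mem_iInf] at hx
    simp only [Subgroup.mem_comap, Subgroup.mem_iInf]
    intro f
    exact hx (f.comp φ.toMonoidHom)

section Extension

variable {G : Type*} [Group G] {d : ℕ} {χ : G →* Multiplicative ℤ} {t : G}

theorem mul_zpow_mem_ker (ht : χ t = Multiplicative.ofAdd 1) (g : G) :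
    g * (t ^ (Multiplicative.toAdd (χ g)))⁻¹ ∈ χ.ker := by
  rw [MonoidHom.mem_ker, map_mul, map_inv, map_zpow, ht, ← ofAdd_zsmul]
  simp

theorem orderOf_eq_zero_of_map_ofAdd_one (ht : χ t = Multiplicative.ofAdd 1) : orderOf t = 0 := by
  rw [orderOf_eq_zero_iff']
  intro n hn h
  have := congrArg χ h
  rw [map_pow, map_one, ht, ← ofAdd_nsmul] at this
  have h2 : (n : ℤ) = 0 := by simpa using this
  omega

theorem hasVirtualCenter_of_finite_ker (ht : χ t = Multiplicative.ofAdd 1) [Finite χ.ker] :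
    HasVirtualCenter G := by
  have : Finite (MulAut χ.ker) := inferInstance
  set m := orderOf (MulAut.conjNormal (H := χ.ker) t)
  have hm : 0 < m := orderOf_pos _
  have h1 : MulAut.conjNormal (H := χ.ker) (t ^ m) = 1 := by rw [map_pow, pow_orderOf_eq_one]
  have h2 : ∀ k ∈ χ.ker, k * t ^ m = t ^ m * k := by
    intro k hk
    have := congrArg Subtype.val (DFunLike.congr_fun h1 ⟨k, hk⟩)
    rw [MulAut.conjNormal_apply] at this
    exact (mul_inv_eq_iff_eq_mul.1 this).symm
  refine ⟨⊤, inferInstance, t ^ m, trivial, ?_, fun g _ => ?_⟩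
  · have h0 := orderOf_eq_zero_of_map_ofAdd_one ht
    rw [orderOf_eq_zero_iff'] at h0 ⊢
    intro n hn
    rw [← pow_mul]
    exact h0 _ (Nat.mul_pos hm hn)
  · have h3 := h2 _ (mul_zpow_mem_ker ht g)
    set k := g * (t ^ (Multiplicative.toAdd (χ g)))⁻¹ with hk
    have hg : g = k * t ^ (Multiplicative.toAdd (χ g)) := by rw [hk]; group
    have h4 : t ^ (Multiplicative.toAdd (χ g)) * t ^ m =
        t ^ m * t ^ (Multiplicative.toAdd (χ g)) := by
      rw [← zpow_natCast, ← zpow_add, ← zpow_add, add_comm]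
    rw [hg, mul_assoc, h4, ← mul_assoc, h3, mul_assoc]

theorem finiteIndex_of_pow_mem (ht : χ t = Multiplicative.ofAdd 1) {L : Subgroup G}
    {C : Subgroup χ.ker} (hC : C.FiniteIndex) (hCL : C.map χ.ker.subtype ≤ L) {m : ℕ} (hm : 0 < m)
    (htL : t ^ m ∈ L) : L.FiniteIndex := by
  have hfin : Finite (χ.ker ⧸ C) := inferInstance
  have : Finite (G ⧸ L) := by
    refine Finite.of_surjective
      (fun p : Fin m × (χ.ker ⧸ C) => ((t ^ (p.1 : ℕ) * (p.2.out : χ.ker) : G) : G ⧸ L)) ?_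
    intro q
    obtain ⟨g, rfl⟩ := QuotientGroup.mk_surjective q
    set i := Multiplicative.toAdd (χ g)
    set k := g * (t ^ i)⁻¹ with hk
    have hkK : k ∈ χ.ker := mul_zpow_mem_ker ht g
    set r := (i % m).toNat with hr
    have hr' : (r : ℤ) = i % m := Int.toNat_of_nonneg (Int.emod_nonneg _ (by omega))
    have hrm : r < m := by
      have := Int.emod_lt_of_pos i (show (0 : ℤ) < m by omega)
      omega
    have hk' : (t ^ r)⁻¹ * k * t ^ r ∈ χ.ker := by
      have := χ.normal_ker.conj_mem k hkK (t ^ r)⁻¹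
      rwa [inv_inv] at this
    obtain ⟨c, hc⟩ := QuotientGroup.mk_out_eq_mul C (⟨_, hk'⟩ : χ.ker)
    refine ⟨(⟨r, hrm⟩, QuotientGroup.mk ⟨_, hk'⟩), ?_⟩
    rw [QuotientGroup.eq, hc]
    have h1 : (t ^ (i / m * m) : G) ∈ L := by
      rw [mul_comm, zpow_mul, zpow_natCast]
      exact L.zpow_mem htL _
    have h2 : ((c : χ.ker) : G) ∈ L := hCL ⟨c, c.2, rfl⟩
    have h3 : t ^ i = t ^ r * t ^ (i / m * m) := by
      rw [← zpow_natCast, hr', ← zpow_add, add_comm, Int.ediv_mul_add_emod]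
    have h4 := L.mul_mem (L.inv_mem h2) h1
    convert h4 using 1
    have hg : g = k * t ^ i := by rw [hk]; group
    rw [hg, h3]
    push_cast
    group
  exact Subgroup.finiteIndex_of_finite_quotient

theorem HasVirtualCenter.of_ker (hG : HasGrowth d G) (ht : χ t = Multiplicative.ofAdd 1)
    [Group.FG χ.ker] (h : HasVirtualCenter χ.ker) : HasVirtualCenter G := by
  obtain ⟨K', hK', z, hz, hz0, hzc⟩ := h
  obtain ⟨C, hCK, hC, hCc⟩ := K'.exists_characteristic_le hK'
  set a : χ.ker := z ^ C.index with ha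
  have haC : a ∈ C := Subgroup.pow_index_mem C z
  have ha0 : orderOf (a : G) = 0 := by
    rw [Subgroup.orderOf_coe, ha]
    rw [orderOf_eq_zero_iff'] at hz0 ⊢
    intro n hn
    rw [← pow_mul]
    exact hz0 _ (Nat.mul_pos (Nat.pos_of_ne_zero hC.index_ne_zero) hn)
  have hac : ∀ c ∈ C.map χ.ker.subtype, c * (a : G) = a * c := by
    rintro _ ⟨c, hc, rfl⟩
    have h1 : Commute c z := hzc c (hCK hc)
    exact congrArg Subtype.val (h1.pow_right C.index)
  have hCnorm : (C.map χ.ker.subtype).Normal := inferInstance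
  set M := Subgroup.closure (Set.range fun i : ℤ => t ^ i * (a : G) * (t ^ i)⁻¹) with hM
  have hMC : M ≤ C.map χ.ker.subtype := by
    rw [hM, Subgroup.closure_le]
    rintro _ ⟨i, rfl⟩
    exact hCnorm.conj_mem _ ⟨a, haC, rfl⟩ _
  have hMc : ∀ x ∈ M, ∀ c ∈ C.map χ.ker.subtype, c * x = x * c := by
    intro x hx
    have h1 : M ≤ Subgroup.centralizer (C.map χ.ker.subtype : Set G) := by
      rw [hM, Subgroup.closure_le]
      rintro _ ⟨i, rfl⟩
      rw [SetLike.mem_coe, Subgroup.mem_centralizer_iff]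
      intro c hc
      have h2 := hac _ (hCnorm.conj_mem c hc (t ^ i)⁻¹)
      rw [inv_inv] at h2
      have h3 : t ^ i * (((t ^ i)⁻¹ * c * t ^ i) * a) * (t ^ i)⁻¹ =
        t ^ i * (a * ((t ^ i)⁻¹ * c * t ^ i)) * (t ^ i)⁻¹ := by rw [h2]
      calc c * (t ^ i * a * (t ^ i)⁻¹) = _ := by group
        _ = _ := h3
        _ = _ := by group
    exact Subgroup.mem_centralizer_iff.1 (h1 hx)
  have hMt : ∀ x ∈ M, t * x * t⁻¹ ∈ M := by
    intro x hx
    have h1 : M.map (MulAut.conj t).toMonoidHom ≤ M := by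
      rw [hM, MonoidHom.map_closure, Subgroup.closure_le]
      rintro _ ⟨_, ⟨i, rfl⟩, rfl⟩
      refine Subgroup.subset_closure ⟨1 + i, ?_⟩
      change t ^ (1 + i) * (a : G) * (t ^ (1 + i))⁻¹ = t * (t ^ i * a * (t ^ i)⁻¹) * t⁻¹
      rw [zpow_add, zpow_one]; group
    exact h1 ⟨x, hx, rfl⟩
  let : CommGroup M :=
    { (inferInstance : Group M) with
      mul_comm := fun x y => Subtype.ext (hMc y y.2 x (hMC x.2)) }
  have hMfg : Group.FG M := (Group.fg_iff_subgroup_fg M).2 (fg_closure_conj_zpow hG t a)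
  have : AddGroup.FG (Additive M) := GroupFG.iff_add_fg.1 hMfg
  have haM : (a : G) ∈ M := Subgroup.subset_closure ⟨0, by simp⟩
  have : Infinite M := by
    have h1 : orderOf (⟨a, haM⟩ : M) = 0 := by rwa [← Subgroup.orderOf_coe]
    exact Infinite.of_injective _ (injective_pow_iff_not_isOfFinOrder.2 (orderOf_eq_zero_iff.1 h1))
  have : Infinite (Additive M) := this
  let τ : M →* M :=
    { toFun := fun x => ⟨t * x * t⁻¹, hMt x x.2⟩
      map_one' := by ext; simp
      map_mul' := fun x y => by ext; simp }
  have hτ : Function.Injective τ := fun x y hxy => by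
    have := congrArg Subtype.val hxy
    exact Subtype.ext (mul_left_cancel (mul_right_cancel this))
  obtain ⟨m, hm, w, hw0, hw⟩ := AddMonoidHom.exists_iterate_eq (MonoidHom.toAdditive τ) hτ (by
    intro μ φ hφ hμ
    obtain ⟨x, hx⟩ : ∃ x, φ x ≠ 0 := by
      by_contra! hcon
      exact hφ (AddMonoidHom.ext hcon)
    exact hG.norm_eigenvalue_le_one M.subtype Subtype.val_injective τ t (fun _ => rfl)
      (fun x => φ (Additive.ofMul x)) (fun x y => φ.map_add _ _) μ hμ x.toMul hx)
  set w' : M := w.toMul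
  have hw1 : orderOf (w' : G) = 0 := by rwa [Subgroup.orderOf_coe]
  have hiter : ∀ n : ℕ, ((τ^[n] w' : M) : G) = t ^ n * w' * (t ^ n)⁻¹ := by
    intro n
    induction n with
    | zero => simp
    | succ n ih =>
      rw [Function.iterate_succ_apply']
      change t * ((τ^[n] w' : M) : G) * t⁻¹ = _
      rw [ih, pow_succ']; group
  have hw2 : t ^ m * w' * (t ^ m)⁻¹ = w' := by
    rw [← hiter]; exact congrArg Subtype.val hw
  have hCL : C.map χ.ker.subtype ≤ Subgroup.centralizer {(w' : G)} := by
    intro c hc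
    rw [Subgroup.mem_centralizer_singleton_iff]
    exact hMc _ w'.2 c hc
  refine ⟨Subgroup.centralizer {(w' : G)}, finiteIndex_of_pow_mem ht hC hCL hm ?_, w', ?_, hw1, ?_⟩
  · rw [Subgroup.mem_centralizer_singleton_iff]
    exact mul_inv_eq_iff_eq_mul.1 hw2
  · rw [Subgroup.mem_centralizer_singleton_iff]
  · intro h hh
    exact Subgroup.mem_centralizer_singleton_iff.1 hh

end Extension

theorem HasGrowth.finite_of_zero {G : Type*} [Group G] [Group.FG G] (hG : HasGrowth 0 G) :
    Finite G := by
  by_contra hcon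
  rw [not_finite_iff_infinite] at hcon
  obtain ⟨T, hT⟩ := IsSymmGen.exists_of_fg (G := G)
  obtain ⟨C, hC⟩ := hG T hT.finite
  obtain ⟨n, hn⟩ := hT.exists_lt_ncard_pow C
  have := hC n
  simp at this
  omega

theorem hasVirtualCenter_of_hasGrowth (d : ℕ) : ∀ (G : Type*) [Group G] [Group.FG G] [Infinite G],
    HasGrowth d G → HasVirtualCenter G := by
  induction d with
  | zero => 
    intro G _ _ _ hG
    have := hG.finite_of_zero
    exact (not_finite G).elim
  | succ d ih =>
    intro G _ _ _ hG
    obtain ⟨H, hH, χ, hχ⟩ := exists_finiteIndex_surjective_int hG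
    refine HasVirtualCenter.of_finiteIndex hH ?_
    obtain ⟨t, ht⟩ := hχ (Multiplicative.ofAdd 1)
    have hHG := hG.subgroup H
    have hfg : Group.FG χ.ker := fg_ker_of_surjective_int hHG χ ht
    have hK := hHG.ker_of_surjective_int χ hχ
    rcases finite_or_infinite χ.ker with h | h
    · exact hasVirtualCenter_of_finite_ker ht
    · exact HasVirtualCenter.of_ker hHG ht (ih χ.ker hK)

theorem Subgroup.FG.of_map_of_inf_ker {G Q : Type*} [Group G] [Group Q] (f : G →* Q)
    {L : Subgroup G} (h1 : (L.map f).FG) (h2 : (L ⊓ f.ker).FG) : L.FG := by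
  obtain ⟨S, hS, hSf⟩ := (Subgroup.fg_iff _).1 h1
  obtain ⟨R, hR, hRf⟩ := (Subgroup.fg_iff _).1 h2
  have hSL : S ⊆ f '' L := by
    intro s hs
    have : s ∈ L.map f := hS ▸ Subgroup.subset_closure hs
    exact this
  obtain ⟨S', hS'L, rfl⟩ := Set.subset_image_iff.1 hSL
  obtain ⟨S'', hS''S, hS''⟩ := Set.exists_subset_bijOn S' f
  have him : f '' S'' = f '' S' := hS''.image_eq
  have hS''f : S''.Finite := Set.Finite.of_finite_image (him ▸ hSf) hS''.injOn
  rw [← him] at hS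
  refine (Subgroup.fg_iff _).2 ⟨R ∪ S'', le_antisymm ?_ ?_, hRf.union hS''f⟩
  · rw [Subgroup.closure_le]
    refine Set.union_subset (fun x hx => ?_) (hS''S.trans hS'L)
    have : x ∈ L ⊓ f.ker := hR ▸ Subgroup.subset_closure hx
    exact this.1
  · intro x hx
    have h3 : f x ∈ (Subgroup.closure S'').map f := by
      rw [MonoidHom.map_closure, hS]; exact ⟨x, hx, rfl⟩
    obtain ⟨y, hy, hxy⟩ := h3
    have hyL : y ∈ L := ((Subgroup.closure_le L).2 (hS''S.trans hS'L)) hy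
    have h4 : x * y⁻¹ ∈ L ⊓ f.ker := ⟨L.mul_mem hx (L.inv_mem hyL),
      MonoidHom.mem_ker.2 (by rw [map_mul, map_inv, hxy, mul_inv_cancel])⟩
    rw [← hR] at h4
    have h5 := mul_mem (Subgroup.closure_mono Set.subset_union_left h4)
      (Subgroup.closure_mono (Set.subset_union_right (s := R)) hy)
    simpa using h5

theorem Subgroup.fg_of_le_zpowers {G : Type*} [Group G] {L : Subgroup G} {z : G}
    (h : L ≤ Subgroup.zpowers z) : L.FG := by
  have h1 : IsCyclic (L.subgroupOf (Subgroup.zpowers z)) := inferInstance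
  obtain ⟨g, hg⟩ := h1
  refine (Subgroup.fg_iff _).2 ⟨{(g : G)}, ?_, Set.finite_singleton _⟩
  rw [← Subgroup.zpowers_eq_closure]
  refine le_antisymm (Subgroup.zpowers_le.2 g.2) fun x hx => ?_
  obtain ⟨k, hk⟩ := hg ⟨⟨x, h hx⟩, hx⟩
  exact ⟨k, congrArg (fun y => ((y : Subgroup.zpowers z) : G)) (congrArg Subtype.val hk)⟩

theorem Subgroup.FG.of_inf_finiteIndex {G : Type*} [Group G] {L H : Subgroup G}
    (hH : H.FiniteIndex) (h : (L ⊓ H).FG) : L.FG := by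
  obtain ⟨S, hS, hSf⟩ := (Subgroup.fg_iff _).1 h
  have hfin : Finite (L ⧸ H.subgroupOf L) := inferInstance
  refine (Subgroup.fg_iff _).2
    ⟨S ∪ Set.range fun q : L ⧸ H.subgroupOf L => (q.out : G), le_antisymm ?_ ?_,
      hSf.union (Set.finite_range _)⟩
  · rw [Subgroup.closure_le]
    refine Set.union_subset (fun x hx => ?_) ?_
    · have : x ∈ L ⊓ H := hS ▸ Subgroup.subset_closure hx
      exact this.1
    · rintro _ ⟨q, rfl⟩
      exact q.out.2
  · intro x hx
    obtain ⟨c, hc⟩ := QuotientGroup.mk_out_eq_mul (H.subgroupOf L) ⟨x, hx⟩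
    have h1 : ((c : L) : G) ∈ L ⊓ H := ⟨(c : L).2, c.2⟩
    rw [← hS] at h1
    have h2 := Subgroup.closure_mono (Set.subset_union_left (t := Set.range
      fun q : L ⧸ H.subgroupOf L => (q.out : G))) h1
    have h3 := Subgroup.subset_closure (Set.mem_union_right S (Set.mem_range_self
      (f := fun q : L ⧸ H.subgroupOf L => (q.out : G)) (QuotientGroup.mk ⟨x, hx⟩)))
    have h4 := mul_mem h3 (inv_mem h2)
    rw [hc] at h4
    simpa using h4

theorem HasGrowth.quotient_zpowers {G : Type*} [Group G] {d : ℕ} (hG : HasGrowth (d + 1) G) {z : G}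
    (hz : orderOf z = 0) [(Subgroup.zpowers z).Normal] :
    HasGrowth d (G ⧸ Subgroup.zpowers z) := by
  intro S hS
  set π := QuotientGroup.mk' (Subgroup.zpowers z) with hπ
  have hπs : Function.Surjective π := QuotientGroup.mk'_surjective _
  obtain ⟨S₀, hS₀S, hS₀⟩ := Set.exists_subset_bijOn (π ⁻¹' S) π
  have hS₀im : π '' S₀ = S := by
    rw [hS₀.image_eq, Set.image_preimage_eq _ hπs]
  have hS₀f : S₀.Finite := Set.Finite.of_finite_image (hS₀im ▸ hS) hS₀.injOn
  set S' : Set G := insert 1 (insert z S₀) with hS'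
  have hS'f : S'.Finite := (hS₀f.insert _).insert _
  obtain ⟨C, hC⟩ := hG S' hS'f
  refine ⟨C * 2 ^ (d + 1), fun n => ?_⟩
  obtain ⟨X, hXS, hX⟩ := Set.exists_subset_bijOn (S₀ ^ n) π
  have hXim : π '' X = S ^ n := by rw [hX.image_eq, Set.image_pow, hS₀im]
  have hXn : X.ncard = (S ^ n).ncard := by rw [← hXim, hX.injOn.ncard_image]
  let f : G × ℕ → G := fun p => p.1 * z ^ p.2
  have hπz : ∀ i : ℕ, π (z ^ i) = 1 := fun i => by
    rw [hπ, QuotientGroup.mk'_apply, QuotientGroup.eq_one_iff]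
    exact Subgroup.npow_mem_zpowers z i
  have hf : Set.InjOn f (X ×ˢ (Finset.range (n + 1) : Set ℕ)) := by
    rintro ⟨k, i⟩ ⟨hk, -⟩ ⟨k', i'⟩ ⟨hk', -⟩ h
    have h1 : π (k * z ^ i) = π (k' * z ^ i') := congrArg π h
    rw [map_mul, map_mul, hπz, hπz, mul_one, mul_one] at h1
    obtain rfl : k = k' := hX.injOn hk hk' h1
    have h3 : z ^ i = z ^ i' := mul_left_cancel h
    have h4 := injective_pow_iff_not_isOfFinOrder.2 (orderOf_eq_zero_iff.1 hz) h3
    exact Prod.ext rfl h4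
  have hsub : f '' (X ×ˢ (Finset.range (n + 1) : Set ℕ)) ⊆ S' ^ (2 * n) := by
    rintro _ ⟨⟨k, i⟩, ⟨hk, hi⟩, rfl⟩
    rw [two_mul, pow_add]
    refine Set.mul_mem_mul (Set.pow_subset_pow_left (fun x hx => by simp [hS', hx]) (hXS hk)) ?_
    have : i ≤ n := by simpa [Nat.lt_succ_iff] using hi
    exact Set.pow_subset_pow_right (by simp [hS']) this (Set.pow_mem_pow (by simp [hS']))
  have h1 := Set.ncard_le_ncard hsub (set_finite_pow hS'f _)
  rw [hf.ncard_image, Set.ncard_prod, Set.ncard_coe_finset, Finset.card_range, hXn] at h1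
  have h2 : (S ^ n).ncard * (n + 1) ≤ (C * 2 ^ (d + 1) * (n + 1) ^ d) * (n + 1) := by
    refine h1.trans ((hC _).trans ?_)
    calc C * (2 * n + 1) ^ (d + 1) ≤ C * (2 * (n + 1)) ^ (d + 1) := by gcongr; omega
      _ = _ := by rw [mul_pow]; ring
  exact Nat.le_of_mul_le_mul_right h2 (Nat.succ_pos n)

/-- **Gromov's theorem**: a finitely generated group of polynomial growth is virtually nilpotent.
Moreover all of its subgroups are finitely generated. -/
theorem exists_finiteIndex_isNilpotent (d : ℕ) : ∀ (G : Type u) [Group G] [Group.FG G],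
    HasGrowth d G → (∀ L : Subgroup G, L.FG) ∧
      ∃ N : Subgroup G, N.FiniteIndex ∧ Group.IsNilpotent N := by
  have hfinite : ∀ (G : Type u) [Group G] [Finite G], (∀ L : Subgroup G, L.FG) ∧
      ∃ N : Subgroup G, N.FiniteIndex ∧ Group.IsNilpotent N := fun G _ _ =>
    ⟨fun L => (Group.fg_iff_subgroup_fg L).1 inferInstance, ⊥, inferInstance, inferInstance⟩
  induction d with
  | zero =>
    intro G _ _ hG
    have := hG.finite_of_zero
    exact hfinite G
  | succ d ih =>
    intro G _ _ hG
    rcases finite_or_infinite G with hfin | hinf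
    · exact hfinite G
    obtain ⟨H, hH, z, hzH, hz0, hzc⟩ := hasVirtualCenter_of_hasGrowth _ G hG
    set w : H := ⟨z, hzH⟩ with hw
    have hw0 : orderOf w = 0 := by rwa [← Subgroup.orderOf_coe]
    have hwc : Subgroup.zpowers w ≤ Subgroup.center H := by
      rw [Subgroup.zpowers_le, Subgroup.mem_center_iff]
      exact fun g => Subtype.ext (hzc g g.2)
    have hnorm : (Subgroup.zpowers w).Normal := ⟨fun n hn g => by
      rw [Subgroup.mem_center_iff.1 (hwc hn) g, mul_inv_cancel_right]; exact hn⟩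
    set π := QuotientGroup.mk' (Subgroup.zpowers w) with hπ
    have hker : π.ker = Subgroup.zpowers w := QuotientGroup.ker_mk' _
    obtain ⟨h1, N, hN, hNn⟩ := ih (H ⧸ Subgroup.zpowers w) ((hG.subgroup H).quotient_zpowers hw0)
    have hHfg : ∀ L : Subgroup H, L.FG := fun L =>
      Subgroup.FG.of_map_of_inf_ker π (h1 _) (Subgroup.fg_of_le_zpowers (inf_le_right.trans hker.le))
    refine ⟨fun L => ?_, (N.comap π).map H.subtype, ⟨?_⟩, ?_⟩
    · refine Subgroup.FG.of_inf_finiteIndex hH ?_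
      rw [← Subgroup.subgroupOf_map_subtype]
      have := (Group.fg_iff_subgroup_fg _).2 (hHfg (L.subgroupOf H))
      rw [← Subgroup.range_subtype (L.subgroupOf H), MonoidHom.map_range]
      exact (Group.fg_iff_subgroup_fg _).1 inferInstance
    · rw [Subgroup.index_map_subtype]
      refine mul_ne_zero ?_ hH.index_ne_zero
      rw [Subgroup.index_comap_of_surjective _ (QuotientGroup.mk'_surjective _)]
      exact hN.index_ne_zero
    · have h2 : Group.IsNilpotent (N.comap π) := by
        refine Subgroup.isNilpotent_of_ker_le_center (π.subgroupComap N) ?_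
        intro x hx
        have h3 : (x : H) ∈ Subgroup.zpowers w := hker.le (congrArg Subtype.val hx)
        rw [Subgroup.mem_center_iff]
        intro y
        exact Subtype.ext (Subgroup.mem_center_iff.1 (hwc h3) y)
      exact Group.nilpotent_of_mulEquiv
        ((N.comap π).equivMapOfInjective H.subtype Subtype.val_injective)

section Filtration

variable {G : Type*} [Group G]

theorem Subgroup.commutator_commutator_le_of_rotate {H₁ H₂ H₃ N : Subgroup G} [N.Normal]
    (h1 : ⁅⁅H₂, H₃⁆, H₁⁆ ≤ N) (h2 : ⁅⁅H₃, H₁⁆, H₂⁆ ≤ N) : ⁅⁅H₁, H₂⁆, H₃⁆ ≤ N := by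
  have key : ∀ K : Subgroup G, K ≤ N ↔ K.map (QuotientGroup.mk' N) = ⊥ := fun K => by
    rw [Subgroup.map_eq_bot_iff, QuotientGroup.ker_mk']
  rw [key] at h1 h2 ⊢
  rw [Subgroup.map_commutator, Subgroup.map_commutator] at h1 h2 ⊢
  exact Subgroup.commutator_commutator_eq_bot_of_rotate h1 h2

theorem Subgroup.commutator_lowerCentralSeries_le (i j : ℕ) :
    ⁅(⊤ : Subgroup G).lowerCentralSeries i, (⊤ : Subgroup G).lowerCentralSeries j⁆ ≤
      (⊤ : Subgroup G).lowerCentralSeries (i + j + 1) := by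
  induction j generalizing i with
  | zero => exact le_rfl
  | succ j ih =>
    rw [Subgroup.commutator_comm, Subgroup.lowerCentralSeries_succ]
    refine Subgroup.commutator_commutator_le_of_rotate ?_ ?_
    · rw [Subgroup.commutator_comm ⊤, ← Subgroup.lowerCentralSeries_succ]
      exact (ih (i + 1)).trans (by rw [show i + 1 + j + 1 = i + (j + 1) + 1 by ring])
    · rw [show i + (j + 1) + 1 = (i + j + 1) + 1 by ring]
      exact Subgroup.commutator_mono (ih i) le_rfl

/-- A decreasing filtration compatible with commutators. -/
structure IsCommFiltration (D : ℕ → Subgroup G) : Prop where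
  antitone : Antitone D
  commutator_le : ∀ i j, ⁅D i, D j⁆ ≤ D (i + j)

theorem isCommFiltration_lowerCentralSeries :
    IsCommFiltration fun w => (⊤ : Subgroup G).lowerCentralSeries (w - 1) where
  antitone := fun i j h => Subgroup.lowerCentralSeries_antitone _ (Nat.sub_le_sub_right h 1)
  commutator_le := by
    intro i j
    rcases i with - | i
    · simpa using Subgroup.commutator_le_right _ _
    rcases j with - | j
    · simpa using Subgroup.commutator_le_left _ _
    · exact (Subgroup.commutator_lowerCentralSeries_le i j).trans
        (by rw [show i + 1 + (j + 1) - 1 = i + j + 1 by omega])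

/-- An alphabet of letters with weights such that words of weight `w` represent exactly the
elements of the `w`-th term of a filtration. -/
structure IsWeightedAlphabet (D : ℕ → Subgroup G) {Λ : Type*} (wt : Λ → ℕ) (val : Λ → G) :
    Prop where
  wt_pos : ∀ a, 1 ≤ wt a
  val_mem : ∀ a, val a ∈ D (wt a)
  exists_word : ∀ w, 1 ≤ w → ∀ g ∈ D w,
    ∃ ℓ : List Λ, (∀ a ∈ ℓ, wt a = w) ∧ (ℓ.map val).prod = g

/-- Number of letters of weight at most `j`. -/
def lightCount {Λ : Type*} (wt : Λ → ℕ) (j : ℕ) (ℓ : List Λ) : ℕ :=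
  ℓ.countP fun b => decide (wt b ≤ j)

section Words

variable {Λ : Type*} {wt : Λ → ℕ} {val : Λ → G} {D : ℕ → Subgroup G}

theorem lightCount_append (j : ℕ) (ℓ ℓ' : List Λ) :
    lightCount wt j (ℓ ++ ℓ') = lightCount wt j ℓ + lightCount wt j ℓ' := List.countP_append ..

theorem lightCount_cons (j : ℕ) (a : Λ) (ℓ : List Λ) :
    lightCount wt j (a :: ℓ) = lightCount wt j ℓ + if wt a ≤ j then 1 else 0 := by
  simp [lightCount, List.countP_cons]

theorem lightCount_le_length (j : ℕ) (ℓ : List Λ) : lightCount wt j ℓ ≤ ℓ.length :=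
  List.countP_le_length

theorem lightCount_eq_zero {j : ℕ} {ℓ : List Λ} (h : ∀ b ∈ ℓ, j < wt b) :
    lightCount wt j ℓ = 0 := by
  rw [lightCount, List.countP_eq_zero]
  intro b hb
  simpa using h b hb

theorem word_mem {ℓ : List Λ} {w : ℕ} (hD : IsCommFiltration D)
    (hΛ : IsWeightedAlphabet D wt val) (h : ∀ a ∈ ℓ, w ≤ wt a) : (ℓ.map val).prod ∈ D w := by
  refine Subgroup.list_prod_mem _ fun x hx => ?_
  obtain ⟨a, ha, rfl⟩ := List.mem_map.1 hx
  exact hD.antitone (h a ha) (hΛ.val_mem a)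

theorem exists_commutator_words [Finite Λ] (hD : IsCommFiltration D)
    (hΛ : IsWeightedAlphabet D wt val) :
    ∃ (com : Λ → Λ → List Λ) (L : ℕ), ∀ a b,
      val b * val a = val a * val b * ((com a b).map val).prod ∧
      (∀ x ∈ com a b, wt x = wt a + wt b) ∧ (com a b).length ≤ L := by
  have h : ∀ p : Λ × Λ, ∃ ℓ : List Λ, (∀ x ∈ ℓ, wt x = wt p.1 + wt p.2) ∧
      (ℓ.map val).prod = ⁅(val p.2)⁻¹, (val p.1)⁻¹⁆ := by
    rintro ⟨a, b⟩
    refine hΛ.exists_word _ (by have := hΛ.wt_pos a; simp only; omega) _ ?_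
    have := hD.commutator_le (wt b) (wt a)
    rw [add_comm] at this
    exact this (Subgroup.commutator_mem_commutator (inv_mem (hΛ.val_mem b))
      (inv_mem (hΛ.val_mem a)))
  choose f hf1 hf2 using h
  obtain ⟨L, hL⟩ := (Set.finite_range fun p => (f p).length).bddAbove
  refine ⟨fun a b => f (a, b), L, fun a b => ⟨?_, hf1 (a, b), hL ⟨(a, b), rfl⟩⟩⟩
  rw [hf2 (a, b), commutatorElement_def]
  group

variable {com : Λ → Λ → List Λ} {L : ℕ}

theorem word_mul_letter
    (hcom : ∀ a b, val b * val a = val a * val b * ((com a b).map val).prod) (a : Λ) (ℓ : List Λ) :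
    (ℓ.map val).prod * val a = val a * ((ℓ.flatMap fun b => b :: com a b).map val).prod := by
  induction ℓ with
  | nil => simp
  | cons b ℓ ih =>
    simp only [List.map_cons, List.prod_cons, List.flatMap_cons, List.cons_append, List.map_append,
      List.prod_append]
    rw [mul_assoc, ih, ← mul_assoc, hcom a b]
    simp only [mul_assoc]

theorem lightCount_flatMap_le (hwt : ∀ a b, ∀ x ∈ com a b, wt x = wt a + wt b)
    (hlen : ∀ a b, (com a b).length ≤ L) (a : Λ) (ℓ : List Λ) {j : ℕ} (hj : wt a ≤ j) :
    lightCount wt j (ℓ.flatMap fun b => b :: com a b) ≤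
      lightCount wt j ℓ + L * lightCount wt (j - wt a) ℓ := by
  induction ℓ with
  | nil => simp [lightCount]
  | cons b ℓ ih =>
    simp only [List.flatMap_cons, List.cons_append, lightCount_cons, lightCount_append]
    have h1 : lightCount wt j (com a b) ≤ L * if wt b ≤ j - wt a then 1 else 0 := by
      split_ifs with h
      · rw [mul_one]; exact (lightCount_le_length _ _).trans (hlen a b)
      · rw [lightCount_eq_zero fun x hx => by rw [hwt a b x hx]; omega]
        exact Nat.zero_le _
    rw [mul_add]
    omega

/-- Moving all letters of minimal weight to the front. -/
theorem exists_extract [DecidableEq Λ] (hpos : ∀ a, 1 ≤ wt a)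
    (hcom : ∀ a b, val b * val a = val a * val b * ((com a b).map val).prod)
    (hwt : ∀ a b, ∀ x ∈ com a b, wt x = wt a + wt b)
    (hlen : ∀ a b, (com a b).length ≤ L) {w R : ℕ} (hw : 1 ≤ w) (as : List Λ) :
    ∀ (ℓ : List Λ) (s : ℕ), (∀ b ∈ ℓ, w ≤ wt b) →
      as.Perm (ℓ.filter fun b => decide (wt b = w)) → s + as.length ≤ R ^ w →
      (∀ j, w ≤ j → lightCount wt j ℓ ≤ R ^ j + s * L * ((1 + L) * R) ^ (j - w)) →
      ∃ ℓ' : List Λ, (∀ b ∈ ℓ', w + 1 ≤ wt b) ∧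
        (ℓ.map val).prod = (as.map val).prod * (ℓ'.map val).prod ∧
        ∀ j, lightCount wt j ℓ' ≤ ((1 + L) * R) ^ j := by
  have hbound : ∀ s j, s ≤ R ^ w → w ≤ j →
      R ^ j + s * L * ((1 + L) * R) ^ (j - w) ≤ ((1 + L) * R) ^ j := by
    intro s j hs hj
    obtain ⟨i, rfl⟩ := Nat.exists_eq_add_of_le hj
    rw [Nat.add_sub_cancel_left]
    have h1 : 1 ≤ (1 + L) ^ i := Nat.one_le_pow _ _ (by omega)
    have h2 : (1 + L) ≤ (1 + L) ^ w := Nat.le_self_pow (by omega) _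
    calc R ^ (w + i) + s * L * ((1 + L) * R) ^ i
        ≤ R ^ (w + i) * (1 + L) ^ i + R ^ w * L * ((1 + L) * R) ^ i := by
          gcongr
          exact Nat.le_mul_of_pos_right _ h1
      _ = (1 + L) * ((1 + L) ^ i * R ^ (w + i)) := by rw [mul_pow, pow_add]; ring
      _ ≤ (1 + L) ^ w * ((1 + L) ^ i * R ^ (w + i)) := by gcongr
      _ = _ := by rw [mul_pow ((1 + L)), pow_add (1 + L)]; ring
  induction as with
  | nil =>
    intro ℓ s hℓ hperm hs hc
    have hgt : ∀ b ∈ ℓ, w + 1 ≤ wt b := by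
      intro b hb
      have h0 := List.nil_perm.1 hperm
      rw [List.filter_eq_nil_iff] at h0
      have h1 := h0 b hb
      have h2 := hℓ b hb
      simp only [decide_eq_true_eq] at h1
      omega
    refine ⟨ℓ, hgt, by simp, fun j => ?_⟩
    rcases le_or_gt w j with hj | hj
    · exact (hc j hj).trans (hbound s j (by simpa using hs) hj)
    · rw [lightCount_eq_zero fun b hb => by have := hgt b hb; omega]
      exact Nat.zero_le _
  | cons a as ih =>
    intro ℓ s hℓ hperm hs hc
    have ha : a ∈ ℓ.filter fun b => decide (wt b = w) := hperm.subset (by simp)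
    obtain ⟨haℓ, haw⟩ := List.mem_filter.1 ha
    have haw : wt a = w := by simpa using haw
    obtain ⟨p, q, rfl⟩ := List.append_of_mem haℓ
    have hsR : s ≤ R ^ w := by omega
    rw [List.length_cons] at hs
    have hcomw : ∀ b ∈ p, ∀ x ∈ com a b, w < wt x := by
      intro b hb x hx
      have := hwt a b x hx
      have := hpos b
      omega
    have hnew := ih ((p.flatMap fun b => b :: com a b) ++ q) (s + 1) ?_ ?_ (by omega) ?_
    · obtain ⟨ℓ', h1, h2, h3⟩ := hnew
      refine ⟨ℓ', h1, ?_, h3⟩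
      rw [List.map_cons, List.prod_cons, mul_assoc, ← h2]
      simp only [List.map_append, List.prod_append, List.map_cons, List.prod_cons]
      rw [← mul_assoc, word_mul_letter hcom, mul_assoc]
    · intro b hb
      rw [List.mem_append, List.mem_flatMap] at hb
      rcases hb with ⟨x, hx, hb⟩ | hb
      · rcases List.mem_cons.1 hb with rfl | hb
        · exact hℓ b (by simp [hx])
        · exact (hcomw x hx b hb).le
      · exact hℓ b (by simp [hb])
    · have h1 : ∀ p : List Λ, (∀ b ∈ p, ∀ x ∈ com a b, w < wt x) →
          (p.flatMap fun b => b :: com a b).filter (fun b => decide (wt b = w)) =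
          p.filter fun b => decide (wt b = w) := by
        intro p
        induction p with
        | nil => simp
        | cons b p ihp =>
          intro h
          have h0 : (com a b).filter (fun b => decide (wt b = w)) = [] := by
            rw [List.filter_eq_nil_iff]
            intro x hx
            have := h b (by simp) x hx
            simp only [decide_eq_true_eq]
            omega
          rw [List.flatMap_cons, List.cons_append, List.filter_cons, List.filter_cons,
            List.filter_append, h0, List.nil_append, ihp fun b hb => h b (by simp [hb])]
      rw [List.filter_append, h1 p hcomw]
      rw [List.filter_append, List.filter_cons_of_pos (by simpa using haw)] at hperm
      exact (hperm.trans List.perm_middle).cons_inv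
    · intro j hj
      have h1 := lightCount_flatMap_le hwt hlen a p (j := j) (by omega)
      have h2 := hc j hj
      rw [lightCount_append, lightCount_cons] at h2
      rw [lightCount_append]
      have h3 : lightCount wt (j - wt a) p ≤ ((1 + L) * R) ^ (j - w) := by
        rw [haw]
        rcases le_or_gt w (j - w) with hj' | hj'
        · have h4 := hc (j - w) hj'
          rw [lightCount_append] at h4
          have := hbound s (j - w) hsR hj'
          omega
        · rw [lightCount_eq_zero fun b hb => by have := hℓ b (by simp [hb]); omega]
          exact Nat.zero_le _
      have h5 : L * lightCount wt (j - wt a) p ≤ L * ((1 + L) * R) ^ (j - w) := by gcongr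
      have h6 : (s + 1) * L * ((1 + L) * R) ^ (j - w) =
        s * L * ((1 + L) * R) ^ (j - w) + L * ((1 + L) * R) ^ (j - w) := by ring
      omega

end Words

end Filtration

section Upper

variable {G : Type*} [Group G] {Λ : Type*} {wt : Λ → ℕ} {val : Λ → G} {D : ℕ → Subgroup G}

theorem exists_list_of_mem_closure {M : Type*} [AddCommMonoid M] {B : Set M} {k : M}
    (hk : k ∈ AddSubmonoid.closure B) :
    ∃ bs : List M, (∀ b ∈ bs, b ∈ B ∧ b ≠ 0) ∧ bs.sum = k := by
  classical
  obtain ⟨l, hl, rfl⟩ := AddSubmonoid.exists_list_of_mem_closure hk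
  exact ⟨l.filter fun b => decide (b ≠ 0), fun b hb => by
    rw [List.mem_filter] at hb; exact ⟨hl b hb.1, by simpa using hb.2⟩, by
    clear hl hk
    induction l with
    | nil => simp
    | cons a l ih =>
      rw [List.filter_cons]
      split_ifs with h
      · rw [List.sum_cons, List.sum_cons, ih]
      · have : a = 0 := by simpa using h
        rw [ih, List.sum_cons, this, zero_add]⟩

/-- A word with prescribed letter counts. -/
noncomputable def countWord [Fintype Λ] (k : Λ → ℕ) : List Λ :=
  (Finset.univ : Finset Λ).toList.flatMap fun a => List.replicate (k a) a

theorem count_countWord [Fintype Λ] [DecidableEq Λ] (k : Λ → ℕ) (a : Λ) :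
    (countWord k).count a = k a := by
  rw [countWord, List.count_flatMap]
  simp only [Function.comp_def, List.count_replicate]
  rw [Finset.sum_map_toList]
  simp

theorem exists_reduce_step [Fintype Λ] (hD : IsCommFiltration D)
    (hΛ : IsWeightedAlphabet D wt val) {w : ℕ} (hw : 1 ≤ w) :
    ∃ C : ℕ, ∀ (R : ℕ) (ℓ : List Λ), 1 ≤ R → (∀ b ∈ ℓ, w ≤ wt b) →
      (∀ j, lightCount wt j ℓ ≤ R ^ j) → (ℓ.map val).prod ∈ D (w + 1) →
      ∃ ℓ' : List Λ, (∀ b ∈ ℓ', w + 1 ≤ wt b) ∧ (ℓ'.map val).prod = (ℓ.map val).prod ∧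
        ∀ j, lightCount wt j ℓ' ≤ (C * R) ^ j := by
  classical
  obtain ⟨com, L, hcom⟩ := exists_commutator_words hD hΛ
  have hX := fun {R : ℕ} (as ℓ : List Λ) => exists_extract (R := R) hΛ.wt_pos
    (fun a b => (hcom a b).1) (fun a b => (hcom a b).2.1) (fun a b => (hcom a b).2.2) hw as ℓ 0
  -- words with the same letters agree modulo the next term
  have hperm : ∀ as bs : List Λ, (∀ a ∈ as, wt a = w) → bs.Perm as →
      (as.map val).prod ∈ D (w + 1) → (bs.map val).prod ∈ D (w + 1) := by
    intro as bs has hp hmem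
    obtain ⟨ℓ', h1, h2, -⟩ := hX (R := as.length + 1) bs as (fun b hb => (has b hb).ge)
      (by rw [List.filter_eq_self.2 (by simpa using has)]; exact hp)
      (by rw [hp.length_eq, zero_add]
          exact (Nat.le_succ _).trans (Nat.le_self_pow (by omega) _))
      (fun j hj => (lightCount_le_length _ _).trans ((Nat.le_succ _).trans
        ((Nat.le_self_pow (by omega) _).trans (Nat.le_add_right _ _))))
    rw [h2] at hmem
    exact (Subgroup.mul_mem_cancel_right _ (word_mem hD hΛ h1)).1 hmem
  let P : AddSubmonoid (Λ → ℕ) :=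
    { carrier := {k | (∀ a, wt a ≠ w → k a = 0) ∧ ((countWord k).map val).prod ∈ D (w + 1)}
      zero_mem' := by
        refine ⟨fun _ _ => rfl, ?_⟩
        have : countWord (0 : Λ → ℕ) = [] := by simp [countWord]
        rw [this]
        simp [one_mem]
      add_mem' := by
        rintro x y ⟨hx1, hx2⟩ ⟨hy1, hy2⟩
        refine ⟨fun a ha => by simp [hx1 a ha, hy1 a ha],
          hperm (countWord x ++ countWord y) _ ?_ ?_ ?_⟩
        · intro a ha
          by_contra hne
          have := List.count_pos_iff.2 ha
          rw [List.count_append, count_countWord, count_countWord, hx1 a hne, hy1 a hne] at this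
          omega
        · rw [List.perm_iff_count]
          intro a
          simp [List.count_append, count_countWord]
        · rw [List.map_append, List.prod_append]
          exact mul_mem hx2 hy2 }
  have hsupp : ∀ k : Λ → ℕ, (∀ a, wt a ≠ w → k a = 0) → ∀ a ∈ countWord k, wt a = w := by
    intro k hk a ha
    by_contra hne
    have := List.count_pos_iff.2 ha
    rw [count_countWord, hk a hne] at this
    omega
  have hPfg : P.FG := by
    refine AddSubmonoid.fg_of_subtractive ?_
    rintro x ⟨hx1, hx2⟩ y ⟨hy1, hy2⟩
    have hy1' : ∀ a, wt a ≠ w → y a = 0 := fun a ha => by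
      have := hy1 a ha
      simp only [Pi.add_apply] at this
      omega
    refine ⟨hy1', ?_⟩
    have h := hperm (countWord (x + y)) (countWord x ++ countWord y) (hsupp _ hy1) (by
      rw [List.perm_iff_count]
      intro a
      simp [List.count_append, count_countWord]) hy2
    rw [List.map_append, List.prod_append] at h
    exact (Subgroup.mul_mem_cancel_left _ hx2).1 h
  obtain ⟨B, hB⟩ := hPfg
  have hBP : ∀ b ∈ B, b ∈ P := fun b hb => hB ▸ AddSubmonoid.subset_closure hb
  have hword : ∀ b : Λ → ℕ, ∃ ℓ : List Λ, b ∈ B → (∀ a ∈ ℓ, wt a = w + 1) ∧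
      (ℓ.map val).prod = ((countWord b).map val).prod := by
    intro b
    by_cases hb : b ∈ B
    · obtain ⟨ℓ, hℓ⟩ := hΛ.exists_word (w + 1) (by omega) _ (hBP b hb).2
      exact ⟨ℓ, fun _ => hℓ⟩
    · exact ⟨[], fun h => absurd h hb⟩
  choose f hf using hword
  obtain ⟨L₁, hL₁⟩ := ((B.finite_toSet).image fun b => (f b).length).bddAbove
  refine ⟨1 + L + L₁, fun R ℓ hR hℓ hc hmem => ?_⟩
  set k : Λ → ℕ := fun a => (ℓ.filter fun b => decide (wt b = w)).count a with hk
  have hkw : ∀ a, wt a ≠ w → k a = 0 := fun a ha => by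
    rw [hk]
    exact List.count_eq_zero.2 fun h => ha (by simpa using (List.mem_filter.1 h).2)
  have hlen : (ℓ.filter fun b => decide (wt b = w)).length ≤ R ^ w := by
    rw [← List.countP_eq_length_filter]
    refine le_trans ?_ (hc w)
    refine List.countP_mono_left fun x _ hx => ?_
    simp only [decide_eq_true_eq] at hx ⊢
    exact hx.le
  have hkc : (countWord k).Perm (ℓ.filter fun b => decide (wt b = w)) := by
    rw [List.perm_iff_count]
    intro a
    rw [count_countWord]
  have hcj : ∀ j, w ≤ j → lightCount wt j ℓ ≤ R ^ j + 0 * L * ((1 + L) * R) ^ (j - w) :=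
    fun j _ => (hc j).trans (Nat.le_add_right _ _)
  have hkP : k ∈ P := by
    refine ⟨hkw, ?_⟩
    obtain ⟨ℓ', h1, h2, -⟩ := hX (R := R) (countWord k) ℓ hℓ hkc
      (by rw [hkc.length_eq]; omega) hcj
    rw [h2] at hmem
    exact (Subgroup.mul_mem_cancel_right _ (word_mem hD hΛ h1)).1 hmem
  rw [← hB] at hkP
  obtain ⟨bs, hbs, hsum⟩ := exists_list_of_mem_closure hkP
  have hcount : ∀ (bs : List (Λ → ℕ)) (a : Λ), (bs.flatMap countWord).count a = bs.sum a := by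
    intro bs a
    induction bs with
    | nil => simp
    | cons b bs ih => simp [List.count_append, count_countWord, ih]
  have hasp : (bs.flatMap countWord).Perm (ℓ.filter fun b => decide (wt b = w)) := by
    rw [List.perm_iff_count]
    intro a
    rw [hcount, hsum]
  obtain ⟨ℓ₁, h1, h2, h3⟩ := hX (R := R) (bs.flatMap countWord) ℓ hℓ hasp
    (by rw [hasp.length_eq]; omega) hcj
  have hbslen : ∀ bs : List (Λ → ℕ), (∀ b ∈ bs, b ∈ B ∧ b ≠ 0) →
      bs.length ≤ (bs.flatMap countWord).length ∧
      (bs.flatMap f).length ≤ L₁ * bs.length ∧ (∀ a ∈ bs.flatMap f, wt a = w + 1) ∧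
      ((bs.flatMap f).map val).prod = ((bs.flatMap countWord).map val).prod := by
    intro bs
    induction bs with
    | nil => intro _; simp
    | cons b bs ih =>
      intro hb
      obtain ⟨i1, i2, i3, i4⟩ := ih fun x hx => hb x (by simp [hx])
      obtain ⟨hbB, hb0⟩ := hb b (by simp)
      refine ⟨?_, ?_, ?_, ?_⟩
      · have : 0 < (countWord b).length := by
          rw [List.length_pos_iff]
          intro h0
          refine hb0 (funext fun a => ?_)
          rw [← count_countWord b a, h0]
          rfl
        rw [List.flatMap_cons, List.length_append, List.length_cons]
        omega
      · have := hL₁ ⟨b, hbB, rfl⟩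
        rw [List.flatMap_cons, List.length_append, List.length_cons, mul_add]
        simp only at this
        omega
      · intro a ha
        rw [List.flatMap_cons, List.mem_append] at ha
        rcases ha with ha | ha
        · exact (hf b hbB).1 a ha
        · exact i3 a ha
      · rw [List.flatMap_cons, List.flatMap_cons, List.map_append, List.map_append,
          List.prod_append, List.prod_append, i4, (hf b hbB).2]
  obtain ⟨i1, i2, i3, i4⟩ := hbslen bs hbs
  have hge : ∀ b ∈ bs.flatMap f ++ ℓ₁, w + 1 ≤ wt b := by
    intro b hb
    rcases List.mem_append.1 hb with hb | hb
    · exact (i3 b hb).ge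
    · exact h1 b hb
  refine ⟨bs.flatMap f ++ ℓ₁, hge, ?_, fun j => ?_⟩
  · rw [List.map_append, List.prod_append, i4, ← h2]
  · rcases le_or_gt (w + 1) j with hj | hj
    · rw [lightCount_append]
      have e1 : lightCount wt j (bs.flatMap f) ≤ (L₁ * R) ^ j := by
        calc lightCount wt j (bs.flatMap f) ≤ L₁ * bs.length :=
              (lightCount_le_length _ _).trans i2
          _ ≤ L₁ * R ^ w := by
              gcongr
              exact i1.trans (hasp.length_eq.le.trans hlen)
          _ ≤ L₁ ^ j * R ^ j := by
              gcongr
              · exact Nat.le_self_pow (by omega) _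
              · omega
          _ = _ := by rw [mul_pow]
      calc _ ≤ (L₁ * R) ^ j + ((1 + L) * R) ^ j := add_le_add e1 (h3 j)
        _ ≤ (L₁ * R + (1 + L) * R) ^ j := pow_add_pow_le (by positivity) (by positivity) (by omega)
        _ = _ := by ring
    · rw [lightCount_eq_zero fun b hb => by have := hge b hb; omega]
      exact Nat.zero_le _

theorem exists_reduce [Fintype Λ] (hD : IsCommFiltration D)
    (hΛ : IsWeightedAlphabet D wt val) (w : ℕ) :
    ∃ C : ℕ, 1 ≤ C ∧ ∀ (R : ℕ) (ℓ : List Λ), 1 ≤ R →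
      (∀ j, lightCount wt j ℓ ≤ R ^ j) → (ℓ.map val).prod ∈ D (w + 1) →
      ∃ ℓ' : List Λ, (∀ b ∈ ℓ', w + 1 ≤ wt b) ∧ (ℓ'.map val).prod = (ℓ.map val).prod ∧
        ∀ j, lightCount wt j ℓ' ≤ (C * R) ^ j := by
  induction w with
  | zero => exact ⟨1, le_rfl, fun R ℓ _ h _ => ⟨ℓ, fun b _ => hΛ.wt_pos b, rfl, by simpa using h⟩⟩
  | succ w ih =>
    obtain ⟨C, hC, h⟩ := ih
    obtain ⟨C', h'⟩ := exists_reduce_step hD hΛ (w := w + 1) (by omega)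
    refine ⟨(C' + 1) * C, Nat.mul_pos (by omega) hC, fun R ℓ hR hc hmem => ?_⟩
    obtain ⟨ℓ₁, h1, h2, h3⟩ := h R ℓ hR hc (hD.antitone (by omega) hmem)
    obtain ⟨ℓ₂, k1, k2, k3⟩ := h' (C * R) ℓ₁ (Nat.mul_pos hC hR) h1 h3 (h2 ▸ hmem)
    refine ⟨ℓ₂, k1, k2.trans h2, fun j => (k3 j).trans (Nat.pow_le_pow_left ?_ _)⟩
    rw [← mul_assoc]
    gcongr
    omega

end Upper

section Nilpotent

variable {G : Type*} [Group G]

theorem Subgroup.FG.exists_list {L : Subgroup G} (hL : L.FG) :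
    ∃ ts : List G, (∀ t ∈ ts, t ∈ L) ∧
      ∀ g ∈ L, ∃ ℓ : List G, (∀ x ∈ ℓ, x ∈ ts) ∧ ℓ.prod = g := by
  classical
  obtain ⟨S, rfl⟩ := hL
  refine ⟨S.toList ++ S.toList.map (·⁻¹), ?_, ?_⟩
  · intro t ht
    rw [List.mem_append, List.mem_map] at ht
    rcases ht with ht | ⟨a, ha, rfl⟩
    · exact Subgroup.subset_closure (by simpa using ht)
    · exact inv_mem (Subgroup.subset_closure (by simpa using ha))
  · intro g hg
    rw [← Subgroup.mem_toSubmonoid, Subgroup.closure_toSubmonoid] at hg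
    obtain ⟨ℓ, hℓ, rfl⟩ := Submonoid.exists_list_of_mem_closure hg
    refine ⟨ℓ, fun x hx => ?_, rfl⟩
    rw [List.mem_append, List.mem_map]
    rcases hℓ x hx with h | h
    · exact Or.inl (by simpa using h)
    · exact Or.inr ⟨x⁻¹, by simpa using h, inv_inv x⟩

theorem exists_list_of_mem_pow {A : Set G} {n : ℕ} {g : G} (hg : g ∈ A ^ n) :
    ∃ ℓ : List G, (∀ x ∈ ℓ, x ∈ A) ∧ ℓ.prod = g ∧ ℓ.length = n := by
  induction n generalizing g with
  | zero => exact ⟨[], by simp, by simpa using hg.symm, rfl⟩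
  | succ n ih =>
    rw [pow_succ'] at hg
    obtain ⟨a, ha, b, hb, rfl⟩ := hg
    obtain ⟨ℓ, h1, h2, h3⟩ := ih hb
    exact ⟨a :: ℓ, by simpa using ⟨ha, h1⟩, by simp [h2], by simp [h3]⟩

/-- In a nilpotent group with last nontrivial term of weight `c + 1`, elements of that term in
a ball of radius `n` are words of length `O(n ^ (c + 1))` in its generators. -/
theorem exists_short_word_lowerCentralSeries (hfg : ∀ L : Subgroup G, L.FG) {c : ℕ}
    (hbot : (⊤ : Subgroup G).lowerCentralSeries (c + 1) = ⊥) :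
    ∃ ts : List G, (∀ t ∈ ts, t ∈ (⊤ : Subgroup G).lowerCentralSeries c) ∧
      ∀ A : Set G, A.Finite → ∃ C : ℕ, 1 ≤ C ∧ ∀ n, 1 ≤ n → ∀ g ∈ A ^ n,
        g ∈ (⊤ : Subgroup G).lowerCentralSeries c →
        ∃ ℓ : List G, (∀ x ∈ ℓ, x ∈ ts) ∧ ℓ.prod = g ∧ ℓ.length ≤ (C * n) ^ (c + 1) := by
  classical
  choose U hU hUw using fun i : ℕ => (hfg ((⊤ : Subgroup G).lowerCentralSeries i)).exists_list
  let Λ := Σ i : Fin (c + 1), {x // x ∈ (U i).toFinset}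
  let wt : Λ → ℕ := fun a => a.1 + 1
  let val : Λ → G := fun a => a.2.1
  have hD := isCommFiltration_lowerCentralSeries (G := G)
  set D : ℕ → Subgroup G := fun w => (⊤ : Subgroup G).lowerCentralSeries (w - 1) with hDdef
  have hlift : ∀ (i : ℕ) (hi : i < c + 1) (ℓ : List G), (∀ x ∈ ℓ, x ∈ U i) →
      ∃ ℓ' : List Λ, (∀ a ∈ ℓ', wt a = i + 1) ∧ (ℓ'.map val).prod = ℓ.prod := by
    intro i hi ℓ
    induction ℓ with
    | nil => intro _; exact ⟨[], by simp⟩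
    | cons x ℓ ih =>
      intro h
      obtain ⟨ℓ', h1, h2⟩ := ih fun y hy => h y (by simp [hy])
      refine ⟨⟨⟨i, hi⟩, x, by simpa using h x (by simp)⟩ :: ℓ', ?_, by simp [h2, val]⟩
      intro a ha
      rcases List.mem_cons.1 ha with rfl | ha
      · rfl
      · exact h1 a ha
  have hΛ : IsWeightedAlphabet D wt val :=
    { wt_pos := fun a => by simp [wt]
      val_mem := fun a => by
        have := hU a.1 a.2.1 (List.mem_toFinset.1 a.2.2)
        simpa [D, wt, val] using this
      exists_word := by
        intro w hw g hg
        rcases lt_or_ge (w - 1) (c + 1) with h | h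
        · obtain ⟨ℓ, h1, h2⟩ := hUw (w - 1) g hg
          obtain ⟨ℓ', h3, h4⟩ := hlift (w - 1) h ℓ h1
          exact ⟨ℓ', fun a ha => by rw [h3 a ha]; omega, h4.trans h2⟩
        · refine ⟨[], by simp, ?_⟩
          have h1 := Subgroup.lowerCentralSeries_antitone (⊤ : Subgroup G) h hg
          rw [hbot, Subgroup.mem_bot] at h1
          simp [h1] }
  obtain ⟨C, hC, hred⟩ := exists_reduce hD hΛ c
  refine ⟨U c, hU c, fun A hA => ?_⟩
  have hw1 : ∀ g : G, ∃ ℓ : List Λ, (∀ a ∈ ℓ, wt a = 1) ∧ (ℓ.map val).prod = g := fun g =>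
    hΛ.exists_word 1 le_rfl g trivial
  choose f hf1 hf2 using hw1
  obtain ⟨k, hk⟩ := (hA.image fun g => (f g).length).bddAbove
  refine ⟨C * (k + 1), Nat.mul_pos hC (by omega), fun n hn g hg hgc => ?_⟩
  obtain ⟨ℓ, h1, h2, h3⟩ := exists_list_of_mem_pow hg
  have hlist : ∀ ℓ : List G, (∀ x ∈ ℓ, x ∈ A) → (ℓ.flatMap f).length ≤ k * ℓ.length ∧
      ((ℓ.flatMap f).map val).prod = ℓ.prod := by
    intro ℓ
    induction ℓ with
    | nil => intro _; simp
    | cons x ℓ ih =>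
      intro h
      obtain ⟨i1, i2⟩ := ih fun y hy => h y (by simp [hy])
      have := hk ⟨x, h x (by simp), rfl⟩
      simp only at this
      rw [List.flatMap_cons, List.length_append, List.map_append, List.prod_append, hf2, i2,
        List.length_cons, List.prod_cons, mul_add]
      exact ⟨by omega, rfl⟩
  obtain ⟨i1, i2⟩ := hlist ℓ h1
  rw [h2] at i2
  rw [h3] at i1
  obtain ⟨ℓ', j1, j2, j3⟩ := hred ((k + 1) * n) (ℓ.flatMap f) (Nat.mul_pos (by omega) hn) (by
    intro j
    rcases Nat.eq_zero_or_pos j with rfl | hj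
    · rw [lightCount_eq_zero fun b _ => hΛ.wt_pos b]
      exact Nat.zero_le _
    · refine (lightCount_le_length _ _).trans (i1.trans (le_trans ?_ (Nat.le_self_pow hj.ne' _)))
      gcongr
      omega) (by rw [i2]; exact hgc)
  refine ⟨ℓ'.map val, ?_, j2.trans i2, ?_⟩
  · intro x hx
    obtain ⟨a, ha, rfl⟩ := List.mem_map.1 hx
    have h4 := j1 a ha
    have h5 : (a.1 : ℕ) = c := by
      have := a.1.2
      simp only [wt] at h4
      omega
    exact (congrArg (fun i => val a ∈ U i) h5).mp (List.mem_toFinset.1 a.2.2)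
  · have h4 := j3 (c + 1)
    rw [List.length_map, mul_assoc]
    refine le_trans (le_of_eq ?_) h4
    symm
    rw [lightCount, List.countP_eq_length]
    intro a _
    have := a.1.2
    simp only [wt, decide_eq_true_eq]
    omega

/-- The set of products of powers `t ^ i`, `i ≤ m`, over a list of elements `t`. -/
def powerBox (m : ℕ) : List G → Set G
  | [] => 1
  | t :: ts => ((fun i => t ^ i) '' Set.Iic m) * powerBox m ts

theorem finite_powerBox (m : ℕ) (ts : List G) : (powerBox m ts).Finite := by
  induction ts with
  | nil => exact Set.finite_one
  | cons t ts ih => exact ((Set.finite_Iic m).image _).mul ih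

theorem one_mem_powerBox (m : ℕ) (ts : List G) : (1 : G) ∈ powerBox m ts := by
  induction ts with
  | nil => exact Set.one_mem_one
  | cons t ts ih => exact ⟨1, ⟨0, by simp, by simp⟩, 1, ih, by simp⟩

theorem powerBox_mono {m n : ℕ} (h : m ≤ n) (ts : List G) : powerBox m ts ⊆ powerBox n ts := by
  induction ts with
  | nil => exact le_rfl
  | cons t ts ih => exact Set.mul_subset_mul (Set.image_mono (Set.Iic_subset_Iic.2 h)) ih

theorem prod_mem_powerBox {ts : List G} (hts : ∀ t ∈ ts, t ∈ Subgroup.center G) (ℓ : List G)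
    (hℓ : ∀ x ∈ ℓ, x ∈ ts) : ℓ.prod ∈ powerBox ℓ.length ts := by
  have key : ∀ (ts : List G) (x : G) (m : ℕ) (g : G), (∀ t ∈ ts, t ∈ Subgroup.center G) → x ∈ ts →
      g ∈ powerBox m ts → x * g ∈ powerBox (m + 1) ts := by
    intro ts x m
    induction ts with
    | nil => intro g _ h; simp at h
    | cons t ts ih =>
      rintro _ hc hx ⟨_, ⟨i, hi, rfl⟩, b, hb, rfl⟩
      simp only
      rcases List.mem_cons.1 hx with rfl | hx
      · refine ⟨_, ⟨i + 1, Set.mem_Iic.2 (Nat.succ_le_succ hi), rfl⟩, b,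
          powerBox_mono (Nat.le_succ m) _ hb, ?_⟩
        simp only
        rw [pow_succ', mul_assoc]
      · refine ⟨_, ⟨i, Set.mem_Iic.2 (le_trans hi (Nat.le_succ m)), rfl⟩, x * b,
          ih b (fun t ht => hc t (by simp [ht])) hx hb, ?_⟩
        simp only
        rw [← mul_assoc, ← mul_assoc, Subgroup.mem_center_iff.1 (hc x (by simp [hx])) (t ^ i)]
  induction ℓ with
  | nil => exact one_mem_powerBox _ _
  | cons x ℓ ih =>
    rw [List.prod_cons, List.length_cons]
    exact key ts x _ _ hts (hℓ x (by simp)) (ih fun y hy => hℓ y (by simp [hy]))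

theorem exists_ncard_powerBox_mul_le {ts : List G} (hts : ∀ t ∈ ts, t ∈ Subgroup.center G) (q : ℕ) :
    ∃ K : ℕ, ∀ m, (powerBox (q * m) ts).ncard ≤ K * (powerBox m ts).ncard := by
  have key : ∃ K : ℕ, ∀ m, ∃ X : Set G, X.Finite ∧ X.ncard ≤ K ∧
      powerBox (q * m) ts ⊆ X * powerBox m ts := by
    induction ts with
    | nil => exact ⟨1, fun m =>
        ⟨1, Set.finite_one, (Set.ncard_singleton (1 : G)).le, by simp [powerBox]⟩⟩
    | cons t ts ih =>
      obtain ⟨K, hK⟩ := ih fun t ht => hts t (by simp [ht])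
      refine ⟨(q + 1) * K, fun m => ?_⟩
      obtain ⟨X, hX, hXK, hsub⟩ := hK m
      refine ⟨((fun i => (t ^ m) ^ i) '' Set.Iic q) * X, ((Set.finite_Iic q).image _).mul hX, ?_, ?_⟩
      · refine (Set.natCard_mul_le).trans (Nat.mul_le_mul ?_ hXK)
        refine (Set.ncard_image_le (Set.finite_Iic q)).trans ?_
        rw [← Finset.coe_Iic, Set.ncard_coe_finset, Nat.card_Iic]
      · rintro _ ⟨_, ⟨i, hi, rfl⟩, b, hb, rfl⟩
        obtain ⟨x, hx, b', hb', rfl⟩ := hsub hb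
        have hi : i ≤ q * m := hi
        refine ⟨(t ^ m) ^ (i / m) * x, ⟨_, ⟨i / m, ?_, rfl⟩, x, hx, rfl⟩, t ^ (i % m) * b',
          ⟨_, ⟨i % m, ?_, rfl⟩, b', hb', rfl⟩, ?_⟩
        · exact Set.mem_Iic.2 (Nat.div_le_of_le_mul (by rwa [mul_comm] at hi))
        · rw [Set.mem_Iic]
          rcases Nat.eq_zero_or_pos m with rfl | hm
          · simpa using hi
          · exact (Nat.mod_lt _ hm).le
        · simp only
          have hc : t ^ (i % m) ∈ Subgroup.center G := pow_mem (hts t (by simp)) _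
          rw [mul_assoc, ← mul_assoc x, Subgroup.mem_center_iff.1 hc x, ← mul_assoc, ← mul_assoc,
            ← pow_mul, ← pow_add, Nat.div_add_mod, mul_assoc]
  obtain ⟨K, hK⟩ := key
  refine ⟨K, fun m => ?_⟩
  obtain ⟨X, hX, hXK, hsub⟩ := hK m
  calc _ ≤ (X * powerBox m ts).ncard := Set.ncard_le_ncard hsub (hX.mul (finite_powerBox _ _))
    _ ≤ X.ncard * (powerBox m ts).ncard := Set.natCard_mul_le
    _ ≤ _ := by gcongr

end Nilpotent

section Nilpotent

variable {G : Type*} [Group G]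

theorem commutatorElement_pow_right_of_mem_center {x y : G}
    (h : ⁅x, y⁆ ∈ Subgroup.center G) (b : ℕ) : ⁅x, y ^ b⁆ = ⁅x, y⁆ ^ b := by
  induction b with
  | zero => simp
  | succ b ih =>
    rw [pow_succ, commutatorElement_mul_right_eq_mul_conj, ih, mul_assoc (⁅x, y⁆ ^ b),
      Subgroup.mem_center_iff.1 h (y ^ b), ← mul_assoc, mul_inv_cancel_right, pow_succ]

theorem commutatorElement_pow_left_of_mem_center {x y : G}
    (h : ⁅x, y⁆ ∈ Subgroup.center G) (a : ℕ) : ⁅x ^ a, y⁆ = ⁅x, y⁆ ^ a := by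
  have h' : ⁅y, x⁆ ∈ Subgroup.center G := by rw [← commutatorElement_inv]; exact inv_mem h
  rw [← commutatorElement_inv, commutatorElement_pow_right_of_mem_center h', ← inv_pow,
    commutatorElement_inv]

theorem commutatorElement_mul_left_of_mem_center {x y z : G} (h : z ∈ Subgroup.center G) :
    ⁅x * z, y⁆ = ⁅x, y⁆ := by
  have h1 : ⁅z, y⁆ = 1 :=
    commutatorElement_eq_one_iff_mul_comm.2 (Subgroup.mem_center_iff.1 h y).symm
  rw [commutatorElement_mul_left_eq_conj_mul, h1, mul_one, mul_inv_cancel, one_mul]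

theorem IsSymmGen.commutator_mem_pow {T : Set G} (hT : IsSymmGen T) {m n : ℕ} {x y : G}
    (hx : x ∈ T ^ m) (hy : y ∈ T ^ n) : ⁅x, y⁆ ∈ T ^ (2 * m + 2 * n) := by
  rw [commutatorElement_def, show 2 * m + 2 * n = m + n + m + n by ring]
  exact IsSymmGen.mul_mem_pow (IsSymmGen.mul_mem_pow (IsSymmGen.mul_mem_pow hx hy)
    (hT.inv_mem_pow hx)) (hT.inv_mem_pow hy)

theorem IsSymmGen.pow_mem_pow {T : Set G} {m : ℕ} {x : G}
    (hx : x ∈ T ^ m) (n : ℕ) : x ^ n ∈ T ^ (m * n) := by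
  rw [pow_mul]; exact Set.pow_mem_pow hx

/-- Large powers of elements deep in the lower central series have small word length,
modulo the next term. -/
theorem exists_distorted_power {T : Set G} (hT : IsSymmGen T) (i : ℕ) :
    ∀ g ∈ (⊤ : Subgroup G).lowerCentralSeries i, ∃ C : ℕ, ∀ n a, 1 ≤ n → a ≤ n ^ (i + 1) →
      ∃ h ∈ T ^ (C * n), h⁻¹ * g ^ a ∈ (⊤ : Subgroup G).lowerCentralSeries (i + 1) := by
  induction i with
  | zero =>
    intro g _
    obtain ⟨k, hk⟩ := hT.exists_mem_pow g
    refine ⟨k, fun n a _ ha => ⟨g ^ a, hT.pow_mono ?_ (IsSymmGen.pow_mem_pow hk a), by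
      simp [one_mem]⟩⟩
    rw [zero_add, pow_one] at ha
    gcongr
  | succ i ih =>
    set N := (⊤ : Subgroup G).lowerCentralSeries (i + 1 + 1) with hN
    set π := QuotientGroup.mk' N with hπ
    have hcen : ∀ z ∈ (⊤ : Subgroup G).lowerCentralSeries (i + 1),
        π z ∈ Subgroup.center (G ⧸ N) := by
      intro z hz
      rw [Subgroup.mem_center_iff]
      intro y
      obtain ⟨y, rfl⟩ := QuotientGroup.mk'_surjective N y
      rw [eq_comm, ← commutatorElement_eq_one_iff_mul_comm, ← map_commutatorElement]
      refine (QuotientGroup.eq_one_iff _).2 ?_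
      exact Subgroup.commutator_mem_commutator hz trivial
    have heq : ∀ h g : G, h⁻¹ * g ∈ N ↔ π h = π g := fun h g => QuotientGroup.eq.symm
    simp only [heq]
    intro g hg
    have hg' := hg
    rw [Subgroup.lowerCentralSeries_succ, Subgroup.commutator_def] at hg
    induction hg using Subgroup.closure_induction with
    | mem g hg =>
      obtain ⟨x, hx, y, -, rfl⟩ := hg
      obtain ⟨C, hC⟩ := ih x hx
      obtain ⟨k, hk⟩ := hT.exists_mem_pow y
      refine ⟨4 * C + 4 * k, fun n a hn ha => ?_⟩
      have hm : 0 < n ^ (i + 1) := Nat.pow_pos hn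
      have hq : a / n ^ (i + 1) ≤ n := Nat.div_le_of_le_mul (by rwa [pow_succ] at ha)
      set q := a / n ^ (i + 1) with hqdef
      set r := a % n ^ (i + 1) with hrdef
      have hqr : a = n ^ (i + 1) * q + r := (Nat.div_add_mod _ _).symm
      obtain ⟨h₁, h₁m, h₁N⟩ := hC n (n ^ (i + 1)) hn le_rfl
      obtain ⟨h₂, h₂m, h₂N⟩ := hC n r hn (Nat.mod_lt _ hm).le
      refine ⟨⁅h₁, y ^ q⁆ * ⁅h₂, y⁆, ?_, ?_⟩
      · have e1 := hT.commutator_mem_pow h₁m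
          (hT.pow_mono (Nat.mul_le_mul_left k hq) (IsSymmGen.pow_mem_pow hk q))
        have e2 := hT.commutator_mem_pow h₂m (hT.pow_mono (Nat.le_mul_of_pos_right k hn) hk)
        have e3 := IsSymmGen.mul_mem_pow e1 e2
        rwa [show 2 * (C * n) + 2 * (k * n) + (2 * (C * n) + 2 * (k * n)) =
          (4 * C + 4 * k) * n by ring] at e3
      · have hxy : ⁅π x, π y⁆ ∈ Subgroup.center (G ⧸ N) := by
          rw [← map_commutatorElement]; exact hcen _ hg'
        have hrepl : ∀ (h : G) (b : ℕ) (z : G), h⁻¹ * x ^ b ∈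
            (⊤ : Subgroup G).lowerCentralSeries (i + 1) → ⁅π x ^ b, π z⁆ = ⁅π h, π z⁆ := by
          intro h b z hb
          rw [← commutatorElement_mul_left_of_mem_center (x := π h) (hcen _ hb), ← map_mul,
            mul_inv_cancel_left, map_pow]
        have hxyq : ⁅π x, π y ^ q⁆ = ⁅π x, π y⁆ ^ q :=
          commutatorElement_pow_right_of_mem_center hxy q
        rw [map_mul, map_commutatorElement, map_commutatorElement, ← hrepl h₁ _ _ h₁N,
          ← hrepl h₂ _ _ h₂N, map_pow, map_pow, map_commutatorElement,
          commutatorElement_pow_left_of_mem_center (by rw [hxyq]; exact pow_mem hxy q), hxyq,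
          commutatorElement_pow_left_of_mem_center hxy, ← pow_mul, ← pow_add]
        congr 1
        rw [hqr]; ring
    | one => exact ⟨0, fun n a _ _ => ⟨1, by simp, by simp⟩⟩
    | mul x y hx hy ihx ihy =>
      obtain ⟨C, hC⟩ := ihx hx
      obtain ⟨C', hC'⟩ := ihy hy
      refine ⟨C + C', fun n a hn ha => ?_⟩
      obtain ⟨h₁, h₁m, h₁N⟩ := hC n a hn ha
      obtain ⟨h₂, h₂m, h₂N⟩ := hC' n a hn ha
      refine ⟨h₁ * h₂, by rw [add_mul]; exact IsSymmGen.mul_mem_pow h₁m h₂m, ?_⟩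
      have hcomm : Commute (π x) (π y) := (Subgroup.mem_center_iff.1 (hcen x hx) (π y)).symm
      rw [map_mul, h₁N, h₂N, map_pow, map_pow, map_pow, map_mul, hcomm.mul_pow]
    | inv x hx ihx =>
      obtain ⟨C, hC⟩ := ihx hx
      refine ⟨C, fun n a hn ha => ?_⟩
      obtain ⟨h, hm, hN⟩ := hC n a hn ha
      exact ⟨h⁻¹, hT.inv_mem_pow hm, by rw [map_inv, hN, ← map_inv, inv_pow]⟩

/-- Boxes of side `n ^ (c + 1)` in the last term of the lower central series are contained in
balls of radius `O(n)`. -/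
theorem exists_powerBox_subset_pow {T : Set G} (hT : IsSymmGen T) {c : ℕ}
    (hbot : (⊤ : Subgroup G).lowerCentralSeries (c + 1) = ⊥) (ts : List G)
    (hts : ∀ t ∈ ts, t ∈ (⊤ : Subgroup G).lowerCentralSeries c) :
    ∃ C : ℕ, ∀ n, 1 ≤ n → powerBox (n ^ (c + 1)) ts ⊆ T ^ (C * n) := by
  induction ts with
  | nil => exact ⟨0, fun n _ => by simp [powerBox]⟩
  | cons t ts ih =>
    obtain ⟨C, hC⟩ := ih fun x hx => hts x (by simp [hx])
    obtain ⟨C', hC'⟩ := exists_distorted_power hT c t (hts t (by simp))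
    refine ⟨C' + C, fun n hn => ?_⟩
    rintro _ ⟨_, ⟨a, ha, rfl⟩, b, hb, rfl⟩
    rw [add_mul]
    refine IsSymmGen.mul_mem_pow ?_ (hC n hn hb)
    obtain ⟨h, hm, hN⟩ := hC' n a hn ha
    rw [hbot, Subgroup.mem_bot, inv_mul_eq_one] at hN
    simp only
    rwa [← hN]

end Nilpotent

section Doubling

variable {G : Type*} [Group G]

theorem IsSymmGen.ncard_pow_le_mul {Q : Type*} [Group Q] {T : Set G} (hT : IsSymmGen T)
    (f : G →* Q) (n : ℕ) :
    (T ^ n).ncard ≤ ((f '' T) ^ n).ncard * (T ^ (2 * n) ∩ f.ker).ncard := by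
  classical
  rw [← Set.image_pow, ← Set.ncard_prod]
  have hs : ∀ q : Q, ∃ x, q ∈ f '' (T ^ n) → x ∈ T ^ n ∧ f x = q := by
    intro q
    by_cases hq : q ∈ f '' (T ^ n)
    · obtain ⟨x, hx, hxq⟩ := hq
      exact ⟨x, fun _ => ⟨hx, hxq⟩⟩
    · exact ⟨1, fun h => absurd h hq⟩
  choose s hs using hs
  refine Set.ncard_le_ncard_of_injOn (fun x => (f x, (s (f x))⁻¹ * x)) ?_ ?_
    (((hT.finite_pow n).image f).prod ((hT.finite_pow _).inter_of_left _))
  · intro x hx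
    obtain ⟨h1, h2⟩ := hs (f x) ⟨x, hx, rfl⟩
    refine ⟨⟨x, hx, rfl⟩, ?_, ?_⟩
    · rw [two_mul]
      exact IsSymmGen.mul_mem_pow (hT.inv_mem_pow h1) hx
    · rw [SetLike.mem_coe, MonoidHom.mem_ker, map_mul, map_inv, h2, inv_mul_cancel]
  · intro x _ y _ hxy
    simp only [Prod.mk.injEq] at hxy
    rw [hxy.1] at hxy
    exact mul_left_cancel hxy.2

theorem IsSymmGen.mul_le_ncard_pow {Q : Type*} [Group Q] {T : Set G} (hT : IsSymmGen T)
    (f : G →* Q) (n m : ℕ) :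
    ((f '' T) ^ n).ncard * (T ^ m ∩ f.ker).ncard ≤ (T ^ (n + m)).ncard := by
  classical
  rw [← Set.image_pow, ← Set.ncard_prod]
  have hs : ∀ q : Q, ∃ x, q ∈ f '' (T ^ n) → x ∈ T ^ n ∧ f x = q := by
    intro q
    by_cases hq : q ∈ f '' (T ^ n)
    · obtain ⟨x, hx, hxq⟩ := hq
      exact ⟨x, fun _ => ⟨hx, hxq⟩⟩
    · exact ⟨1, fun h => absurd h hq⟩
  choose s hs using hs
  refine Set.ncard_le_ncard_of_injOn (fun p => s p.1 * p.2) ?_ ?_ (hT.finite_pow _)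
  · rintro ⟨q, z⟩ ⟨hq, hz⟩
    exact IsSymmGen.mul_mem_pow (hs q hq).1 hz.1
  · rintro ⟨q, z⟩ ⟨hq, hz⟩ ⟨q', z'⟩ ⟨hq', hz'⟩ h
    simp only at h hq hq' hz hz'
    have hf : ∀ q ∈ f '' (T ^ n), ∀ z ∈ T ^ m ∩ f.ker, f (s q * z) = q := by
      intro q hq z hz
      rw [map_mul, (hs q hq).2, MonoidHom.mem_ker.1 hz.2, mul_one]
    have h1 : q = q' := by rw [← hf q hq z hz, h, hf q' hq' z' hz']
    subst h1
    rw [mul_left_cancel h]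

theorem hasDoubling_of_lowerCentralSeries_eq_bot (c : ℕ) : ∀ (G : Type u) [Group G],
    (∀ L : Subgroup G, L.FG) → (⊤ : Subgroup G).lowerCentralSeries c = ⊥ → HasDoubling G := by
  induction c with
  | zero =>
    intro G _ _ hbot A _ T hT
    rw [Subgroup.lowerCentralSeries_zero] at hbot
    have h1 : ∀ g : G, g = 1 := fun g =>
      Subgroup.mem_bot.1 (hbot ▸ Subgroup.mem_top g)
    refine ⟨1, fun n => ?_⟩
    rw [one_mul]
    exact Set.ncard_le_ncard (fun x _ => h1 x ▸ hT.one_mem_pow n) (hT.finite_pow n)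
  | succ c ih =>
    intro G _ hfg hbot A hA T hT
    set Z := (⊤ : Subgroup G).lowerCentralSeries c with hZ
    set π := QuotientGroup.mk' Z with hπ
    have hsurj : Function.Surjective π := QuotientGroup.mk'_surjective Z
    have hker : π.ker = Z := QuotientGroup.ker_mk' Z
    have hQ : HasDoubling (G ⧸ Z) := by
      refine ih _ (fun L => ?_) ?_
      · rw [← Subgroup.map_comap_eq_self_of_surjective hsurj L]
        obtain ⟨S, hS⟩ := hfg (L.comap π)
        classical
        exact ⟨S.image π, by rw [Finset.coe_image, ← MonoidHom.map_closure, hS]⟩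
      · rw [← Subgroup.map_top_of_surjective π hsurj, ← Subgroup.map_lowerCentralSeries,
          Subgroup.map_eq_bot_iff, hker]
    have hTbar := hT.image_of_surjective π hsurj
    obtain ⟨ts, hts, hup⟩ := exists_short_word_lowerCentralSeries hfg hbot
    obtain ⟨C, hC, hup⟩ := hup T hT.finite
    obtain ⟨D, hD⟩ := exists_powerBox_subset_pow hT hbot ts hts
    obtain ⟨k, hk⟩ := hT.exists_pow_subset_pow hA
    have htsc : ∀ t ∈ ts, t ∈ Subgroup.center G := by
      intro t ht
      refine Subgroup.commutator_top_right_eq_bot_iff_le_center.1 ?_ (hts t ht)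
      rw [← hbot, Subgroup.lowerCentralSeries_succ]
    have hboxZ : ∀ m, powerBox m ts ⊆ Z := by
      intro m
      have : ∀ us : List G, (∀ t ∈ us, t ∈ Z) → powerBox m us ⊆ Z := by
        intro us
        induction us with
        | nil => intro _; simp [powerBox]
        | cons t us ihu =>
          rintro h _ ⟨_, ⟨i, -, rfl⟩, b, hb, rfl⟩
          exact mul_mem (pow_mem (h t (by simp)) i) (ihu (fun x hx => h x (by simp [hx])) hb)
      exact this ts hts
    obtain ⟨K₁, hK₁⟩ := hQ ((π '' T) ^ (4 * (k + 1) * (D + 1)))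
      (hTbar.finite_pow _) _ hTbar
    obtain ⟨K₂, hK₂⟩ := exists_ncard_powerBox_mul_le htsc
      ((C * (2 * (4 * (k + 1) * (D + 1)))) ^ (c + 1))
    refine ⟨K₁ * K₂ + (T ^ (k * (2 * (D + 1)))).ncard, fun n => ?_⟩
    rw [add_mul]
    rcases lt_or_ge n (2 * (D + 1)) with hn | hn
    · refine le_trans ?_ (Nat.le_add_left _ _)
      refine le_trans ?_ (Nat.le_mul_of_pos_right _ (hT.ncard_pow_pos n))
      refine (Set.ncard_le_ncard (hk n) (hT.finite_pow _)).trans (hT.ncard_pow_mono ?_)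
      gcongr
    refine le_trans ?_ (Nat.le_add_right _ _)
    set m := n / (2 * (D + 1)) with hm
    have hm1 : 1 ≤ m := (Nat.one_le_div_iff (by omega)).2 hn
    have hnm : 2 * (D + 1) * m ≤ n := Nat.mul_div_le _ _
    have hnm' : n ≤ 4 * (D + 1) * m := by
      have := Nat.lt_mul_div_succ n (show 0 < 2 * (D + 1) by omega)
      rw [← hm] at this
      nlinarith
    set N := 4 * (k + 1) * (D + 1) * m with hN
    have hN1 : 1 ≤ 2 * N := by
      have : 0 < N := by positivity
      omega
    have hfib : T ^ (2 * N) ∩ π.ker ⊆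
        powerBox ((C * (2 * (4 * (k + 1) * (D + 1)))) ^ (c + 1) * m ^ (c + 1)) ts := by
      rintro g ⟨hg, hgk⟩
      rw [SetLike.mem_coe, hker] at hgk
      obtain ⟨ℓ, h1, h2, h3⟩ := hup _ hN1 g hg hgk
      rw [← h2, ← mul_pow]
      refine powerBox_mono (h3.trans (le_of_eq ?_)) ts (prod_mem_powerBox htsc ℓ h1)
      congr 1
      rw [hN]; ring
    have hbox : powerBox (m ^ (c + 1)) ts ⊆ T ^ (D * m) ∩ π.ker := by
      refine Set.subset_inter (hD m hm1) ?_
      rw [hker]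
      exact hboxZ _
    calc (A ^ n).ncard ≤ (T ^ N).ncard :=
          (Set.ncard_le_ncard (hk n) (hT.finite_pow _)).trans (hT.ncard_pow_mono (by
            calc k * n ≤ (k + 1) * (4 * (D + 1) * m) := by gcongr; omega
              _ = N := by rw [hN]; ring))
      _ ≤ ((π '' T) ^ N).ncard * (T ^ (2 * N) ∩ π.ker).ncard := hT.ncard_pow_le_mul π N
      _ ≤ (K₁ * ((π '' T) ^ m).ncard) * (K₂ * (T ^ (D * m) ∩ π.ker).ncard) := by
          refine Nat.mul_le_mul ?_ ?_
          · rw [hN, pow_mul]; exact hK₁ m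
          · refine (Set.ncard_le_ncard hfib (finite_powerBox _ _)).trans ((hK₂ _).trans ?_)
            gcongr
            exact (hT.finite_pow _).inter_of_left _
      _ = K₁ * K₂ * (((π '' T) ^ m).ncard * (T ^ (D * m) ∩ π.ker).ncard) := by ring
      _ ≤ K₁ * K₂ * (T ^ (m + D * m)).ncard := by
          gcongr
          exact hT.mul_le_ncard_pow π m _
      _ ≤ K₁ * K₂ * (T ^ n).ncard :=
          Nat.mul_le_mul_left _ (hT.ncard_pow_mono (by nlinarith))

end Doubling

section Doubling

variable {G : Type u} [Group G]

theorem HasDoubling.of_finiteIndex {N : Subgroup G} [hN : N.FiniteIndex] [Group.FG N]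
    (h : HasDoubling N) : HasDoubling G := by
  intro A hA T hT
  obtain ⟨T', hT'⟩ := IsSymmGen.exists_of_fg N
  -- a right transversal
  let s : Quotient (QuotientGroup.rightRel N) → G := Quotient.out
  have : Finite (Quotient (QuotientGroup.rightRel N)) :=
    (QuotientGroup.quotientRightRelEquivQuotientLeftRel N).finite_iff.2 inferInstance
  set X : Set G := insert 1 (Set.range s) with hX
  have hXf : X.Finite := (Set.finite_range s).insert 1
  have hdec : ∀ g : G, ∃ x ∈ X, g * x⁻¹ ∈ N := by
    intro g
    refine ⟨s (Quotient.mk'' g), Set.mem_insert_of_mem _ ⟨_, rfl⟩, ?_⟩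
    have h1 : Quotient.mk'' (s (Quotient.mk'' g)) = (Quotient.mk'' g : Quotient _) :=
      Quotient.out_eq' _
    exact QuotientGroup.rightRel_apply.1 (Quotient.exact' h1)
  set B : Set G := X * A * X⁻¹ with hB
  have hBf : B.Finite := (hXf.mul hA).mul hXf.inv
  set A' : Set N := Subtype.val ⁻¹' B with hA'
  have hA'f : A'.Finite := hBf.preimage Subtype.val_injective.injOn
  have hsub : ∀ n, ∀ x ∈ X, ∀ g ∈ A ^ n, ∃ ν ∈ A' ^ n, ∃ x' ∈ X, x * g = ν * x' := by
    intro n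
    induction n with
    | zero =>
      intro x hx g hg
      rw [pow_zero, Set.mem_one] at hg
      exact ⟨1, by simp, x, hx, by simp [hg]⟩
    | succ n ih =>
      intro x hx g hg
      rw [pow_succ'] at hg
      obtain ⟨a, ha, g, hg, rfl⟩ := hg
      obtain ⟨y, hy, hyN⟩ := hdec (x * a)
      obtain ⟨ν, hν, x', hx', he⟩ := ih y hy g hg
      refine ⟨⟨_, hyN⟩ * ν, ?_, x', hx', ?_⟩
      · rw [pow_succ']
        exact Set.mul_mem_mul (Set.mul_mem_mul (Set.mul_mem_mul hx ha) (Set.inv_mem_inv.2 hy)) hν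
      · rw [Subgroup.coe_mul, mul_assoc, ← he]
        group
  have hcard : ∀ n, (A ^ n).ncard ≤ (A' ^ n).ncard * X.ncard := by
    intro n
    have h1 : A ^ n ⊆ (Subtype.val '' (A' ^ n)) * X := by
      intro g hg
      obtain ⟨ν, hν, x, hx, he⟩ := hsub n 1 (Set.mem_insert _ _) g hg
      rw [one_mul] at he
      exact ⟨ν, ⟨ν, hν, rfl⟩, x, hx, he.symm⟩
    refine (Set.ncard_le_ncard h1 (((set_finite_pow hA'f n).image _).mul hXf)).trans ?_
    refine Set.natCard_mul_le.trans ?_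
    exact Nat.mul_le_mul_right _ (Set.ncard_image_le (set_finite_pow hA'f n))
  obtain ⟨k, hk⟩ := hT.exists_pow_subset_pow (hT'.finite.image Subtype.val)
  have hT'T : ∀ m, (T' ^ m).ncard ≤ (T ^ (k * m)).ncard := by
    intro m
    rw [← Set.ncard_image_of_injective (T' ^ m) Subtype.val_injective]
    refine Set.ncard_le_ncard ?_ (hT.finite_pow _)
    have : Subtype.val '' (T' ^ m) = (Subtype.val '' T') ^ m := Set.image_pow N.subtype T' m
    rw [this]
    exact hk m
  obtain ⟨T'', hT''⟩ : ∃ T'' : Set N, IsSymmGen T'' ∧ A' ⊆ T'' ∧ T''.Finite := by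
    obtain ⟨j, hj⟩ := hT'.exists_subset_pow hA'f
    exact ⟨T' ^ (j + 1), hT'.pow_of_pos (by omega), hj.trans (hT'.pow_mono (by omega)),
      hT'.finite_pow _⟩
  obtain ⟨K, hK⟩ := h (T'' ^ (2 * (k + 1))) (set_finite_pow hT''.2.2 _) T' hT'
  refine ⟨K * X.ncard + (T'' ^ (k + 1)).ncard * X.ncard, fun n => ?_⟩
  have hAT : (A' ^ n).ncard ≤ (T'' ^ n).ncard :=
    Set.ncard_le_ncard (Set.pow_subset_pow_left hT''.2.1) (set_finite_pow hT''.2.2 _)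
  rw [add_mul]
  rcases lt_or_ge n (k + 1) with hn | hn
  · refine le_trans ?_ (Nat.le_add_left _ _)
    refine le_trans ?_ (Nat.le_mul_of_pos_right _ (hT.ncard_pow_pos n))
    exact (hcard n).trans (Nat.mul_le_mul_right _ (hAT.trans (hT''.1.ncard_pow_mono hn.le)))
  · refine le_trans ?_ (Nat.le_add_right _ _)
    set m := n / (k + 1) with hm
    have hm1 : 1 ≤ m := (Nat.one_le_div_iff (by omega)).2 hn
    have hnm : (k + 1) * m ≤ n := Nat.mul_div_le _ _
    have hnm' : n ≤ 2 * (k + 1) * m := by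
      have := Nat.lt_mul_div_succ n (show 0 < k + 1 by omega)
      rw [← hm] at this
      nlinarith
    have h1 : (A' ^ n).ncard ≤ K * (T ^ n).ncard := by
      calc (A' ^ n).ncard ≤ (T'' ^ (2 * (k + 1) * m)).ncard :=
            hAT.trans (hT''.1.ncard_pow_mono hnm')
        _ ≤ K * (T' ^ m).ncard := by rw [pow_mul]; exact hK m
        _ ≤ K * (T ^ n).ncard := Nat.mul_le_mul_left _
            ((hT'T m).trans (hT.ncard_pow_mono (by nlinarith)))
    calc (A ^ n).ncard ≤ K * (T ^ n).ncard * X.ncard :=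
          (hcard n).trans (Nat.mul_le_mul_right _ h1)
      _ = _ := by ring

/-- Groups of polynomial growth are doubling. -/
theorem HasGrowth.hasDoubling [Group.FG G] {d : ℕ} (hG : HasGrowth d G) : HasDoubling G := by
  obtain ⟨hfg, N, hN, hNn⟩ := exists_finiteIndex_isNilpotent d G hG
  have hNfg : ∀ L : Subgroup N, L.FG := by
    intro L
    have := (Group.fg_iff_subgroup_fg _).2 (hfg (L.map N.subtype))
    exact (Group.fg_iff_subgroup_fg _).1 (Group.fg_of_surjective
      (f := (L.equivMapOfInjective N.subtype N.subtype_injective).symm.toMonoidHom)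
      (MulEquiv.surjective _))
  have : Group.FG N := (Group.fg_iff_subgroup_fg _).2 (hfg N)
  obtain ⟨c, hc⟩ := Subgroup.nilpotent_iff_lowerCentralSeries.1 hNn
  exact (hasDoubling_of_lowerCentralSeries_eq_bot c N hNfg hc).of_finiteIndex

end Doubling

section Balls

variable {Γ : Type*} {d : Γ → Γ → ℕ} {B : Γ → ℕ → Finset Γ} {v : ℕ → ℕ}

/-- A discrete length metric all of whose balls of radius `r` have the same cardinality `v r`. -/
structure IsBallSystem (d : Γ → Γ → ℕ) (B : Γ → ℕ → Finset Γ) (v : ℕ → ℕ) : Prop where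
  eq_iff : ∀ x y, d x y = 0 ↔ x = y
  symm : ∀ x y, d x y = d y x
  triangle : ∀ x y z, d x z ≤ d x y + d y z
  geodesic : ∀ x y a, a ≤ d x y → ∃ z, d x z = a ∧ d z y = d x y - a
  mem : ∀ g r y, y ∈ B g r ↔ d g y ≤ r
  card : ∀ g r, (B g r).card = v r

/-- A finite family of sets has a disjoint subfamily such that every member meets a chosen one
which is at least as large. -/
theorem exists_disjoint_subfamily {ι α : Type*} [DecidableEq α] (b : ι → Finset α)
    (hb : ∀ i, (b i).Nonempty) (r : ι → ℕ) (I : Finset ι) :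
    ∃ A ⊆ I, (A : Set ι).PairwiseDisjoint b ∧
      ∀ i ∈ I, ∃ a ∈ A, r i ≤ r a ∧ ¬ Disjoint (b i) (b a) := by
  classical
  induction I using Finset.strongInduction with
  | H I ih =>
    rcases I.eq_empty_or_nonempty with rfl | hI
    · exact ⟨∅, by simp, by simp, by simp⟩
    obtain ⟨i₀, hi₀, hmax⟩ := I.exists_max_image r hI
    have hself : ¬ Disjoint (b i₀) (b i₀) := by
      rw [disjoint_self]
      exact (hb i₀).ne_empty
    obtain ⟨A, hA, hdisj, hcov⟩ := ih (I.filter fun i => Disjoint (b i) (b i₀))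
      (Finset.filter_ssubset.2 ⟨i₀, hi₀, hself⟩)
    refine ⟨insert i₀ A, ?_, ?_, ?_⟩
    · exact Finset.insert_subset hi₀ (hA.trans (Finset.filter_subset _ _))
    · rw [Finset.coe_insert]
      refine hdisj.insert fun j hj _ => ?_
      exact ((Finset.mem_filter.1 (hA hj)).2).symm
    · intro i hi
      by_cases h : Disjoint (b i) (b i₀)
      · obtain ⟨a, ha, h1⟩ := hcov i (Finset.mem_filter.2 ⟨hi, h⟩)
        exact ⟨a, Finset.mem_insert_of_mem ha, h1⟩
      · exact ⟨i₀, Finset.mem_insert_self _ _, hmax i hi, h⟩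

theorem doubling_pow_mul_le {K : ℕ} (hK : ∀ r, v (2 * r) ≤ K * v r) (j r : ℕ) :
    v (2 ^ j * r) ≤ K ^ j * v r := by
  induction j with
  | zero => simp
  | succ j ih =>
    calc v (2 ^ (j + 1) * r) = v (2 * (2 ^ j * r)) := by rw [pow_succ']; ring_nf
      _ ≤ K * (K ^ j * v r) := (hK _).trans (Nat.mul_le_mul_left _ ih)
      _ = _ := by rw [pow_succ']; ring

namespace IsBallSystem

theorem self_mem (hB : IsBallSystem d B v) (g : Γ) (r : ℕ) : g ∈ B g r := by
  rw [hB.mem, (hB.eq_iff g g).2 rfl]; exact Nat.zero_le r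

theorem ball_zero (hB : IsBallSystem d B v) (g : Γ) : B g 0 = {g} := by
  ext y
  rw [hB.mem, Nat.le_zero, hB.eq_iff, Finset.mem_singleton, eq_comm]

theorem ball_mono (hB : IsBallSystem d B v) (g : Γ) {r s : ℕ} (h : r ≤ s) : B g r ⊆ B g s := by
  intro y hy
  rw [hB.mem] at hy ⊢
  omega

theorem mono (hB : IsBallSystem d B v) [Nonempty Γ] {r s : ℕ} (h : r ≤ s) : v r ≤ v s := by
  obtain ⟨g⟩ := ‹Nonempty Γ›
  rw [← hB.card g, ← hB.card g]
  exact Finset.card_le_card (hB.ball_mono g h)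

theorem pos (hB : IsBallSystem d B v) [Nonempty Γ] (r : ℕ) : 0 < v r := by
  obtain ⟨g⟩ := ‹Nonempty Γ›
  rw [← hB.card g, Finset.card_pos]
  exact ⟨g, hB.self_mem g r⟩

theorem not_disjoint_iff (hB : IsBallSystem d B v) [DecidableEq Γ] (g h : Γ) (r s : ℕ) :
    ¬ Disjoint (B g r) (B h s) ↔ d g h ≤ r + s := by
  rw [Finset.not_disjoint_iff]
  constructor
  · rintro ⟨x, h1, h2⟩
    rw [hB.mem] at h1 h2
    have := hB.triangle g x h
    have := hB.symm h x
    omega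
  · intro h1
    obtain ⟨z, h2, h3⟩ := hB.geodesic g h (min r (d g h)) (min_le_right _ _)
    refine ⟨z, ?_, ?_⟩
    · rw [hB.mem]; omega
    · rw [hB.mem, hB.symm]; omega

/-- Comparison of an annulus with the next inner annulus. -/
theorem card_annulus_le (hB : IsBallSystem d B v)
    [Nonempty Γ] {K : ℕ} (hK : ∀ r, v (2 * r) ≤ K * v r) {r s : ℕ}
    (h : 3 * s ≤ r) : v (r + s) - v r ≤ K ^ 3 * (v r - v (r - 3 * s)) := by
  classical
  obtain ⟨e⟩ := ‹Nonempty Γ›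
  obtain ⟨P, hP, hdisj, hcov⟩ := exists_disjoint_subfamily (fun p => B p (3 * s))
    (fun p => ⟨p, hB.self_mem p _⟩) (fun _ => 0) (B e (r + s) \ B e r)
  have hPmem : ∀ p ∈ P, d e p ≤ r + s ∧ r < d e p := by
    intro p hp
    have := hP hp
    rw [Finset.mem_sdiff, hB.mem, hB.mem] at this
    omega
  have hmove : ∀ p, ∃ q, p ∈ P → d p q = 2 * s ∧ d q e = d p e - 2 * s := by
    intro p
    by_cases hp : p ∈ P
    · have := hPmem p hp
      have := hB.symm p e
      obtain ⟨q, h1, h2⟩ := hB.geodesic p e (2 * s) (by omega)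
      exact ⟨q, fun _ => ⟨h1, h2⟩⟩
    · exact ⟨p, fun h => absurd h hp⟩
  choose q hq using hmove
  have h1 : (B e (r + s) \ B e r).card ≤ P.card * v (6 * s) := by
    calc (B e (r + s) \ B e r).card ≤ (P.biUnion fun p => B p (6 * s)).card := by
          refine Finset.card_le_card fun x hx => ?_
          obtain ⟨a, ha, -, h2⟩ := hcov x hx
          rw [hB.not_disjoint_iff] at h2
          rw [Finset.mem_biUnion]
          exact ⟨a, ha, by rw [hB.mem, hB.symm]; omega⟩
      _ ≤ _ := Finset.card_biUnion_le_card_mul _ _ _ fun p _ => (hB.card p _).le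
  have h2 : P.card * v s ≤ (B e r \ B e (r - 3 * s)).card := by
    have hd : ∀ p ∈ P, ∀ p' ∈ P, p ≠ p' → Disjoint (B (q p) s) (B (q p') s) := by
      intro p hp p' hp' hne
      by_contra hnd
      rw [hB.not_disjoint_iff] at hnd
      have h3 := hdisj hp hp' hne
      refine absurd h3 ((hB.not_disjoint_iff _ _ _ _).2 ?_)
      have := hB.triangle p (q p) p'
      have := hB.triangle (q p) (q p') p'
      have := hB.symm (q p') p'
      have := (hq p hp).1
      have := (hq p' hp').1
      omega
    calc P.card * v s = (P.biUnion fun p => B (q p) s).card := by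
          rw [Finset.card_biUnion hd, Finset.sum_congr rfl fun p _ => hB.card (q p) s,
            Finset.sum_const, smul_eq_mul]
      _ ≤ _ := by
          refine Finset.card_le_card fun x hx => ?_
          obtain ⟨p, hp, hx⟩ := Finset.mem_biUnion.1 hx
          rw [hB.mem] at hx
          rw [Finset.mem_sdiff, hB.mem, hB.mem]
          have := hPmem p hp
          have := hq p hp
          have := hB.symm e p
          have := hB.symm e (q p)
          have := hB.symm (q p) x
          have := hB.triangle e (q p) x
          have := hB.triangle e x (q p)
          omega
  rw [Finset.card_sdiff_of_subset (hB.ball_mono e (by omega)), hB.card, hB.card] at h1 h2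
  have : Nonempty Γ := ⟨e⟩
  calc v (r + s) - v r ≤ P.card * v (6 * s) := h1
    _ ≤ P.card * (K ^ 3 * v s) := by
        refine Nat.mul_le_mul_left _ (le_trans (hB.mono ?_) (doubling_pow_mul_le hK 3 s))
        omega
    _ = K ^ 3 * (P.card * v s) := by ring
    _ ≤ _ := Nat.mul_le_mul_left _ h2

/-- Annular decay. -/
theorem exists_annulus_le (hB : IsBallSystem d B v)
    [Nonempty Γ] {K : ℕ} (hK : ∀ r, v (2 * r) ≤ K * v r) {ε : ℝ}
    (hε : 0 < ε) : ∃ l : ℕ, 2 ≤ l ∧ ∀ R s, l * s ≤ R →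
      (v (R + 2 * s) : ℝ) - v (R - 2 * s) ≤ ε * v R := by
  set L : ℝ := K ^ 3 with hL
  have hL0 : 0 ≤ L := by positivity
  have hstep : ∀ ρ t, 4 * t ≤ ρ →
      (v ρ : ℝ) - v (ρ - t) ≤ (L / (1 + L)) * ((v ρ : ℝ) - v (ρ - 4 * t)) := by
    intro ρ t ht
    have h := hB.card_annulus_le hK (r := ρ - t) (s := t) (by omega)
    rw [Nat.sub_add_cancel (by omega), Nat.sub_sub, show t + 3 * t = 4 * t by ring] at h
    have h1 : v (ρ - t) ≤ v ρ := hB.mono (Nat.sub_le _ _)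
    have h2 : v (ρ - 4 * t) ≤ v (ρ - t) := hB.mono (by omega)
    have h' : ((v ρ - v (ρ - t) : ℕ) : ℝ) ≤ ((K ^ 3 * (v (ρ - t) - v (ρ - 4 * t)) : ℕ) : ℝ) := by
      exact_mod_cast h
    rw [Nat.cast_sub h1, Nat.cast_mul, Nat.cast_sub h2, Nat.cast_pow, ← hL] at h'
    rw [div_mul_eq_mul_div, le_div_iff₀ (by positivity)]
    nlinarith
  set θ := L / (1 + L) with hθ
  have hθ0 : 0 ≤ θ := by positivity
  have hθ1 : θ < 1 := by rw [hθ, div_lt_one (by positivity)]; linarith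
  obtain ⟨j, hj⟩ := exists_pow_lt_of_lt_one (show 0 < ε / (K + 1) by positivity) hθ1
  refine ⟨4 ^ (j + 1), ?_, fun R s hs => ?_⟩
  · calc 2 ≤ 4 ^ 1 := by norm_num
      _ ≤ 4 ^ (j + 1) := Nat.pow_le_pow_right (by norm_num) (by omega)
  have hiter : ∀ j ρ t, 4 ^ j * t ≤ ρ →
      (v ρ : ℝ) - v (ρ - t) ≤ θ ^ j * ((v ρ : ℝ) - v (ρ - 4 ^ j * t)) := by
    intro j
    induction j with
    | zero => intro ρ t _; simp
    | succ j ih =>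
      intro ρ t ht
      have e1 : 4 ^ j * (4 * t) = 4 ^ (j + 1) * t := by rw [pow_succ]; ring
      have h4 : 4 * t ≤ 4 ^ (j + 1) * t := by
        rw [← e1]
        exact Nat.le_mul_of_pos_left _ (by positivity)
      have h1 := hstep ρ t (h4.trans ht)
      have h2 := ih ρ (4 * t) (by rw [e1]; exact ht)
      rw [e1] at h2
      calc _ ≤ θ * ((v ρ : ℝ) - v (ρ - 4 * t)) := h1
        _ ≤ θ * (θ ^ j * ((v ρ : ℝ) - v (ρ - 4 ^ (j + 1) * t))) := by gcongr
        _ = _ := by rw [pow_succ']; ring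
  have e2 : 4 ^ j * (4 * s) = 4 ^ (j + 1) * s := by rw [pow_succ]; ring
  have h1 := hiter j (R + 2 * s) (4 * s) (by rw [e2]; omega)
  have h3 : 2 * s ≤ R := le_trans (Nat.mul_le_mul_right s (by
    calc 2 ≤ 4 ^ 1 := by norm_num
      _ ≤ 4 ^ (j + 1) := Nat.pow_le_pow_right (by norm_num) (by omega))) hs
  rw [show R + 2 * s - 4 * s = R - 2 * s by omega] at h1
  have h4 : (v (R + 2 * s) : ℝ) ≤ (K + 1) * v R := by
    have h5 : v (R + 2 * s) ≤ (K + 1) * v R :=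
      ((hB.mono (by omega)).trans (hK R)).trans (Nat.mul_le_mul_right _ (Nat.le_succ K))
    exact_mod_cast h5
  calc (v (R + 2 * s) : ℝ) - v (R - 2 * s)
      ≤ θ ^ j * ((v (R + 2 * s) : ℝ) - v (R + 2 * s - 4 ^ j * (4 * s))) := h1
    _ ≤ ε / (K + 1) * ((K + 1) * v R) := by
        have h6 : (0 : ℝ) ≤ v (R + 2 * s - 4 ^ j * (4 * s)) := Nat.cast_nonneg _
        have h7 : (v (R + 2 * s - 4 ^ j * (4 * s)) : ℝ) ≤ v (R + 2 * s) := by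
          exact_mod_cast hB.mono (Nat.sub_le _ _)
        exact mul_le_mul hj.le (by linarith) (by linarith) (by positivity)
    _ = _ := by field_simp

end IsBallSystem

end Balls

section Cover

variable {Γ : Type*} {d : Γ → Γ → ℕ} {B : Γ → ℕ → Finset Γ} {v : ℕ → ℕ}

namespace IsBallSystem

theorem sum_filter_subset_le (hB : IsBallSystem d B v) [DecidableEq Γ] {E : Finset (Γ × ℕ)}
    (hE : (E : Set (Γ × ℕ)).PairwiseDisjoint fun p => B p.1 p.2) (W : Finset Γ) :
    ∑ p ∈ E with B p.1 p.2 ⊆ W, v p.2 ≤ W.card := by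
  calc ∑ p ∈ E with B p.1 p.2 ⊆ W, v p.2
      = ((E.filter fun p => B p.1 p.2 ⊆ W).biUnion fun p => B p.1 p.2).card := by
        rw [Finset.card_biUnion]
        · exact Finset.sum_congr rfl fun p _ => (hB.card _ _).symm
        · intro p hp q hq hne
          exact hE (Finset.mem_filter.1 hp).1 (Finset.mem_filter.1 hq).1 hne
    _ ≤ W.card := by
        refine Finset.card_le_card fun x hx => ?_
        obtain ⟨p, hp, hx⟩ := Finset.mem_biUnion.1 hx
        exact (Finset.mem_filter.1 hp).2 hx

/-- A disjoint family of balls, each of which comes with sufficiently many concentric balls of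
rapidly increasing radii, is almost covered by a disjoint family of these larger balls. -/
theorem exists_almost_cover (hB : IsBallSystem d B v) [Nonempty Γ] [DecidableEq Γ] {K : ℕ}
    (hK : ∀ r, v (2 * r) ≤ K * v r) {ε : ℝ} (hε : 0 < ε) :
    ∃ l : ℕ, 2 ≤ l ∧ ∃ M : ℕ, 1 ≤ M ∧ ∀ (E : Finset (Γ × ℕ)) (R : ℕ → Γ → ℕ),
      (E : Set (Γ × ℕ)).PairwiseDisjoint (fun p => B p.1 p.2) →
      (∀ p ∈ E, 1 ≤ R 0 p.1 ∧ l * p.2 ≤ R 0 p.1) →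
      (∀ p ∈ E, ∀ m, m + 1 < M → l * R m p.1 ≤ R (m + 1) p.1) →
      ∃ A : Finset (Γ × ℕ), (∀ a ∈ A, ∃ p ∈ E, a.1 = p.1 ∧ ∃ m < M, a.2 = R m p.1) ∧
        (A : Set (Γ × ℕ)).PairwiseDisjoint (fun p => B p.1 p.2) ∧
        ∑ p ∈ E, (v p.2 : ℝ) ≤
          ∑ a ∈ A, ∑ p ∈ E with B p.1 p.2 ⊆ B a.1 a.2, (v p.2 : ℝ) +
            ε * ∑ a ∈ A, (v a.2 : ℝ) := by
  obtain ⟨l, hl, hann⟩ := hB.exists_annulus_le hK (half_pos hε)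
  obtain ⟨M, hM⟩ := exists_nat_gt ((K : ℝ) ^ 2 / (ε / 2))
  have hM0 : (0 : ℝ) < M := lt_of_le_of_lt (by positivity) hM
  have hM1 : 1 ≤ M := by exact_mod_cast hM0
  have hKM : (K : ℝ) ^ 2 / M ≤ ε / 2 := by
    rw [div_lt_iff₀ (by positivity)] at hM
    rw [div_le_iff₀ hM0]
    linarith
  refine ⟨l, hl, M, hM1, fun E R hE h0 hstep => ?_⟩
  obtain ⟨A, hA, hdisj, hcov⟩ := exists_disjoint_subfamily (fun p : Γ × ℕ => B p.1 p.2)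
    (fun p => ⟨p.1, hB.self_mem _ _⟩) (fun p => p.2)
    ((E ×ˢ Finset.range M).image fun q => (q.1.1, R q.2 q.1.1))
  refine ⟨A, fun a ha => ?_, hdisj, ?_⟩
  · obtain ⟨q, hq, rfl⟩ := Finset.mem_image.1 (hA ha)
    rw [Finset.mem_product, Finset.mem_range] at hq
    exact ⟨q.1, hq.1, rfl, q.2, hq.2, rfl⟩
  set outer : Γ × ℕ → Finset Γ := fun a =>
    B a.1 (a.2 + 2 * (a.2 / l)) \ B a.1 (a.2 - 2 * (a.2 / l)) with houter
  have hpoint : ∀ p ∈ E, (v p.2 : ℝ) ≤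
      ∑ a ∈ A, (if B p.1 p.2 ⊆ B a.1 a.2 then (v p.2 : ℝ) else 0) +
      ∑ a ∈ A, (if B p.1 p.2 ⊆ outer a then (v p.2 : ℝ) else 0) +
      (1 / M) * ∑ a ∈ A, (if B p.1 p.2 ⊆ B a.1 (4 * a.2) then (v p.2 : ℝ) else 0) := by
    intro p hp
    have hn1 : 0 ≤ ∑ a ∈ A, (if B p.1 p.2 ⊆ B a.1 a.2 then (v p.2 : ℝ) else 0) :=
      Finset.sum_nonneg fun a _ => by split_ifs <;> positivity
    have hn2 : 0 ≤ ∑ a ∈ A, (if B p.1 p.2 ⊆ outer a then (v p.2 : ℝ) else 0) :=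
      Finset.sum_nonneg fun a _ => by split_ifs <;> positivity
    have hn3 : 0 ≤ (1 / (M : ℝ)) *
        ∑ a ∈ A, (if B p.1 p.2 ⊆ B a.1 (4 * a.2) then (v p.2 : ℝ) else 0) :=
      mul_nonneg (by positivity) (Finset.sum_nonneg fun a _ => by split_ifs <;> positivity)
    have hone : ∀ W : Γ × ℕ → Finset Γ, ∀ a ∈ A, B p.1 p.2 ⊆ W a →
        (v p.2 : ℝ) ≤ ∑ a ∈ A, (if B p.1 p.2 ⊆ W a then (v p.2 : ℝ) else 0) := by
      intro W a ha hsub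
      have := Finset.single_le_sum
        (f := fun a => if B p.1 p.2 ⊆ W a then (v p.2 : ℝ) else 0)
        (fun a _ => by split_ifs <;> positivity) ha
      simpa only [if_pos hsub] using this
    by_cases hc : ∃ a ∈ A, B p.1 p.2 ⊆ B a.1 a.2
    · obtain ⟨a, ha, hsub⟩ := hc
      have := hone (fun a => B a.1 a.2) a ha hsub
      linarith
    push Not at hc
    have hR : ∀ m < M, 1 ≤ R m p.1 ∧ l * p.2 ≤ R m p.1 := by
      intro m
      induction m with
      | zero => exact fun _ => h0 p hp
      | succ m ih =>
        intro hm
        have h1 := ih (by omega)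
        have h2 := hstep p hp m hm
        have h3 : R m p.1 ≤ l * R m p.1 := Nat.le_mul_of_pos_left _ (by omega)
        omega
    have hpR : ∀ m < M, p.2 ≤ R m p.1 := fun m hm =>
      (Nat.le_mul_of_pos_left _ (by omega)).trans (hR m hm).2
    have hsel : ∀ m, ∃ a, m < M → a ∈ A ∧ R m p.1 ≤ a.2 ∧ d p.1 a.1 ≤ R m p.1 + a.2 := by
      intro m
      by_cases hm : m < M
      · obtain ⟨a, ha, h1, h2⟩ := hcov (p.1, R m p.1)
          (Finset.mem_image.2 ⟨(p, m), Finset.mem_product.2 ⟨hp, Finset.mem_range.2 hm⟩, rfl⟩)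
        exact ⟨a, fun _ => ⟨ha, h1, (hB.not_disjoint_iff _ _ _ _).1 h2⟩⟩
      · exact ⟨p, fun h => absurd h hm⟩
    choose a ha using hsel
    by_cases hi : ∃ m < M, l * R m p.1 ≤ (a m).2
    · obtain ⟨m, hm, h1⟩ := hi
      obtain ⟨h2, h3, h4⟩ := ha m hm
      have h5 : R m p.1 ≤ (a m).2 / l := (Nat.le_div_iff_mul_le (by omega)).2 (by
        rw [mul_comm]; exact h1)
      have h6 : (a m).2 < d p.1 (a m).1 + p.2 := by
        by_contra! h7
        refine hc (a m) h2 fun y hy => ?_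
        rw [hB.mem] at hy ⊢
        have := hB.triangle (a m).1 p.1 y
        have := hB.symm (a m).1 p.1
        omega
      have h7 := hpR m hm
      have h9 : 2 * ((a m).2 / l) ≤ (a m).2 :=
        (Nat.mul_le_mul_right _ hl).trans (Nat.mul_div_le _ _)
      have h8 := hone outer (a m) h2 fun y hy => by
        rw [hB.mem] at hy
        rw [houter, Finset.mem_sdiff, hB.mem, hB.mem]
        have := hB.triangle (a m).1 p.1 y
        have := hB.triangle (a m).1 y p.1
        have := hB.symm (a m).1 p.1
        have := hB.symm y p.1
        omega
      linarith
    · push Not at hi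
      have hmono : ∀ m, m < M → ∀ m' < m, (a m').2 < (a m).2 := by
        intro m
        induction m with
        | zero => intro _ m' h; omega
        | succ m ih =>
          intro hm m' hm'
          have h1 := hi m (by omega)
          have h2 := hstep p hp m hm
          have h3 := (ha (m + 1) hm).2.1
          rcases Nat.lt_succ_iff_lt_or_eq.1 hm' with h4 | rfl
          · have := ih (by omega) m' h4
            omega
          · omega
      have hinj : Set.InjOn a (Finset.range M : Finset ℕ) := by
        intro m hm m' hm' heq
        rw [Finset.mem_coe, Finset.mem_range] at hm hm'
        by_contra hne
        rcases lt_or_gt_of_ne hne with h | h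
        · have := hmono m' hm' m h
          rw [heq] at this
          omega
        · have := hmono m hm m' h
          rw [heq] at this
          omega
      have hcount : (M : ℝ) * v p.2 ≤
          ∑ a ∈ A, (if B p.1 p.2 ⊆ B a.1 (4 * a.2) then (v p.2 : ℝ) else 0) := by
        calc (M : ℝ) * v p.2
            = ∑ b ∈ (Finset.range M).image a,
                (if B p.1 p.2 ⊆ B b.1 (4 * b.2) then (v p.2 : ℝ) else 0) := by
              rw [Finset.sum_image hinj, Finset.sum_congr rfl (g := fun _ => (v p.2 : ℝ)),
                Finset.sum_const, Finset.card_range, nsmul_eq_mul]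
              intro m hm
              rw [Finset.mem_range] at hm
              rw [if_pos]
              intro y hy
              rw [hB.mem] at hy ⊢
              have := ha m hm
              have := hpR m hm
              have := hB.triangle (a m).1 p.1 y
              have := hB.symm (a m).1 p.1
              omega
          _ ≤ _ := by
              refine Finset.sum_le_sum_of_subset_of_nonneg ?_
                fun b _ _ => by split_ifs <;> positivity
              intro b hb
              obtain ⟨m, hm, rfl⟩ := Finset.mem_image.1 hb
              exact (ha m (Finset.mem_range.1 hm)).1
      have : (v p.2 : ℝ) ≤ (1 / (M : ℝ)) *
          ∑ a ∈ A, (if B p.1 p.2 ⊆ B a.1 (4 * a.2) then (v p.2 : ℝ) else 0) := by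
        rw [one_div, inv_mul_eq_div, le_div_iff₀ hM0]
        linarith
      linarith
  have hswap : ∀ W : Γ × ℕ → Finset Γ,
      ∑ p ∈ E, ∑ a ∈ A, (if B p.1 p.2 ⊆ W a then (v p.2 : ℝ) else 0) =
        ∑ a ∈ A, ∑ p ∈ E with B p.1 p.2 ⊆ W a, (v p.2 : ℝ) := by
    intro W
    rw [Finset.sum_comm]
    exact Finset.sum_congr rfl fun a _ => (Finset.sum_filter _ _).symm
  have hpack : ∀ W : Finset Γ, ∑ p ∈ E with B p.1 p.2 ⊆ W, (v p.2 : ℝ) ≤ W.card := by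
    intro W
    exact_mod_cast hB.sum_filter_subset_le hE W
  have hO : ∑ a ∈ A, ∑ p ∈ E with B p.1 p.2 ⊆ outer a, (v p.2 : ℝ) ≤
      ε / 2 * ∑ a ∈ A, (v a.2 : ℝ) := by
    rw [Finset.mul_sum]
    refine Finset.sum_le_sum fun a _ => (hpack _).trans ?_
    rw [houter, Finset.card_sdiff_of_subset (hB.ball_mono _ (by omega)), hB.card, hB.card,
      Nat.cast_sub (hB.mono (by omega))]
    exact hann _ _ (Nat.mul_div_le _ _)
  have hT : ∑ a ∈ A, ∑ p ∈ E with B p.1 p.2 ⊆ B a.1 (4 * a.2), (v p.2 : ℝ) ≤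
      (K : ℝ) ^ 2 * ∑ a ∈ A, (v a.2 : ℝ) := by
    rw [Finset.mul_sum]
    refine Finset.sum_le_sum fun a _ => (hpack _).trans ?_
    rw [hB.card]
    exact_mod_cast doubling_pow_mul_le hK 2 a.2
  have hA0 : 0 ≤ ∑ a ∈ A, (v a.2 : ℝ) := Finset.sum_nonneg fun _ _ => Nat.cast_nonneg _
  calc ∑ p ∈ E, (v p.2 : ℝ) ≤ _ := Finset.sum_le_sum hpoint
    _ = ∑ a ∈ A, ∑ p ∈ E with B p.1 p.2 ⊆ B a.1 a.2, (v p.2 : ℝ) +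
        ∑ a ∈ A, ∑ p ∈ E with B p.1 p.2 ⊆ outer a, (v p.2 : ℝ) +
        (1 / M) * ∑ a ∈ A, ∑ p ∈ E with B p.1 p.2 ⊆ B a.1 (4 * a.2), (v p.2 : ℝ) := by
      rw [Finset.sum_add_distrib, Finset.sum_add_distrib, ← Finset.mul_sum,
        hswap fun a => B a.1 a.2, hswap outer, hswap fun a => B a.1 (4 * a.2)]
    _ ≤ ∑ a ∈ A, ∑ p ∈ E with B p.1 p.2 ⊆ B a.1 a.2, (v p.2 : ℝ) +
        ε / 2 * ∑ a ∈ A, (v a.2 : ℝ) + (1 / M) * ((K : ℝ) ^ 2 * ∑ a ∈ A, (v a.2 : ℝ)) := by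
      gcongr
    _ = ∑ a ∈ A, ∑ p ∈ E with B p.1 p.2 ⊆ B a.1 a.2, (v p.2 : ℝ) +
        (ε / 2 + (K : ℝ) ^ 2 / M) * ∑ a ∈ A, (v a.2 : ℝ) := by ring
    _ ≤ _ := by
      gcongr
      linarith

end IsBallSystem

end Cover

section Upcrossings

/-- The sequence `a` has at least `k` upcrossings across `(α, β)` before time `R`. -/
def HasUpcrossings (a : ℕ → ℝ) (α β : ℝ) (k R : ℕ) : Prop :=
  ∃ i j : ℕ → ℕ, (∀ m < k, i m < j m ∧ j m ≤ R ∧ a (i m) < α ∧ β < a (j m)) ∧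
    ∀ m, m + 1 < k → j m < i (m + 1)

variable {Γ : Type*} {d : Γ → Γ → ℕ} {B : Γ → ℕ → Finset Γ} {v : ℕ → ℕ}

/-- Subadditivity of a function of balls along disjoint decompositions of balls into balls. -/
def IsBallSubadditive [DecidableEq Γ] (B : Γ → ℕ → Finset Γ) (f : Γ → ℕ → ℝ) : Prop :=
  ∀ (g : Γ) (r : ℕ) (E : Finset (Γ × ℕ)),
    (E : Set (Γ × ℕ)).PairwiseDisjoint (fun p => B p.1 p.2) →
    (B g r = E.biUnion fun p => B p.1 p.2) → f g r ≤ ∑ p ∈ E, f p.1 p.2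

namespace IsBallSystem

/-- Disjoint balls with small averages occupy a definite proportion at most of a ball with a
large average. -/
theorem sum_low_le (hB : IsBallSystem d B v)
    [DecidableEq Γ] {f : Γ → ℕ → ℝ} (hf : IsBallSubadditive B f) {α β C : ℝ}
    (hαβ : α < β) (hβC : β < C) (hC : ∀ g, f g 0 ≤ C) {h : Γ} {r : ℕ}
    (hup : β * v r < f h r) {E : Finset (Γ × ℕ)}
    (hE : (E : Set (Γ × ℕ)).PairwiseDisjoint fun p => B p.1 p.2)
    (hlow : ∀ p ∈ E, f p.1 p.2 < α * v p.2) :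
    ∑ p ∈ E with B p.1 p.2 ⊆ B h r, (v p.2 : ℝ) ≤ (C - β) / (C - α) * v r := by
  set E₁ := E.filter fun p => B p.1 p.2 ⊆ B h r with hE₁
  set W := E₁.biUnion fun p => B p.1 p.2 with hW
  set E₂ := (B h r \ W).image fun x => ((x, 0) : Γ × ℕ) with hE₂
  have hWsub : W ⊆ B h r := by
    intro x hx
    obtain ⟨p, hp, hx⟩ := Finset.mem_biUnion.1 hx
    exact (Finset.mem_filter.1 hp).2 hx
  have hd₁ : (E₁ : Set (Γ × ℕ)).PairwiseDisjoint fun p => B p.1 p.2 := by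
    intro p hp q hq hne
    exact hE (Finset.mem_filter.1 hp).1 (Finset.mem_filter.1 hq).1 hne
  have hdisj : Disjoint E₁ E₂ := by
    rw [Finset.disjoint_left]
    intro p hp hp'
    obtain ⟨x, hx, rfl⟩ := Finset.mem_image.1 hp'
    refine (Finset.mem_sdiff.1 hx).2 (Finset.mem_biUnion.2 ⟨_, hp, ?_⟩)
    exact hB.self_mem x 0
  have hcross : ∀ p ∈ E₁, ∀ q ∈ E₂, Disjoint (B p.1 p.2) (B q.1 q.2) := by
    intro p hp q hq
    obtain ⟨x, hx, rfl⟩ := Finset.mem_image.1 hq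
    rw [hB.ball_zero, Finset.disjoint_singleton_right]
    exact fun h1 => (Finset.mem_sdiff.1 hx).2 (Finset.mem_biUnion.2 ⟨p, hp, h1⟩)
  have hPD : ((E₁ ∪ E₂ : Finset (Γ × ℕ)) : Set (Γ × ℕ)).PairwiseDisjoint
      fun p => B p.1 p.2 := by
    intro p hp q hq hne
    rw [Finset.mem_coe, Finset.mem_union] at hp hq
    rcases hp with hp | hp <;> rcases hq with hq | hq
    · exact hd₁ hp hq hne
    · exact hcross p hp q hq
    · exact (hcross q hq p hp).symm
    · obtain ⟨x, hx, rfl⟩ := Finset.mem_image.1 hp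
      obtain ⟨y, hy, rfl⟩ := Finset.mem_image.1 hq
      change Disjoint (B x 0) (B y 0)
      rw [hB.ball_zero, hB.ball_zero, Finset.disjoint_singleton]
      rintro rfl
      exact hne rfl
  have hunion : B h r = (E₁ ∪ E₂).biUnion fun p => B p.1 p.2 := by
    rw [Finset.union_biUnion, ← hW, hE₂, Finset.image_biUnion]
    simp only [hB.ball_zero, Finset.biUnion_singleton_eq_self]
    rw [Finset.union_sdiff_of_subset hWsub]
  have h1 := hf h r _ hPD hunion
  rw [Finset.sum_union hdisj] at h1
  have h2 : ∑ p ∈ E₁, f p.1 p.2 ≤ α * ∑ p ∈ E₁, (v p.2 : ℝ) := by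
    rw [Finset.mul_sum]
    exact Finset.sum_le_sum fun p hp => (hlow p (Finset.mem_filter.1 hp).1).le
  have hcard : (W.card : ℝ) = ∑ p ∈ E₁, (v p.2 : ℝ) := by
    rw [hW, Finset.card_biUnion hd₁]
    push_cast
    exact Finset.sum_congr rfl fun p _ => by rw [hB.card]
  have h3 : ∑ p ∈ E₂, f p.1 p.2 ≤ C * (v r - ∑ p ∈ E₁, (v p.2 : ℝ)) := by
    calc ∑ p ∈ E₂, f p.1 p.2 ≤ E₂.card • C := by
          refine Finset.sum_le_card_nsmul _ _ _ fun p hp => ?_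
          obtain ⟨x, -, rfl⟩ := Finset.mem_image.1 hp
          exact hC x
      _ = _ := by
          rw [hE₂, Finset.card_image_of_injective _ (fun x y hxy => (Prod.ext_iff.1 hxy).1),
            Finset.card_sdiff_of_subset hWsub, nsmul_eq_mul,
            Nat.cast_sub (Finset.card_le_card hWsub), hB.card, hcard, mul_comm]
  rw [div_mul_eq_mul_div, le_div_iff₀ (by linarith)]
  linarith

/-- The number of points of a ball at which a subadditive function has many upcrossings. -/
theorem exists_card_upcrossings_le (hB : IsBallSystem d B v) [Nonempty Γ] [DecidableEq Γ] {K : ℕ}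
    (hK : ∀ r, v (2 * r) ≤ K * v r) {α β C : ℝ} (hαβ : α < β) (hβC : β < C) :
    ∃ c > (0 : ℝ), ∃ ρ ∈ Set.Ioo (0 : ℝ) 1, ∀ f : Γ → ℕ → ℝ, IsBallSubadditive B f →
      (∀ g, f g 0 ≤ C) → ∀ (k N R : ℕ) (e : Γ) (E : Finset Γ), 1 ≤ k → E ⊆ B e N →
      (∀ g ∈ E, HasUpcrossings (fun n => f g n / v n) α β k R) →
      (E.card : ℝ) ≤ c * ρ ^ k * v (N + R) := by
  set κ := (C - β) / (C - α) with hκ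
  have hκ0 : 0 < κ := div_pos (by linarith) (by linarith)
  have hκ1 : κ < 1 := by rw [hκ, div_lt_one (by linarith)]; linarith
  set ε := (1 - κ) / 4 with hε
  have hε0 : 0 < ε := by rw [hε]; linarith
  have hκε : κ = 1 - 4 * ε := by rw [hε]; ring
  obtain ⟨l, hl, M, hM, hcover⟩ := hB.exists_almost_cover hK hε0
  obtain ⟨p, hp⟩ := exists_pow_lt_of_lt_one (show (0 : ℝ) < 1 / (K ^ l + 1) by positivity) hκ1
  set q := (1 + ε) * (κ + ε) with hq
  have hq0 : 0 < q := by positivity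
  have hq1 : q < 1 := by
    rw [hq, hκε]
    nlinarith
  set L := (p + 1) * (2 * M) with hL
  have hL0 : 0 < L := by positivity
  refine ⟨q⁻¹, by positivity, q ^ ((1 : ℝ) / L), ⟨by positivity,
    Real.rpow_lt_one hq0.le hq1 (by positivity)⟩, ?_⟩
  intro f hf hC k N R e E hk hEN hE
  have hvpos : ∀ r, (0 : ℝ) < v r := fun r => by exact_mod_cast hB.pos r
  choose! I J hIJ hJI using hE
  have hlow : ∀ g ∈ E, ∀ m < k, f g (I g m) < α * v (I g m) := fun g hg m hm =>
    (div_lt_iff₀ (hvpos _)).1 (hIJ g hg m hm).2.2.1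
  have hup : ∀ g ∈ E, ∀ m < k, β * v (J g m) < f g (J g m) := fun g hg m hm =>
    (lt_div_iff₀ (hvpos _)).1 (hIJ g hg m hm).2.2.2
  have hgrow : ∀ g ∈ E, ∀ m < k, (v (I g m) : ℝ) ≤ κ * v (J g m) := by
    intro g hg m hm
    have h1 := hB.sum_low_le hf hαβ hβC hC (hup g hg m hm) (E := {(g, I g m)}) (by simp)
      (by simpa using hlow g hg m hm)
    rw [Finset.filter_true_of_mem] at h1
    · simpa using h1
    · intro p hp
      rw [Finset.mem_singleton] at hp
      subst hp
      exact hB.ball_mono g (hIJ g hg m hm).1.le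
  have hgrow' : ∀ g ∈ E, ∀ s m, m + s < k → (v (J g m) : ℝ) ≤ κ ^ s * v (J g (m + s)) := by
    intro g hg s
    induction s with
    | zero => intro m _; simp
    | succ s ih =>
      intro m hm
      have h1 := ih m (by omega)
      have h2 : (v (J g (m + s)) : ℝ) ≤ v (I g (m + s + 1)) := by
        exact_mod_cast hB.mono (hJI g hg (m + s) (by omega)).le
      have h3 := hgrow g hg (m + s + 1) (by omega)
      calc (v (J g m) : ℝ) ≤ κ ^ s * v (J g (m + s)) := h1
        _ ≤ κ ^ s * (κ * v (J g (m + s + 1))) := by gcongr; linarith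
        _ = _ := by rw [← add_assoc, pow_succ]; ring
  have hImono : ∀ g ∈ E, ∀ b a, a ≤ b → b < k → I g a ≤ I g b := by
    intro g hg b
    induction b with
    | zero => intro a ha _; rw [Nat.le_zero.1 ha]
    | succ b ih =>
      intro a ha hb
      rcases Nat.le_succ_iff.1 ha with h | rfl
      · have := ih a h (by omega)
        have := (hIJ g hg b (by omega)).1
        have := hJI g hg b hb
        omega
      · exact le_rfl
  have hsep : ∀ g ∈ E, ∀ a b, a + (p + 1) ≤ b → b < k → l * J g a ≤ I g b := by
    intro g hg a b hab hb
    refine le_trans ?_ (hImono g hg b _ hab hb)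
    by_contra! hlt
    rw [← add_assoc] at hlt
    have h1 := hJI g hg (a + p) (by omega)
    have h2 : v (J g (a + p)) ≤ K ^ l * v (J g a) := by
      refine (hB.mono ?_).trans (doubling_pow_mul_le hK l _)
      have : l * J g a ≤ 2 ^ l * J g a := Nat.mul_le_mul_right _ Nat.lt_two_pow_self.le
      omega
    have h2' : (v (J g (a + p)) : ℝ) ≤ K ^ l * v (J g a) := by exact_mod_cast h2
    have h3 := hgrow' g hg p a (by omega)
    rw [lt_div_iff₀ (by positivity)] at hp
    have h4 := hvpos (J g (a + p))
    have h5 := hvpos (J g a)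
    have h6 : (K : ℝ) ^ l * v (J g a) ≤ K ^ l * (κ ^ p * v (J g (a + p))) := by gcongr
    nlinarith [pow_pos hκ0 p]
  have hmass : ∀ A : Finset (Γ × ℕ), 0 ≤ ∑ a ∈ A, (v a.2 : ℝ) := fun A =>
    Finset.sum_nonneg fun _ _ => Nat.cast_nonneg _
  have hiter : ∀ t, L * t < k → ∃ A : Finset (Γ × ℕ),
      (A : Set (Γ × ℕ)).PairwiseDisjoint (fun p => B p.1 p.2) ∧
      (∀ a ∈ A, a.1 ∈ E ∧ a.2 ≤ J a.1 ((p + 1) * (2 * M * t)) ∧ a.2 ≤ R) ∧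
      (E.card : ℝ) ≤ q ^ t * ∑ a ∈ A, (v a.2 : ℝ) := by
    intro t
    induction t with
    | zero =>
      intro _
      refine ⟨E.image fun x => (x, 0), ?_, ?_, ?_⟩
      · rw [Finset.coe_image]
        rintro _ ⟨x, hx, rfl⟩ _ ⟨y, hy, rfl⟩ hne
        change Disjoint (B x 0) (B y 0)
        rw [hB.ball_zero, hB.ball_zero, Finset.disjoint_singleton]
        rintro rfl
        exact hne rfl
      · intro a ha
        obtain ⟨x, hx, rfl⟩ := Finset.mem_image.1 ha
        exact ⟨hx, Nat.zero_le _, Nat.zero_le _⟩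
      · rw [Finset.sum_image (fun x _ y _ hxy => (Prod.ext_iff.1 hxy).1), pow_zero, one_mul]
        change (E.card : ℝ) ≤ ∑ x ∈ E, (v 0 : ℝ)
        rw [Finset.sum_const, nsmul_eq_mul]
        have : (1 : ℝ) ≤ v 0 := by exact_mod_cast hB.pos 0
        exact le_mul_of_one_le_right (Nat.cast_nonneg _) this
    | succ t ih =>
      intro ht
      have hidx : ∀ b, b ≤ 2 * M * t + 2 * M → (p + 1) * b < k := by
        intro b hb
        refine lt_of_le_of_lt (Nat.mul_le_mul_left _ hb) ?_
        rw [hL] at ht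
        calc (p + 1) * (2 * M * t + 2 * M) = (p + 1) * (2 * M) * (t + 1) := by ring
          _ < k := ht
      have hsep' : ∀ g ∈ E, ∀ b, b + 1 ≤ 2 * M * t + 2 * M →
          l * J g ((p + 1) * b) ≤ I g ((p + 1) * (b + 1)) := fun g hg b hb =>
        hsep g hg _ _ (by rw [mul_add, mul_one]) (hidx _ hb)
      have hIJ' : ∀ g ∈ E, ∀ b, b ≤ 2 * M * t + 2 * M →
          I g ((p + 1) * b) ≤ J g ((p + 1) * b) ∧ J g ((p + 1) * b) ≤ R := fun g hg b hb =>
        ⟨(hIJ g hg _ (hidx b hb)).1.le, (hIJ g hg _ (hidx b hb)).2.1⟩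
      have hIpos : ∀ g ∈ E, ∀ b, b + 1 ≤ 2 * M * t + 2 * M → 1 ≤ I g ((p + 1) * (b + 1)) := by
        intro g hg b hb
        have h1 := hidx _ hb
        have h2 : (p + 1) * (b + 1) = (p + 1) * b + p + 1 := by ring
        rw [h2] at h1 ⊢
        have := hJI g hg _ h1
        omega
      obtain ⟨A, hAd, hAE, hAc⟩ := ih (lt_of_le_of_lt (Nat.mul_le_mul_left _ (Nat.le_succ t)) ht)
      obtain ⟨A₁, hA₁, hA₁d, hA₁c⟩ := hcover A
        (fun m g => I g ((p + 1) * (2 * M * t + m + 1))) hAd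
        (fun a ha => by
          obtain ⟨h1, h2, -⟩ := hAE a ha
          refine ⟨hIpos _ h1 _ (by omega), ?_⟩
          exact (Nat.mul_le_mul_left _ h2).trans (hsep' _ h1 (2 * M * t) (by omega)))
        (fun a ha m hm => by
          obtain ⟨h1, -, -⟩ := hAE a ha
          exact (Nat.mul_le_mul_left _ (hIJ' _ h1 _ (by omega)).1).trans
            (hsep' _ h1 (2 * M * t + m + 1) (by omega)))
      have hA₁E : ∀ a ∈ A₁, a.1 ∈ E ∧ ∃ m < M, a.2 = I a.1 ((p + 1) * (2 * M * t + m + 1)) := by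
        intro a ha
        obtain ⟨b, hb, h1, m, hm, h2⟩ := hA₁ a ha
        exact ⟨h1 ▸ (hAE b hb).1, m, hm, by rw [h1, h2]⟩
      have hJmono : ∀ g ∈ E, ∀ a b, a ≤ b → b ≤ 2 * M * t + 2 * M →
          J g ((p + 1) * a) ≤ J g ((p + 1) * b) := by
        intro g hg a b hab hb
        rcases hab.eq_or_lt with rfl | hlt
        · exact le_rfl
        have h1 := hsep g hg ((p + 1) * a) ((p + 1) * b) (by
          rw [← mul_add_one]
          exact Nat.mul_le_mul_left _ hlt) (hidx b hb)
        have h2 := (hIJ' g hg b hb).1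
        have h3 : J g ((p + 1) * a) ≤ l * J g ((p + 1) * a) :=
          Nat.le_mul_of_pos_left _ (by omega)
        omega
      obtain ⟨A₂, hA₂, hA₂d, hA₂c⟩ := hcover A₁
        (fun m g => J g ((p + 1) * (2 * M * t + M + m + 1))) hA₁d
        (fun a ha => by
          obtain ⟨h1, m, hm, h2⟩ := hA₁E a ha
          have h3 := hIpos _ h1 (2 * M * t + M) (by omega)
          have h4 := (hIJ' _ h1 (2 * M * t + M + 1) (by omega)).1
          have h5 := hsep' _ h1 (2 * M * t + M) (by omega)
          have h6 := (hIJ' _ h1 (2 * M * t + m + 1) (by omega)).1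
          have h7 := hJmono _ h1 (2 * M * t + m + 1) (2 * M * t + M) (by omega) (by omega)
          have h8 := Nat.mul_le_mul_left l (h6.trans h7)
          rw [← h2] at h8
          exact ⟨h3.trans h4, h8.trans (h5.trans h4)⟩)
        (fun a ha m hm => by
          obtain ⟨h1, -⟩ := hA₁E a ha
          exact (hsep' _ h1 (2 * M * t + M + m + 1) (by omega)).trans
            (hIJ' _ h1 (2 * M * t + M + (m + 1) + 1) (by omega)).1)
      have hA₂E : ∀ a ∈ A₂, a.1 ∈ E ∧
          ∃ m < M, a.2 = J a.1 ((p + 1) * (2 * M * t + M + m + 1)) := by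
        intro a ha
        obtain ⟨b, hb, h1, m, hm, h2⟩ := hA₂ a ha
        exact ⟨h1 ▸ (hA₁E b hb).1, m, hm, by rw [h1, h2]⟩
      refine ⟨A₂, hA₂d, fun a ha => ?_, ?_⟩
      · obtain ⟨h1, m, hm, h2⟩ := hA₂E a ha
        refine ⟨h1, ?_, ?_⟩
        · rw [h2, show 2 * M * (t + 1) = 2 * M * t + 2 * M by ring]
          exact hJmono _ h1 _ _ (by omega) le_rfl
        · rw [h2]
          exact (hIJ' _ h1 _ (by omega)).2
      have hs₁ : ∑ a ∈ A, (v a.2 : ℝ) ≤ (1 + ε) * ∑ a ∈ A₁, (v a.2 : ℝ) := by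
        refine hA₁c.trans ?_
        rw [add_mul, one_mul]
        gcongr with a ha
        have := hB.sum_filter_subset_le hAd (B a.1 a.2)
        rw [hB.card] at this
        exact_mod_cast this
      have hs₂ : ∑ a ∈ A₁, (v a.2 : ℝ) ≤ (κ + ε) * ∑ a ∈ A₂, (v a.2 : ℝ) := by
        refine hA₂c.trans ?_
        rw [add_mul, Finset.mul_sum (a := κ)]
        gcongr with a ha
        obtain ⟨h1, m, hm, h2⟩ := hA₂E a ha
        refine hB.sum_low_le hf hαβ hβC hC ?_ hA₁d fun b hb => ?_
        · rw [h2]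
          exact hup _ h1 _ (hidx _ (by omega))
        · obtain ⟨h1, m, hm, h2⟩ := hA₁E b hb
          rw [h2]
          exact hlow _ h1 _ (hidx _ (by omega))
      calc (E.card : ℝ) ≤ q ^ t * ∑ a ∈ A, (v a.2 : ℝ) := hAc
        _ ≤ q ^ t * ((1 + ε) * ((κ + ε) * ∑ a ∈ A₂, (v a.2 : ℝ))) :=
            mul_le_mul_of_nonneg_left
              (hs₁.trans (mul_le_mul_of_nonneg_left hs₂ (by linarith))) (by positivity)
        _ = _ := by rw [pow_succ, hq]; ring
  obtain ⟨A, hAd, hAE, hAc⟩ := hiter ((k - 1) / L) (by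
    have := Nat.mul_div_le (k - 1) L
    omega)
  have hsum : ∑ a ∈ A, (v a.2 : ℝ) ≤ v (N + R) := by
    have h1 := hB.sum_filter_subset_le hAd (B e (N + R))
    rw [hB.card, Finset.filter_true_of_mem] at h1
    · exact_mod_cast h1
    · intro a ha y hy
      have h2 := hEN (hAE a ha).1
      rw [hB.mem] at h2 hy ⊢
      have := hB.triangle e a.1 y
      have := (hAE a ha).2.2
      omega
  have hpow : q ^ ((k - 1) / L) ≤ q⁻¹ * (q ^ ((1 : ℝ) / L)) ^ k := by
    have h1 : k ≤ L * ((k - 1) / L + 1) := by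
      have := Nat.div_add_mod (k - 1) L
      have := Nat.mod_lt (k - 1) hL0
      rw [mul_add]
      omega
    have h2 : (q ^ ((1 : ℝ) / L)) ^ L = q := by
      rw [← Real.rpow_natCast, ← Real.rpow_mul hq0.le, one_div_mul_cancel (by positivity),
        Real.rpow_one]
    have h3 : q ^ ((k - 1) / L + 1) ≤ (q ^ ((1 : ℝ) / L)) ^ k := by
      calc q ^ ((k - 1) / L + 1) = (q ^ ((1 : ℝ) / L)) ^ (L * ((k - 1) / L + 1)) := by
            rw [pow_mul, h2]
        _ ≤ _ := pow_le_pow_of_le_one (by positivity)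
            (Real.rpow_le_one hq0.le hq1.le (by positivity)) h1
    rw [inv_mul_eq_div, le_div_iff₀ hq0, ← pow_succ]
    exact h3
  calc (E.card : ℝ) ≤ q ^ ((k - 1) / L) * ∑ a ∈ A, (v a.2 : ℝ) := hAc
    _ ≤ _ := mul_le_mul hpow hsum (hmass A) (by positivity)

end IsBallSystem

end Upcrossings

section WordMetric

variable {Γ : Type*} [Group Γ] {S : Set Γ}

theorem wordNorm_le_iff (hS : S.Finite) (hgen : Subgroup.closure S = ⊤) {g : Γ} {r : ℕ} :
    wordNorm S g ≤ r ↔ g ∈ (S ∪ S⁻¹ ∪ {1}) ^ r := by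
  have hT := IsSymmGen.of_closure hS hgen
  have hword : ∀ n, ∀ g ∈ (S ∪ S⁻¹ ∪ {1}) ^ n, ∃ ℓ : List Γ,
      (∀ x ∈ ℓ, x ∈ S ∨ x⁻¹ ∈ S) ∧ ℓ.prod = g ∧ ℓ.length ≤ n := by
    intro n
    induction n with
    | zero => exact fun g hg => ⟨[], by simp, by simpa using hg.symm, le_rfl⟩
    | succ n ih =>
      intro g hg
      rw [pow_succ'] at hg
      obtain ⟨s, hs, w, hw, rfl⟩ := Set.mem_mul.1 hg
      obtain ⟨ℓ, h1, h2, h3⟩ := ih w hw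
      rcases hs with hs | hs
      · refine ⟨s :: ℓ, ?_, by rw [List.prod_cons, h2], by simpa using h3⟩
        rintro x (_ | ⟨_, hx⟩)
        · simpa using hs
        · exact h1 x hx
      · rw [Set.mem_singleton_iff] at hs
        exact ⟨ℓ, h1, by rw [h2, hs, one_mul], by omega⟩
  have hmem : ∀ n, ∀ g ∈ (S ∪ S⁻¹ ∪ {1}) ^ n, wordNorm S g ≤ n := by
    intro n g hg
    obtain ⟨ℓ, h1, h2, h3⟩ := hword n g hg
    refine le_trans (Nat.sInf_le ?_) h3
    exact ⟨ℓ.get, fun i => h1 _ (List.get_mem _ _), by rw [List.ofFn_get, h2]⟩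
  constructor
  · intro h
    obtain ⟨n, hn⟩ := hT.exists_mem_pow g
    obtain ⟨ℓ, h1, h2, -⟩ := hword n g hn
    obtain ⟨f, hf, hg⟩ := Nat.sInf_mem
      (s := {n : ℕ | ∃ f : Fin n → Γ, (∀ i, f i ∈ S ∨ (f i)⁻¹ ∈ S) ∧ g = (List.ofFn f).prod})
      ⟨ℓ.length, ℓ.get, fun i => h1 _ (List.get_mem _ _), by rw [List.ofFn_get, h2]⟩
    refine hT.pow_mono h ?_
    have hlist : ∀ ℓ : List Γ, (∀ x ∈ ℓ, x ∈ S ∨ x⁻¹ ∈ S) →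
        ℓ.prod ∈ (S ∪ S⁻¹ ∪ {1}) ^ ℓ.length := by
      intro ℓ
      induction ℓ with
      | nil => simp
      | cons x ℓ ih =>
        intro h
        rw [List.prod_cons, List.length_cons, pow_succ']
        exact Set.mul_mem_mul (Or.inl (by simpa using h x (by simp)))
          (ih fun y hy => h y (by simp [hy]))
    have := hlist (List.ofFn f) (by simpa [List.mem_ofFn] using hf)
    rw [← hg, List.length_ofFn] at this
    exact this
  · exact fun h => hmem r g h

theorem mem_wordBall_iff (hS : S.Finite) (hgen : Subgroup.closure S = ⊤) {g y : Γ} {r : ℕ} :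
    y ∈ wordBall S g r ↔ g * y⁻¹ ∈ (S ∪ S⁻¹ ∪ {1}) ^ r :=
  wordNorm_le_iff hS hgen

theorem ncard_wordBall (hS : S.Finite) (hgen : Subgroup.closure S = ⊤) (g : Γ) (r : ℕ) :
    (wordBall S g r).ncard = ((S ∪ S⁻¹ ∪ {1}) ^ r).ncard := by
  have : (S ∪ S⁻¹ ∪ {1}) ^ r = (fun y => g * y⁻¹) '' wordBall S g r := by
    ext z
    rw [Set.mem_image]
    constructor
    · intro hz
      exact ⟨z⁻¹ * g, (mem_wordBall_iff hS hgen).2 (by simpa using hz), by group⟩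
    · rintro ⟨y, hy, rfl⟩
      exact (mem_wordBall_iff hS hgen).1 hy
  rw [this, Set.ncard_image_of_injective]
  intro x y hxy
  simpa using hxy

theorem finite_wordBall (hS : S.Finite) (hgen : Subgroup.closure S = ⊤) (g : Γ) (r : ℕ) :
    (wordBall S g r).Finite := by
  refine Set.finite_of_ncard_pos ?_
  rw [ncard_wordBall hS hgen]
  exact (IsSymmGen.of_closure hS hgen).ncard_pow_pos r

theorem isBallSystem_wordBall (hS : S.Finite) (hgen : Subgroup.closure S = ⊤) :
    IsBallSystem (fun x y => wordNorm S (x * y⁻¹))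
      (fun g r => (finite_wordBall hS hgen g r).toFinset)
      (fun r => ((S ∪ S⁻¹ ∪ {1}) ^ r).ncard) := by
  have hT := IsSymmGen.of_closure hS hgen
  have hle : ∀ {g : Γ} {r : ℕ}, wordNorm S g ≤ r ↔ g ∈ (S ∪ S⁻¹ ∪ {1}) ^ r :=
    wordNorm_le_iff hS hgen
  have hinv : ∀ g : Γ, wordNorm S g⁻¹ ≤ wordNorm S g := fun g =>
    hle.2 (hT.inv_mem_pow (hle.1 le_rfl))
  have htri : ∀ g h : Γ, wordNorm S (g * h) ≤ wordNorm S g + wordNorm S h := fun g h =>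
    hle.2 (IsSymmGen.mul_mem_pow (hle.1 le_rfl) (hle.1 le_rfl))
  have htri' : ∀ x y z : Γ,
      wordNorm S (x * z⁻¹) ≤ wordNorm S (x * y⁻¹) + wordNorm S (y * z⁻¹) := fun x y z => by
    have := htri (x * y⁻¹) (y * z⁻¹)
    rwa [show x * y⁻¹ * (y * z⁻¹) = x * z⁻¹ by group] at this
  refine ⟨fun x y => ?_, fun x y => ?_, htri', fun x y a ha => ?_, fun g r y => ?_,
    fun g r => ?_⟩
  · rw [← Nat.le_zero, hle, pow_zero, Set.mem_one, mul_inv_eq_one]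
  · have h1 := hinv (x * y⁻¹)
    have h2 := hinv (y * x⁻¹)
    rw [mul_inv_rev, inv_inv] at h1 h2
    exact le_antisymm h2 h1
  · have h1 : x * y⁻¹ ∈ (S ∪ S⁻¹ ∪ {1}) ^ wordNorm S (x * y⁻¹) := hle.1 le_rfl
    rw [← Nat.add_sub_cancel' ha, pow_add] at h1
    obtain ⟨u, hu, w, hw, huw⟩ := Set.mem_mul.1 h1
    have h2 := hle.2 hu
    have h3 := hle.2 hw
    have h4 := htri' x (u⁻¹ * x) y
    have e1 : x * (u⁻¹ * x)⁻¹ = u := by group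
    have e2 : u⁻¹ * x * y⁻¹ = w := by rw [mul_assoc, ← huw]; group
    rw [e1, e2] at h4
    refine ⟨u⁻¹ * x, ?_, ?_⟩
    · rw [e1]; omega
    · rw [e2]; omega
  · rw [Set.Finite.mem_toFinset]; rfl
  · rw [← Set.ncard_eq_toFinset_card _ (finite_wordBall hS hgen g r), ncard_wordBall hS hgen]

theorem hasGrowth_of_natCard_wordBall_le (hS : S.Finite) (hgen : Subgroup.closure S = ⊤)
    {C : ℝ} {d : ℕ}
    (h : ∀ n : ℕ, 1 ≤ n → (Nat.card (wordBall S 1 n) : ℝ) ≤ C * (n : ℝ) ^ d) :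
    HasGrowth d Γ := by
  have hT := IsSymmGen.of_closure hS hgen
  refine hT.hasGrowth (C := ⌈C⌉₊) fun n => ?_
  have h1 := h (n + 1) (by omega)
  rw [Nat.card_coe_set_eq, ncard_wordBall hS hgen] at h1
  have h2 : (((S ∪ S⁻¹ ∪ {1}) ^ n).ncard : ℝ) ≤ ((S ∪ S⁻¹ ∪ {1}) ^ (n + 1)).ncard := by
    exact_mod_cast hT.ncard_pow_mono (Nat.le_succ n)
  have h3 : (((S ∪ S⁻¹ ∪ {1}) ^ n).ncard : ℝ) ≤ ⌈C⌉₊ * ((n + 1 : ℕ) : ℝ) ^ d :=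
    h2.trans (h1.trans (mul_le_mul_of_nonneg_right (Nat.le_ceil C) (by positivity)))
  exact_mod_cast h3

theorem isBallSubadditive_of_fin (hS : S.Finite) (hgen : Subgroup.closure S = ⊤)
    [DecidableEq Γ] {f : Γ → ℕ → ℝ}
    (hf : ∀ (g : Γ) (r : ℕ) (m : ℕ) (ctr : Fin m → Γ) (rad : Fin m → ℕ),
      (Pairwise fun i i' =>
        Disjoint (wordBall S (ctr i) (rad i)) (wordBall S (ctr i') (rad i'))) →
      wordBall S g r = (⋃ i, wordBall S (ctr i) (rad i)) →
      f g r ≤ ∑ i, f (ctr i) (rad i)) :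
    IsBallSubadditive (fun g r => (finite_wordBall hS hgen g r).toFinset) f := by
  intro g r E hd hE
  have h := hf g r E.card (fun i => (E.equivFin.symm i).1.1) (fun i => (E.equivFin.symm i).1.2)
    (fun i i' hne => by
      have h1 := hd (E.equivFin.symm i).2 (E.equivFin.symm i').2
        (fun h => hne (E.equivFin.symm.injective (Subtype.ext h)))
      have h2 := Finset.disjoint_coe.2 h1
      simpa using h2)
    (by
      ext y
      have h1 := Finset.ext_iff.1 hE y
      rw [Set.Finite.mem_toFinset, Finset.mem_biUnion] at h1
      rw [h1, Set.mem_iUnion]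
      constructor
      · rintro ⟨p, hp, hy⟩
        refine ⟨E.equivFin ⟨p, hp⟩, ?_⟩
        simpa using hy
      · rintro ⟨i, hy⟩
        exact ⟨_, (E.equivFin.symm i).2, by simpa using hy⟩)
  refine h.trans_eq ?_
  rw [Equiv.sum_comp E.equivFin.symm fun p : E => f p.1.1 p.1.2]
  exact Finset.sum_coe_sort E fun p => f p.1 p.2

end WordMetric

theorem measurableSet_hasUpcrossings (α β : ℝ) (k R : ℕ) :
    MeasurableSet {a : ℕ → ℝ | HasUpcrossings a α β k R} := by
  have : {a : ℕ → ℝ | HasUpcrossings a α β k R} = ⋃ L : Finset ℕ, ⋃ U : Finset ℕ,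
      ((⋂ n ∈ L, {a | a n < α}) ∩ ⋂ n ∈ U, {a | β < a n}) ∩
        {_a | ∃ i j : ℕ → ℕ, (∀ m < k, i m < j m ∧ j m ≤ R ∧ i m ∈ L ∧ j m ∈ U) ∧
          ∀ m, m + 1 < k → j m < i (m + 1)} := by
    ext a
    simp only [Set.mem_iUnion, Set.mem_inter_iff, Set.mem_iInter, Set.mem_ofPred_eq]
    constructor
    · rintro ⟨i, j, h1, h2⟩
      refine ⟨(Finset.range k).image i, (Finset.range k).image j, ⟨?_, ?_⟩, i, j, ?_, h2⟩
      · intro n hn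
        obtain ⟨m, hm, rfl⟩ := Finset.mem_image.1 hn
        exact (h1 m (Finset.mem_range.1 hm)).2.2.1
      · intro n hn
        obtain ⟨m, hm, rfl⟩ := Finset.mem_image.1 hn
        exact (h1 m (Finset.mem_range.1 hm)).2.2.2
      · intro m hm
        exact ⟨(h1 m hm).1, (h1 m hm).2.1,
          Finset.mem_image_of_mem _ (Finset.mem_range.2 hm),
          Finset.mem_image_of_mem _ (Finset.mem_range.2 hm)⟩
    · rintro ⟨L, U, ⟨hL, hU⟩, i, j, h1, h2⟩
      exact ⟨i, j, fun m hm => ⟨(h1 m hm).1, (h1 m hm).2.1, hL _ (h1 m hm).2.2.1,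
        hU _ (h1 m hm).2.2.2⟩, h2⟩
  rw [this]
  refine MeasurableSet.iUnion fun L => MeasurableSet.iUnion fun U =>
    ((Finset.measurableSet_biInter _ fun n _ => ?_).inter
      (Finset.measurableSet_biInter _ fun n _ => ?_)).inter (MeasurableSet.const _)
  · exact measurableSet_lt (measurable_pi_apply n) measurable_const
  · exact measurableSet_lt measurable_const (measurable_pi_apply n)

theorem HasUpcrossings.mono {a : ℕ → ℝ} {α β : ℝ} {k R R' : ℕ} (h : R ≤ R') :
    HasUpcrossings a α β k R → HasUpcrossings a α β k R' := by
  rintro ⟨i, j, h1, h2⟩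
  exact ⟨i, j, fun m hm => ⟨(h1 m hm).1, (h1 m hm).2.1.trans h, (h1 m hm).2.2⟩, h2⟩

/-- Kingman-type exponential upcrossing bound for stationary subadditive processes
on groups of polynomial growth. -/
theorem stmt18 {Γ : Type*} [Group Γ] (S : Set Γ) (hSfin : S.Finite)
    (hSgen : Subgroup.closure S = ⊤)
    -- Γ has polynomial growth:
    (hpoly : ∃ (Cg : ℝ) (dg : ℕ), 0 < Cg ∧ ∀ n : ℕ, 1 ≤ n →
      (Nat.card (wordBall S 1 n) : ℝ) ≤ Cg * (n : ℝ) ^ dg)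
    (α β : ℝ) (hαβ : α < β) (C : ℝ) (hC : 0 < C) :
    ∃ c > (0:ℝ), ∃ ρ ∈ Set.Ioo (0:ℝ) 1,
      ∀ (X : Type) (_ : MeasurableSpace X) (P : Measure X), IsProbabilityMeasure P →
      ∀ F : Γ → ℕ → X → ℝ, (∀ g r, Measurable (F g r)) →
      -- stationarity:
      (∀ h : Γ, Measure.map (fun x => fun p : Γ × ℕ => F (p.1 * h) p.2 x) P =
        Measure.map (fun x => fun p : Γ × ℕ => F p.1 p.2 x) P) →
      -- subadditivity: if a ball is a disjoint union of balls, then S_V ≤ ∑ S_{V_i}: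
      (∀ (g : Γ) (r : ℕ) (m : ℕ) (ctr : Fin m → Γ) (rad : Fin m → ℕ),
        (Pairwise fun i i' =>
          Disjoint (wordBall S (ctr i) (rad i)) (wordBall S (ctr i') (rad i'))) →
        wordBall S g r = (⋃ i, wordBall S (ctr i) (rad i)) →
        ∀ x : X, F g r x ≤ ∑ i, F (ctr i) (rad i) x) →
      -- S_{B(e,0)} ≤ C almost surely:
      (∀ᵐ x ∂P, F 1 0 x ≤ C) →
      ∀ k : ℕ, 1 ≤ k →
      P {x | ∃ i j : ℕ → ℕ,
          (∀ m < k, i m < j m ∧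
            F 1 (i m) x / (Nat.card (wordBall S 1 (i m)) : ℝ) < α ∧
            β < F 1 (j m) x / (Nat.card (wordBall S 1 (j m)) : ℝ)) ∧
          (∀ m, m + 1 < k → j m < i (m + 1))}
        ≤ ENNReal.ofReal (c * ρ ^ k) := by
  classical
  obtain ⟨Cg, dg, -, hgrow⟩ := hpoly
  have hT := IsSymmGen.of_closure hSfin hSgen
  have hfg : Group.FG Γ := hT.fg
  have hΓ : Countable Γ := hT.countable
  have hB := isBallSystem_wordBall hSfin hSgen
  obtain ⟨K, hK⟩ := (hasGrowth_of_natCard_wordBall_le hSfin hSgen hgrow).hasDoubling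
    _ (hT.finite_pow 2) _ hT
  simp only [← pow_mul] at hK
  set v : ℕ → ℕ := fun r => ((S ∪ S⁻¹ ∪ {1}) ^ r).ncard with hv
  have hcard : ∀ r, Nat.card (wordBall S 1 r) = v r := fun r => by
    rw [Nat.card_coe_set_eq, ncard_wordBall hSfin hSgen]
  obtain ⟨c, hc, ρ, hρ, hbound⟩ := hB.exists_card_upcrossings_le hK hαβ
    (lt_max_of_lt_right (lt_add_one β) : β < max C (β + 1))
  refine ⟨c * (K + 1), by positivity, ρ, hρ, ?_⟩
  intro X _ P hP F hF hstat hsub hF0 k hk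
  have hρ0 := hρ.1
  have hmeas : ∀ h : Γ, Measurable fun x => fun p : Γ × ℕ => F (p.1 * h) p.2 x := fun h =>
    measurable_pi_lambda _ fun p => hF _ _
  have hmeas1 : Measurable fun x => fun p : Γ × ℕ => F p.1 p.2 x :=
    measurable_pi_lambda _ fun p => hF _ _
  set A : ℕ → Γ → Set X := fun R g => {x | HasUpcrossings (fun n => F g n x / v n) α β k R}
    with hA
  have hAmeas : ∀ R g, MeasurableSet (A R g) := by
    intro R g
    have h1 : Measurable fun x => fun n => F g n x / (v n : ℝ) :=
      measurable_pi_lambda _ fun n => (hF g n).div_const _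
    exact h1 (measurableSet_hasUpcrossings α β k R)
  have hAinv : ∀ R g, P (A R g) = P (A R 1) := by
    intro R g
    set W : Set (Γ × ℕ → ℝ) := {ω | HasUpcrossings (fun n => ω (1, n) / v n) α β k R} with hW
    have h2 : Measurable fun ω : Γ × ℕ → ℝ => fun n => ω (1, n) / (v n : ℝ) :=
      measurable_pi_lambda _ fun n => (measurable_pi_apply (1, n)).div_const _
    have hWmeas : MeasurableSet W := h2 (measurableSet_hasUpcrossings α β k R)
    have h1 := congrArg (fun μ => μ W) (hstat g)
    simp only [Measure.map_apply (hmeas g) hWmeas, Measure.map_apply hmeas1 hWmeas] at h1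
    have e1 : A R g = (fun x => fun p : Γ × ℕ => F (p.1 * g) p.2 x) ⁻¹' W := by
      ext x
      simp [hA, hW]
    rw [e1, h1]
    rfl
  have hF0' : ∀ᵐ x ∂P, ∀ g, F g 0 x ≤ max C (β + 1) := by
    rw [ae_all_iff]
    intro g
    have hs : MeasurableSet {ω : Γ × ℕ → ℝ | ω (1, 0) ≤ C} :=
      measurableSet_le (measurable_pi_apply _) measurable_const
    have h1 : ∀ᵐ ω ∂Measure.map (fun x => fun p : Γ × ℕ => F p.1 p.2 x) P, ω (1, 0) ≤ C :=
      (ae_map_iff hmeas1.aemeasurable hs).2 hF0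
    rw [← hstat g, ae_map_iff (hmeas g).aemeasurable hs] at h1
    filter_upwards [h1] with x hx
    rw [one_mul] at hx
    exact hx.trans (le_max_left _ _)
  have hAbound : ∀ R, P (A R 1) ≤ ENNReal.ofReal (c * (K + 1) * ρ ^ k) := by
    intro R
    set N : Finset Γ := (finite_wordBall hSfin hSgen 1 R).toFinset with hN
    have hNcard : N.card = v R := hB.card 1 R
    have hvR : 0 < v R := hB.pos R
    have hsum : (v R : ENNReal) * P (A R 1) ≤ ENNReal.ofReal (c * ρ ^ k * v (R + R)) := by
      calc (v R : ENNReal) * P (A R 1) = ∑ g ∈ N, P (A R g) := by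
            rw [Finset.sum_congr rfl fun g _ => hAinv R g, Finset.sum_const, hNcard,
              nsmul_eq_mul]
        _ = ∫⁻ x, ∑ g ∈ N, (A R g).indicator 1 x ∂P := by
            rw [lintegral_finsetSum _ fun g _ => measurable_one.indicator (hAmeas R g)]
            exact Finset.sum_congr rfl fun g _ => (lintegral_indicator_one (hAmeas R g)).symm
        _ ≤ ∫⁻ _, ENNReal.ofReal (c * ρ ^ k * v (R + R)) ∂P := by
            refine lintegral_mono_ae ?_
            filter_upwards [hF0'] with x hx
            have h1 := hbound (fun g r => F g r x)
              (isBallSubadditive_of_fin hSfin hSgen fun g r m ctr rad h1 h2 =>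
                hsub g r m ctr rad h1 h2 x) hx k R R 1 (N.filter fun g => x ∈ A R g) hk
              (Finset.filter_subset _ _) fun g hg => (Finset.mem_filter.1 hg).2
            have h2 : ∑ g ∈ N, (A R g).indicator (1 : X → ENNReal) x =
                ((N.filter fun g => x ∈ A R g).card : ENNReal) := by
              rw [Finset.card_filter, Nat.cast_sum]
              refine Finset.sum_congr rfl fun g _ => ?_
              by_cases h : x ∈ A R g <;> simp [h]
            rw [h2, ← ENNReal.ofReal_natCast]
            exact ENNReal.ofReal_le_ofReal h1
        _ = _ := by simp
    have hK' : (v (R + R) : ℝ) ≤ (K + 1) * v R := by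
      have h1 : v (R + R) ≤ (K + 1) * v R := by
        rw [← two_mul]
        exact (hK R).trans (Nat.mul_le_mul_right _ (Nat.le_succ K))
      exact_mod_cast h1
    have h3 : (v R : ENNReal) * P (A R 1) ≤
        v R * ENNReal.ofReal (c * (K + 1) * ρ ^ k) := by
      refine hsum.trans ?_
      rw [← ENNReal.ofReal_natCast, ← ENNReal.ofReal_mul (Nat.cast_nonneg _)]
      refine ENNReal.ofReal_le_ofReal ?_
      calc c * ρ ^ k * v (R + R) ≤ c * ρ ^ k * ((K + 1) * v R) := by gcongr
        _ = _ := by ring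
    exact (ENNReal.mul_le_mul_iff_right (by exact_mod_cast hvR.ne')
      (ENNReal.natCast_ne_top _)).1 h3
  have hmono : Monotone fun R => A R 1 := by
    intro R R' h x hx
    have h1 : HasUpcrossings (fun n => F 1 n x / v n) α β k R := hx
    exact h1.mono h
  calc _ ≤ P (⋃ R, A R 1) := by
        refine measure_mono ?_
        rintro x ⟨i, j, h1, h2⟩
        rw [Set.mem_iUnion]
        refine ⟨(Finset.range k).sup j, i, j, fun m hm => ?_, h2⟩
        have h3 := h1 m hm
        rw [hcard, hcard] at h3
        exact ⟨h3.1, Finset.le_sup (Finset.mem_range.2 hm), h3.2⟩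
    _ = ⨆ R, P (A R 1) := hmono.measure_iUnion
    _ ≤ _ := iSup_le hAbound
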